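/- arXiv:2209.12470 — 5 statements merged into one kernel-verified Lean document; each statement's English description precedes it below -/
import Mathlib

section
/- For all n1, n2, n3, n4 ∈ ℕ and all parameters ν = (ν_{mr}) ∈ k^{n1×n4}, γ = (γ_{qs}) ∈ k^{n2×n3}, λ = (λ_m) ∈ k^{n1}, μ = (μ_q) ∈ k^{n2}, α = (α_s) ∈ k^{n3}, β = (β_r) ∈ k^{n4}, the algebra U_9(n1,n2,n3,n4; ν,γ,λ,μ,α,β) has dimension 2^{6+n1+n2+n3+n4} over k; a k-basis is given by the images of the products p1^{i} p2^{j} (∏_m E_m^{ε_m})(∏_q F_q^{φ_q})(∏_s G_s^{σ_s})(∏_r H_r^{ρ_r}) a^e b^f c^g d^h with all exponents in {0,1} and factors taken in increasing index order. -/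
namespace Stmt5

/-- The generators `a, b, c, d, p1, p2` and the families `E, F, G, H`. -/
inductive Gen (n1 n2 n3 n4 : ℕ)
  | a | b | c | d | p1 | p2
  | E (m : Fin n1) | F (q : Fin n2) | G (s : Fin n3) | H (r : Fin n4)

open Gen

variable (k : Type*) [Field k]
variable (xi : k) (n1 n2 n3 n4 : ℕ) (nu : Matrix (Fin n1) (Fin n4) k)
  (gam : Matrix (Fin n2) (Fin n3) k) (lam : Fin n1 → k) (mu : Fin n2 → k)
  (alp : Fin n3 → k) (bet : Fin n4 → k)

/-- The generators viewed inside the free algebra. -/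
abbrev g {n1 n2 n3 n4 : ℕ} (x : Gen n1 n2 n3 n4) : FreeAlgebra k (Gen n1 n2 n3 n4) :=
  FreeAlgebra.ι k x

/-- The defining relations of `U_9(n1,n2,n3,n4; ν,γ,λ,μ,α,β)`. -/
inductive Rel : FreeAlgebra k (Gen n1 n2 n3 n4) → FreeAlgebra k (Gen n1 n2 n3 n4) → Prop
  -- H-relations
  | haa : Rel (g k a * g k a) 1
  | hbb : Rel (g k b * g k b) 1
  | hcc : Rel (g k c * g k c) 1
  | hab : Rel (g k a * g k b) (g k b * g k a)
  | hac : Rel (g k a * g k c) (g k c * g k a)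
  | hbc : Rel (g k b * g k c) (g k c * g k b)
  | hdd : Rel (g k d * g k d) (g k a)
  | hda : Rel (g k d * g k a) (g k a * g k d)
  | hdb : Rel (g k d * g k b) (g k c * g k d)
  | hdc : Rel (g k d * g k c) (g k b * g k d)
  | aE (m : Fin n1) : Rel (g k a * g k (E m)) (-(g k (E m) * g k a))
  | bE (m : Fin n1) : Rel (g k b * g k (E m)) (-(g k (E m) * g k b))
  | cE (m : Fin n1) : Rel (g k c * g k (E m)) (-(g k (E m) * g k c))
  | dE (m : Fin n1) : Rel (g k d * g k (E m)) (-(xi • (g k (E m) * g k d)))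
  | aF (q : Fin n2) : Rel (g k a * g k (F q)) (-(g k (F q) * g k a))
  | bF (q : Fin n2) : Rel (g k b * g k (F q)) (-(g k (F q) * g k b))
  | cF (q : Fin n2) : Rel (g k c * g k (F q)) (-(g k (F q) * g k c))
  | dF (q : Fin n2) : Rel (g k d * g k (F q)) (xi • (g k (F q) * g k d))
  | aG (s : Fin n3) : Rel (g k a * g k (G s)) (-(g k (G s) * g k a))
  | bG (s : Fin n3) : Rel (g k b * g k (G s)) (-(g k (G s) * g k b))
  | cG (s : Fin n3) : Rel (g k c * g k (G s)) (-(g k (G s) * g k c))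
  | dG (s : Fin n3) : Rel (g k d * g k (G s)) (-(xi • (g k (G s) * g k d)))
  | aH (r : Fin n4) : Rel (g k a * g k (H r)) (-(g k (H r) * g k a))
  | bH (r : Fin n4) : Rel (g k b * g k (H r)) (-(g k (H r) * g k b))
  | cH (r : Fin n4) : Rel (g k c * g k (H r)) (-(g k (H r) * g k c))
  | dH (r : Fin n4) : Rel (g k d * g k (H r)) (xi • (g k (H r) * g k d))
  | EE (i i' : Fin n1) : Rel (g k (E i) * g k (E i') + g k (E i') * g k (E i)) (0)
  | FF (i i' : Fin n2) : Rel (g k (F i) * g k (F i') + g k (F i') * g k (F i)) (0)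
  | GG (i i' : Fin n3) : Rel (g k (G i) * g k (G i') + g k (G i') * g k (G i)) (0)
  | HH (i i' : Fin n4) : Rel (g k (H i) * g k (H i') + g k (H i') * g k (H i)) (0)
  | EH (i : Fin n1) (i' : Fin n4) : Rel (g k (E i) * g k (H i') + g k (H i') * g k (E i)) (nu i i' • (1 - g k b * g k c))
  | FG (i : Fin n2) (i' : Fin n3) : Rel (g k (F i) * g k (G i') + g k (G i') * g k (F i)) (gam i i' • (1 - g k b * g k c))
  | EF (i : Fin n1) (i' : Fin n2) : Rel (g k (E i) * g k (F i') + g k (F i') * g k (E i)) (0)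
  | EG (i : Fin n1) (i' : Fin n3) : Rel (g k (E i) * g k (G i') + g k (G i') * g k (E i)) (0)
  | FH (i : Fin n2) (i' : Fin n4) : Rel (g k (F i) * g k (H i') + g k (H i') * g k (F i)) (0)
  | GH (i : Fin n3) (i' : Fin n4) : Rel (g k (G i) * g k (H i') + g k (H i') * g k (G i)) (0)
  -- relations involving p1, p2
  | ap1 : Rel (g k a * g k p1) (-(g k p1 * g k a))
  | bp1 : Rel (g k b * g k p1) (-(g k p1 * g k b))
  | cp1 : Rel (g k c * g k p1) (-(g k p1 * g k c))
  | dp1 : Rel (g k d * g k p1) (g k p2 * g k d)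
  | ap2 : Rel (g k a * g k p2) (-(g k p2 * g k a))
  | bp2 : Rel (g k b * g k p2) (-(g k p2 * g k b))
  | cp2 : Rel (g k c * g k p2) (-(g k p2 * g k c))
  | dp2 : Rel (g k d * g k p2) (-(g k p1 * g k d))
  | p1p1 : Rel (g k p1 * g k p1) 0
  | p2p2 : Rel (g k p2 * g k p2) 0
  | p1p2 : Rel (g k p1 * g k p2 + g k p2 * g k p1) 0
  | p1E (m : Fin n1) : Rel (g k p1 * g k (E m) + g k (E m) * g k p1) (lam m • (1 - g k a * g k b))
  | p2E (m : Fin n1) : Rel (g k p2 * g k (E m) + g k (E m) * g k p2) ((xi * lam m) • (1 - g k a * g k c))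
  | p1F (q : Fin n2) : Rel (g k p1 * g k (F q) + g k (F q) * g k p1) (mu q • (1 - g k a * g k b))
  | p2F (q : Fin n2) : Rel (g k p2 * g k (F q) + g k (F q) * g k p2) ((-(xi * mu q)) • (1 - g k a * g k c))
  | p1G (s : Fin n3) : Rel (g k p1 * g k (G s) + g k (G s) * g k p1) (alp s • (1 - g k a * g k c))
  | p2G (s : Fin n3) : Rel (g k p2 * g k (G s) + g k (G s) * g k p2) ((xi * alp s) • (1 - g k a * g k b))
  | p1H (r : Fin n4) : Rel (g k p1 * g k (H r) + g k (H r) * g k p1) (bet r • (1 - g k a * g k c))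
  | p2H (r : Fin n4) : Rel (g k p2 * g k (H r) + g k (H r) * g k p2) ((-(xi * bet r)) • (1 - g k a * g k b))

/-- The algebra `U_9(n1,n2,n3,n4; ν,γ,λ,μ,α,β)`. -/
abbrev U := RingQuot (Rel k xi n1 n2 n3 n4 nu gam lam mu alp bet)

/-- The quotient map. -/
noncomputable abbrev mk : FreeAlgebra k (Gen n1 n2 n3 n4) →ₐ[k] U k xi n1 n2 n3 n4 nu gam lam mu alp bet :=
  RingQuot.mkAlgHom k (Rel k xi n1 n2 n3 n4 nu gam lam mu alp bet)

/-- The image of the monomial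
`p1^i p2^j (∏ E_m^{ε_m})(∏ F_q^{φ_q})(∏ G_s^{σ_s})(∏ H_r^{ρ_r}) a^e b^f c^g d^h`,
with factors of each family taken in increasing index order. -/
noncomputable def mono
    (x : (Fin 2 × Fin 2) × (Fin n1 → Fin 2) × (Fin n2 → Fin 2) × (Fin n3 → Fin 2) ×
      (Fin n4 → Fin 2) × Fin 2 × Fin 2 × Fin 2 × Fin 2) : U k xi n1 n2 n3 n4 nu gam lam mu alp bet :=
  match x with
  | ⟨⟨i, j⟩, eE, eF, eG, eH, ea, eb, ec, ed⟩ =>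
    mk k xi n1 n2 n3 n4 nu gam lam mu alp bet
      (g k p1 ^ i.val * g k p2 ^ j.val *
        (List.ofFn fun m => g k (E m) ^ (eE m).val).prod *
        (List.ofFn fun q => g k (F q) ^ (eF q).val).prod *
        (List.ofFn fun s => g k (G s) ^ (eG s).val).prod *
        (List.ofFn fun r => g k (H r) ^ (eH r).val).prod *
        g k a ^ ea.val * g k b ^ eb.val * g k c ^ ec.val * g k d ^ ed.val)

section Tower

variable {k A : Type*} [Field k] [Ring A] [Algebra k A]

/-- The span of the ordered products of subsets of the list `L`, multiplied on the right by
elements of `S`. -/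
def tower (L : List A) (S : Submodule k A) : Submodule k A :=
  L.foldr (fun x T => T ⊔ T.map (LinearMap.mulLeft k x)) S

lemma tower_cons (x : A) (L : List A) (S : Submodule k A) :
    tower (x :: L) S = tower L S ⊔ (tower L S).map (LinearMap.mulLeft k x) := rfl

lemma tower_append (L L' : List A) (S : Submodule k A) :
    tower (L ++ L') S = tower L (tower L' S) := by
  simp [tower]

lemma mem_tower_cons {x : A} {L : List A} {S : Submodule k A} {s : A} :
    s ∈ tower (x :: L) S ↔ ∃ u ∈ tower L S, ∃ v ∈ tower L S, u + x * v = s := by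
  simp [tower_cons, Submodule.mem_sup]

lemma tower_le_tower_cons (x : A) (L : List A) (S : Submodule k A) :
    tower L S ≤ tower (x :: L) S := le_sup_left

lemma mul_mem_tower_cons_self {x : A} {L : List A} {S : Submodule k A} {s : A}
    (hs : s ∈ tower L S) : x * s ∈ tower (x :: L) S :=
  mem_tower_cons.2 ⟨0, zero_mem _, s, hs, by simp⟩

lemma le_tower (L : List A) (S : Submodule k A) : S ≤ tower L S := by
  induction L with
  | nil => exact le_rfl
  | cons x L ih => exact ih.trans (tower_le_tower_cons x L S)

lemma tower_mono (L : List A) {S T : Submodule k A} (h : S ≤ T) : tower L S ≤ tower L T := by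
  induction L with
  | nil => exact h
  | cons x L ih => exact sup_le_sup ih (Submodule.map_mono ih)

lemma smul_comm_mul_mem_tower {y : A} {L : List A} {S : Submodule k A}
    (hS : ∀ s ∈ S, y * s ∈ S) (hL : ∀ x ∈ L, ∃ c : k, y * x = c • (x * y)) :
    ∀ s ∈ tower L S, y * s ∈ tower L S := by
  induction L with
  | nil => exact hS
  | cons x L ih =>
    have ih := ih fun z hz => hL z (List.mem_cons_of_mem _ hz)
    intro s hs
    obtain ⟨u, hu, v, hv, rfl⟩ := mem_tower_cons.1 hs
    obtain ⟨c, hc⟩ := hL x List.mem_cons_self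
    refine mem_tower_cons.2 ⟨y * u, ih u hu, c • (y * v), Submodule.smul_mem _ _ (ih v hv), ?_⟩
    rw [mul_add, ← mul_assoc y x v, hc]
    simp [mul_assoc]

lemma mul_mem_tower {L : List A} {S : Submodule k A} (hsq : ∀ x ∈ L, x * x = 0)
    (hL : ∀ x ∈ L, ∀ y ∈ L, ∃ z : A, x * y + y * x = z ∧ (∀ s ∈ S, z * s ∈ S) ∧
      ∀ w ∈ L, z * w = w * z) :
    ∀ y ∈ L, ∀ s ∈ tower L S, y * s ∈ tower L S := by
  induction L with
  | nil => simp
  | cons x L ih =>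
    have ih := ih (fun z hz => hsq z (List.mem_cons_of_mem _ hz)) fun y hy z hz => by
      obtain ⟨w, h1, h2, h3⟩ := hL y (List.mem_cons_of_mem _ hy) z (List.mem_cons_of_mem _ hz)
      exact ⟨w, h1, h2, fun t ht => h3 t (List.mem_cons_of_mem _ ht)⟩
    intro y hy s hs
    obtain ⟨u, hu, v, hv, rfl⟩ := mem_tower_cons.1 hs
    rcases List.mem_cons.1 hy with rfl | hy
    · rw [mul_add, ← mul_assoc, hsq y List.mem_cons_self, zero_mul, add_zero]
      exact mul_mem_tower_cons_self hu
    · obtain ⟨z, h1, h2, h3⟩ := hL y (List.mem_cons_of_mem _ hy) x List.mem_cons_self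
      have hz : z * v ∈ tower L S := smul_comm_mul_mem_tower h2
        (fun w hw => ⟨1, by rw [h3 w (List.mem_cons_of_mem _ hw), one_smul]⟩) v hv
      refine mem_tower_cons.2 ⟨y * u + z * v, add_mem (ih y hy u hu) hz, -(y * v),
        neg_mem (ih y hy v hv), ?_⟩
      rw [← h1]
      noncomm_ring

lemma tower_ofFn_le {ι : Type*} {n : ℕ} (f : Fin n → A) (t : ι → A) :
    tower (List.ofFn f) (Submodule.span k (Set.range t)) ≤
      Submodule.span k (Set.range fun p : (Fin n → Fin 2) × ι =>
        (List.ofFn fun i => f i ^ (p.1 i).val).prod * t p.2) := by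
  induction n with
  | zero =>
    refine Submodule.span_mono ?_
    rintro _ ⟨i, rfl⟩
    exact ⟨(0, i), by simp⟩
  | succ n ih =>
    rw [List.ofFn_succ, tower_cons]
    refine sup_le ((ih _).trans (Submodule.span_mono ?_))
      ((Submodule.map_mono (ih _)).trans ?_)
    · rintro _ ⟨⟨e, i⟩, rfl⟩
      exact ⟨(Fin.cons 0 e, i), by simp [List.ofFn_succ]⟩
    · rw [Submodule.map_span_le]
      rintro _ ⟨⟨e, i⟩, rfl⟩
      exact Submodule.subset_span ⟨(Fin.cons 1 e, i), by simp [List.ofFn_succ, mul_assoc]⟩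

end Tower

section Group

variable {k A : Type*} [Field k] [Ring A] [Algebra k A] {a b c d : A}

/-- The span of the normally ordered monomials in `a, b, c, d`. -/
def groupSpan (k : Type*) {A : Type*} [Field k] [Ring A] [Algebra k A] (a b c d : A) :
    Submodule k A :=
  Submodule.span k (Set.range fun p : Fin 2 × Fin 2 × Fin 2 × Fin 2 =>
    a ^ p.1.val * b ^ p.2.1.val * c ^ p.2.2.1.val * d ^ p.2.2.2.val)

lemma pow_mem_groupSpan (ha : a * a = 1) (hb : b * b = 1) (hc : c * c = 1)
    (e f g : ℕ) (h : Fin 2) : a ^ e * b ^ f * c ^ g * d ^ h.val ∈ groupSpan k a b c d := by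
  have key {x : A} (hx : x * x = 1) (n : ℕ) : x ^ n = x ^ (n % 2) :=
    pow_eq_pow_mod n (by rw [pow_two, hx])
  rw [key ha, key hb, key hc]
  exact Submodule.subset_span ⟨(⟨e % 2, Nat.mod_lt _ two_pos⟩, ⟨f % 2, Nat.mod_lt _ two_pos⟩,
    ⟨g % 2, Nat.mod_lt _ two_pos⟩, h), rfl⟩

lemma mul_mem_groupSpan (ha : a * a = 1) (hb : b * b = 1) (hc : c * c = 1)
    (hab : Commute a b) (hac : Commute a c) (hbc : Commute b c) (hdd : d * d = a)
    (hda : Commute d a) (hdb : d * b = c * d) (hdc : d * c = b * d) :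
    ∀ y ∈ ({a, b, c, d} : Set A), ∀ s ∈ groupSpan k a b c d, y * s ∈ groupSpan k a b c d := by
  intro y hy s hs
  suffices h : groupSpan k a b c d ≤ (groupSpan k a b c d).comap (LinearMap.mulLeft k y) from h hs
  refine Submodule.span_le.2 ?_
  rintro _ ⟨⟨e, f, g, h⟩, rfl⟩
  change y * (a ^ e.val * b ^ f.val * c ^ g.val * d ^ h.val) ∈ groupSpan k a b c d
  have hm := pow_mem_groupSpan (k := k) (d := d) ha hb hc
  rcases hy with rfl | rfl | rfl | rfl
  · simpa [pow_succ', mul_assoc] using hm (e + 1) f g h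
  · have := hm e (f + 1) g h
    rw [pow_succ'] at this
    simpa only [mul_assoc, ← (hab.pow_left e.val).left_comm] using this
  · have := hm e f (g + 1) h
    rw [pow_succ'] at this
    simpa only [mul_assoc, ← (hac.pow_left e.val).left_comm, ← (hbc.pow_left f.val).left_comm]
      using this
  · have hb' : y * b ^ f.val = c ^ f.val * y := (show SemiconjBy y b c from hdb).pow_right f.val
    have hc' : y * c ^ g.val = b ^ g.val * y := (show SemiconjBy y c b from hdc).pow_right g.val
    have e1 : y * (a ^ e.val * b ^ f.val * c ^ g.val * y ^ h.val) =
        a ^ e.val * b ^ g.val * c ^ f.val * y ^ (h.val + 1) := by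
      have h1 : y * a ^ e.val = a ^ e.val * y := hda.pow_right e.val
      have h2 : c ^ f.val * b ^ g.val = b ^ g.val * c ^ f.val := (hbc.pow_pow _ _).symm
      calc _ = (y * a ^ e.val) * b ^ f.val * c ^ g.val * y ^ h.val := by noncomm_ring
        _ = a ^ e.val * (y * b ^ f.val) * c ^ g.val * y ^ h.val := by rw [h1]; noncomm_ring
        _ = a ^ e.val * c ^ f.val * (y * c ^ g.val) * y ^ h.val := by rw [hb']; noncomm_ring
        _ = a ^ e.val * (c ^ f.val * b ^ g.val) * (y * y ^ h.val) := by rw [hc']; noncomm_ring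
        _ = _ := by rw [h2, pow_succ', ← mul_assoc (a ^ e.val)]
    rw [e1]
    fin_cases h
    · exact hm e g f 1
    · have := hm (e + 1) g f 0
      have h3 : c ^ f.val * a = a * c ^ f.val := (hac.pow_right _).symm
      have h4 : b ^ g.val * a = a * b ^ g.val := (hab.pow_right _).symm
      have e2 : a ^ e.val * b ^ g.val * c ^ f.val * y ^ (1 + 1) =
          a ^ (e.val + 1) * b ^ g.val * c ^ f.val * y ^ (0 : Fin 2).val := by
        rw [pow_two, hdd, mul_assoc, h3, ← mul_assoc, mul_assoc _ _ a, h4, ← mul_assoc, pow_succ]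
        simp
      simpa only [e2] using this

end Group

section Fock

variable {k V X : Type*} [Field k] [AddCommGroup V] [Module k V]

/-- Left contraction on the exterior algebra. -/
noncomputable def contract (φ : Module.Dual k V) : Module.End k (ExteriorAlgebra k V) :=
  CliffordAlgebra.contractLeft (Q := (0 : QuadraticForm k V)) φ

lemma contract_ι_mul (φ : Module.Dual k V) (v : V) (w : ExteriorAlgebra k V) :
    contract φ (ExteriorAlgebra.ι k v * w) =
      φ v • w - ExteriorAlgebra.ι k v * contract φ w :=
  CliffordAlgebra.contractLeft_ι_mul (Q := (0 : QuadraticForm k V)) _ _ _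

lemma contract_contract (φ ψ : Module.Dual k V) (w : ExteriorAlgebra k V) :
    contract φ (contract ψ w) = -contract ψ (contract φ w) :=
  CliffordAlgebra.contractLeft_comm _ _ _

lemma contract_add (φ ψ : Module.Dual k V) : contract (φ + ψ) = contract φ + contract ψ :=
  map_add _ _ _

lemma contract_smul (c : k) (φ : Module.Dual k V) : contract (c • φ) = c • contract φ :=
  map_smul _ _ _

lemma map_contract (T : V →ₗ[k] V) (φ ψ : Module.Dual k V) (h : ψ ∘ₗ T = φ)
    (w : ExteriorAlgebra k V) :
    ExteriorAlgebra.map T (contract φ w) = contract ψ (ExteriorAlgebra.map T w) := by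
  induction w using CliffordAlgebra.left_induction with
  | algebraMap r => simp [contract, CliffordAlgebra.contractLeft_algebraMap]
  | add x y hx hy => simp [hx, hy]
  | ι_mul x m hx =>
    change ExteriorAlgebra.map T (contract φ (ExteriorAlgebra.ι k m * x)) =
      contract ψ (ExteriorAlgebra.map T (ExteriorAlgebra.ι k m * x))
    have h1 : ψ (T m) = φ m := by rw [← h]; rfl
    rw [contract_ι_mul, map_sub, map_smul, map_mul, map_mul, hx, ExteriorAlgebra.map_apply_ι,
      contract_ι_mul, h1]

/-- The operator on functions with values in the exterior algebra which translates along `σ` and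
acts on the values by `T`. -/
noncomputable def twist (T : V →ₗ[k] V) (σ : X → X) :
    Module.End k (X → ExteriorAlgebra k V) :=
  (ExteriorAlgebra.map T).toLinearMap.compLeft X ∘ₗ LinearMap.funLeft k _ σ

@[simp] lemma twist_apply (T : V →ₗ[k] V) (σ : X → X) (f : X → ExteriorAlgebra k V) (x : X) :
    twist T σ f x = ExteriorAlgebra.map T (f (σ x)) := rfl

lemma twist_mul (T T' : V →ₗ[k] V) (σ σ' : X → X) :
    twist T σ * twist T' σ' = twist (T ∘ₗ T') (σ' ∘ σ) := by
  ext f x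
  simp [← ExteriorAlgebra.map_comp_map]

/-- Translation along `σ`. -/
noncomputable def shift (σ : X → X) : Module.End k (X → ExteriorAlgebra k V) :=
  LinearMap.funLeft k _ σ

@[simp] lemma shift_apply (σ : X → X) (f : X → ExteriorAlgebra k V) (x : X) :
    shift σ f x = f (σ x) := rfl

variable {I : Type*} [Fintype I]

/-- Exterior multiplication by `v`, followed by contractions along the `φ i` weighted by
`1 - shift (s i)`. -/
noncomputable def vec (s : I → X → X) (v : V) (φ : I → Module.Dual k V) :
    Module.End k (X → ExteriorAlgebra k V) :=
  (LinearMap.mulLeft k (ExteriorAlgebra.ι k v)).compLeft X +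
    ∑ i, (contract (φ i)).compLeft X *
      (1 - shift (s i))

lemma vec_apply (s : I → X → X) (v : V) (φ : I → Module.Dual k V)
    (f : X → ExteriorAlgebra k V) (x : X) :
    vec s v φ f x = ExteriorAlgebra.ι k v * f x +
      ∑ i, contract (φ i)
        (f x - f (s i x)) := by
  simp [vec, LinearMap.sum_apply]

lemma vec_add (s : I → X → X) (v w : V) (φ ψ : I → Module.Dual k V) :
    vec s (v + w) (φ + ψ) = vec s v φ + vec s w ψ := by
  ext f x
  simp only [vec_apply, map_add, add_mul, contract_add, Pi.add_apply, LinearMap.add_apply,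
    Finset.sum_add_distrib]
  abel

lemma vec_smul (s : I → X → X) (c : k) (v : V) (φ : I → Module.Dual k V) :
    vec s (c • v) (c • φ) = c • vec s v φ := by
  ext f x
  simp only [vec_apply, map_smul, smul_mul_assoc, contract_smul, Pi.smul_apply,
    LinearMap.smul_apply, Finset.smul_sum, smul_add]

lemma twist_mul_vec (T : V →ₗ[k] V) (σ : X → X) (s : I → X → X) (π : Equiv.Perm I)
    (hs : ∀ i x, s i (σ x) = σ (s (π i) x)) {v w : V} {φ ψ : I → Module.Dual k V}
    (hv : T v = w) (hφ : ∀ i, ψ (π i) ∘ₗ T = φ i) :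
    twist T σ * vec s v φ = vec s w ψ * twist T σ := by
  ext f x
  simp only [Module.End.mul_apply, vec_apply, twist_apply, map_add, map_mul, map_sum,
    ExteriorAlgebra.map_apply_ι, hv, hs]
  congr 1
  simp only [map_sub, map_contract T _ _ (hφ _)]
  exact Equiv.sum_comp π fun i => contract (ψ i) (ExteriorAlgebra.map T (f (σ x))) -
    contract (ψ i) (ExteriorAlgebra.map T (f (σ (s i x))))

lemma vec_mul_vec_add (s : I → X → X) (hs : ∀ i j x, s i (s j x) = s j (s i x)) (v w : V)
    (φ ψ : I → Module.Dual k V) :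
    vec s v φ * vec s w ψ + vec s w ψ * vec s v φ =
      ∑ i, (φ i w + ψ i v) • (1 - shift (s i)) := by
  set L : V → Module.End k (X → ExteriorAlgebra k V) := fun v =>
    (LinearMap.mulLeft k (ExteriorAlgebra.ι k v)).compLeft X
  set K : Module.Dual k V → Module.End k (X → ExteriorAlgebra k V) := fun φ =>
    (contract φ).compLeft X
  set S : I → Module.End k (X → ExteriorAlgebra k V) := fun i => 1 - shift (s i)
  have hLL : ∀ v w, L v * L w = -(L w * L v) := fun v w => by
    refine LinearMap.ext fun f => funext fun x => ?_
    have := eq_neg_of_add_eq_zero_left (ExteriorAlgebra.ι_add_mul_swap (R := k) v w)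
    simp [L, ← mul_assoc, this]
  have hKL : ∀ φ v, K φ * L v = φ v • 1 - L v * K φ := fun φ v =>
    LinearMap.ext fun f => funext fun x => contract_ι_mul φ v (f x)
  have hKK : ∀ φ ψ, K φ * K ψ + K ψ * K φ = 0 := fun φ ψ =>
    LinearMap.ext fun f => funext fun x => by simp [K, contract_contract φ ψ]
  have hSL : ∀ i v, S i * L v = L v * S i := fun i v => by
    refine LinearMap.ext fun f => funext fun x => ?_
    simp [S, L, mul_sub]
  have hSK : ∀ i φ, S i * K φ = K φ * S i := fun i φ => by
    refine LinearMap.ext fun f => funext fun x => ?_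
    simp [S, K]
  have hSS : ∀ i j, S i * S j = S j * S i := fun i j => by
    refine LinearMap.ext fun f => funext fun x => ?_
    simp [S, hs i j]
    abel
  have hvec : ∀ v φ, vec s v φ = L v + ∑ i, K (φ i) * S i := fun v φ => rfl
  have h1 : ∀ (v : V) (φ : I → Module.Dual k V), (∑ i, K (φ i) * S i) * L v =
      ∑ i, φ i v • S i - L v * ∑ i, K (φ i) * S i := fun v φ => by
    rw [Finset.sum_mul, Finset.mul_sum, ← Finset.sum_sub_distrib]
    refine Finset.sum_congr rfl fun i _ => ?_
    rw [mul_assoc, hSL, ← mul_assoc, hKL, sub_mul, smul_mul_assoc, one_mul, mul_assoc]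
  have h2 : (∑ i, K (φ i) * S i) * (∑ i, K (ψ i) * S i) +
      (∑ i, K (ψ i) * S i) * (∑ i, K (φ i) * S i) = 0 := by
    have h3 (φ ψ : Module.Dual k V) (i j : I) :
        K φ * S i * (K ψ * S j) = K φ * K ψ * (S i * S j) := by
      rw [mul_assoc, ← mul_assoc (S i), hSK, mul_assoc, mul_assoc]
    rw [Finset.sum_mul_sum, Finset.sum_mul_sum, Finset.sum_comm, ← Finset.sum_add_distrib]
    refine Finset.sum_eq_zero fun j _ => ?_
    rw [← Finset.sum_add_distrib]
    refine Finset.sum_eq_zero fun i _ => ?_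
    rw [h3, h3, hSS, ← add_mul, hKK, zero_mul]
  simp only [hvec, mul_add, add_mul, h1, eq_neg_of_add_eq_zero_left h2, hLL v w, add_smul,
    Finset.sum_add_distrib]
  abel

/-- If a subspace of functions contains all functions with scalar values and is stable under
operators `vec s v φ` for all `v`, then it contains all functions of rank one. -/
lemma smul_mem_of_vec_mem {N : Submodule k (X → ExteriorAlgebra k V)} (s : I → X → X)
    (hone : ∀ u : X → k, (fun x => u x • (1 : ExteriorAlgebra k V)) ∈ N)
    (hvec : ∀ v : V, ∃ φ, ∀ f ∈ N, vec s v φ f ∈ N) (w : ExteriorAlgebra k V) :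
    ∀ C ∈ Submonoid.closure (Set.range (contract (k := k) (V := V))),
      ∀ u : X → k, (fun x => u x • C w) ∈ N := by
  induction w using CliffordAlgebra.left_induction with
  | algebraMap r =>
    intro C hC u
    obtain ⟨r', hr'⟩ : ∃ r' : k, C (algebraMap k _ r) = algebraMap k _ r' := by
      induction hC using Submonoid.closure_induction_left generalizing r with
      | one => exact ⟨r, rfl⟩
      | mul_left _ hC D hD ih =>
        obtain ⟨φ, rfl⟩ := hC
        obtain ⟨r', hr'⟩ := ih r
        refine ⟨0, ?_⟩
        rw [Module.End.mul_apply, hr', map_zero]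
        exact CliffordAlgebra.contractLeft_algebraMap _ _ _
    rw [hr']
    convert hone (r' • u) using 2 with x
    simp [Algebra.algebraMap_eq_smul_one, smul_smul, mul_comm]
  | add x y hx hy =>
    intro C hC u
    simp only [map_add, smul_add]
    exact add_mem (hx C hC u) (hy C hC u)
  | ι_mul x m hx =>
    intro C hC
    induction hC using Submonoid.closure_induction_right generalizing x with
    | one =>
      intro u
      obtain ⟨φ, hφ⟩ := hvec m
      have h1 := hφ _ (hx 1 (one_mem _) u)
      have h2 : (fun y => ∑ i, (u y - u (s i y)) • contract (φ i) x) ∈ N := by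
        have := sum_mem (t := Finset.univ) fun i _ =>
          hx (contract (φ i)) (Submonoid.subset_closure ⟨_, rfl⟩) (fun y => u y - u (s i y))
        convert this using 1
        ext y
        simp
      convert sub_mem h1 h2 using 1
      ext y
      simp only [Pi.sub_apply, vec_apply, Module.End.one_apply, ← sub_smul, map_smul,
        mul_smul_comm]
      exact (add_sub_cancel_right _ _).symm
    | mul_right D hD _ hC ih =>
      obtain ⟨φ, rfl⟩ := hC
      intro u
      have h1 := hx D hD (φ m • u)
      have h2 := ih (contract φ x) (fun C hC u => by
        simpa using hx (C * contract φ)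
          (mul_mem hC (Submonoid.subset_closure ⟨_, rfl⟩)) u) u
      convert sub_mem h1 h2 using 1
      ext y
      simp only [Pi.sub_apply, Module.End.mul_apply, Pi.smul_apply, contract_ι_mul, map_sub,
        map_smul, smul_sub, smul_smul, smul_eq_mul, mul_comm]

lemma eq_top_of_vec_mem [Fintype X] [DecidableEq X]
    {N : Submodule k (X → ExteriorAlgebra k V)} (s : I → X → X)
    (hone : ∀ y : X, Pi.single y 1 ∈ N)
    (hvec : ∀ v : V, ∃ φ, ∀ f ∈ N, vec s v φ f ∈ N) : N = ⊤ := by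
  have key := smul_mem_of_vec_mem s (N := N) (fun u => by
    convert sum_mem (t := Finset.univ) fun y _ => N.smul_mem (u y) (hone y) using 1
    ext x
    simp [Pi.single_apply]) hvec
  refine eq_top_iff.2 fun f _ => ?_
  convert sum_mem (t := Finset.univ) fun y _ => key (f y) 1 (one_mem _) (Pi.single y 1) using 1
  ext x
  simp [Pi.single_apply]

lemma twist_single [DecidableEq X] (T : V →ₗ[k] V) {σ : X → X} (hσ : Function.Injective σ) (x : X) :
    twist T σ (Pi.single (σ x) 1) = Pi.single x 1 := by
  ext y
  rcases eq_or_ne y x with rfl | h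
  · simp
  · simp [h, hσ.ne h]

end Fock

section Model

variable (k : Type*) [Field k] (n1 n2 n3 n4 : ℕ)

/-- The space of generators `p1, p2, E, F, G, H`. -/
abbrev GenSpace := (k × k) × (Fin n1 → k) × (Fin n2 → k) × (Fin n3 → k) × (Fin n4 → k)

variable {k n1 n2 n3 n4}

/-- The linear functional on the span of the `E, F, G, H` with given values. -/
def functional (l : Fin n1 → k) (m : Fin n2 → k) (a : Fin n3 → k) (b : Fin n4 → k) :
    Module.Dual k (GenSpace k n1 n2 n3 n4) where
  toFun v := l ⬝ᵥ v.2.1 + m ⬝ᵥ v.2.2.1 + a ⬝ᵥ v.2.2.2.1 + b ⬝ᵥ v.2.2.2.2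
  map_add' v w := by simp [dotProduct_add]; ring
  map_smul' c v := by simp; ring

lemma functional_apply (l : Fin n1 → k) (m : Fin n2 → k) (a : Fin n3 → k) (b : Fin n4 → k)
    (v : GenSpace k n1 n2 n3 n4) : functional l m a b v =
      l ⬝ᵥ v.2.1 + m ⬝ᵥ v.2.2.1 + a ⬝ᵥ v.2.2.2.1 + b ⬝ᵥ v.2.2.2.2 := rfl

/-- Conjugation by `d` on the space of generators. -/
def dAct (xi : k) : GenSpace k n1 n2 n3 n4 →ₗ[k] GenSpace k n1 n2 n3 n4 where
  toFun v := ((-v.1.2, v.1.1), -xi • v.2.1, xi • v.2.2.1, -xi • v.2.2.2.1, xi • v.2.2.2.2)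
  map_add' v w := by ext <;> simp <;> ring
  map_smul' c v := by ext <;> simp <;> ring

lemma dAct_apply (xi : k) (v : GenSpace k n1 n2 n3 n4) : dAct xi v =
    ((-v.1.2, v.1.1), -xi • v.2.1, xi • v.2.2.1, -xi • v.2.2.2.1, xi • v.2.2.2.2) := rfl

lemma functional_comp_dAct (xi : k) (l : Fin n1 → k) (m : Fin n2 → k) (a : Fin n3 → k)
    (b : Fin n4 → k) : functional l m a b ∘ₗ dAct xi =
      functional (-xi • l) (xi • m) (-xi • a) (xi • b) :=
  LinearMap.ext fun v => by simp [functional_apply, dAct_apply]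

lemma functional_smul (r : k) (l : Fin n1 → k) (m : Fin n2 → k) (a : Fin n3 → k)
    (b : Fin n4 → k) :
    r • functional l m a b = functional (r • l) (r • m) (r • a) (r • b) :=
  LinearMap.ext fun v => by simp [functional_apply, mul_add]

lemma dAct_comp_dAct {xi : k} (hxi : xi * xi = -1) :
    dAct xi ∘ₗ dAct xi = -(LinearMap.id : GenSpace k n1 n2 n3 n4 →ₗ[k] _) := by
  refine LinearMap.ext fun v => ?_
  simp [dAct_apply, smul_smul, hxi, Prod.ext_iff]

/-- The set underlying the group generated by `a, b, c, d`. -/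
abbrev GroupSet := ZMod 2 × ZMod 2 × ZMod 4

/-- Translation by `a`. -/
def sa (x : GroupSet) : GroupSet := (x.1, x.2.1, x.2.2 + 2)
/-- Translation by `b`. -/
def sb (x : GroupSet) : GroupSet := (x.1 + 1, x.2.1, x.2.2)
/-- Translation by `c`. -/
def sc (x : GroupSet) : GroupSet := (x.1, x.2.1 + 1, x.2.2)
/-- Translation by `d`. -/
def sd (x : GroupSet) : GroupSet := (x.2.1, x.1, x.2.2 + 1)

/-- Translations by `ab`, `ac` and `bc`. -/
def evenShift : Fin 3 → GroupSet → GroupSet := ![sb ∘ sa, sc ∘ sa, sc ∘ sb]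

lemma evenShift_comm : ∀ i j x, evenShift i (evenShift j x) = evenShift j (evenShift i x) := by
  decide

/-- The operators on the Fock space attached to the generators. -/
noncomputable def genOp (xi : k) (nu : Matrix (Fin n1) (Fin n4) k)
    (gam : Matrix (Fin n2) (Fin n3) k) (lam : Fin n1 → k) (mu : Fin n2 → k)
    (alp : Fin n3 → k) (bet : Fin n4 → k) :
    Gen n1 n2 n3 n4 →
      Module.End k (GroupSet → ExteriorAlgebra k (GenSpace k n1 n2 n3 n4))
  | a => twist (-LinearMap.id) sa
  | b => twist (-LinearMap.id) sb
  | c => twist (-LinearMap.id) sc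
  | d => twist (dAct xi) sd
  | p1 => vec evenShift ((1, 0), 0) ![functional lam mu 0 0, functional 0 0 alp bet, 0]
  | p2 => vec evenShift ((0, 1), 0)
      ![functional 0 0 (xi • alp) (-xi • bet), functional (xi • lam) (-xi • mu) 0 0, 0]
  | E m => vec evenShift (0, Pi.single m 1, 0) ![0, 0, functional 0 0 0 (nu m)]
  | F q => vec evenShift (0, 0, Pi.single q 1, 0) ![0, 0, functional 0 0 (gam q) 0]
  | G s => vec evenShift (0, 0, 0, Pi.single s 1, 0) ![0, 0, 0]
  | H r => vec evenShift (0, 0, 0, 0, Pi.single r 1) ![0, 0, 0]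

lemma twist_mul_vec_even {σ : GroupSet → GroupSet}
    (hσ : ∀ i x, evenShift i (σ x) = σ (evenShift i x)) (v : GenSpace k n1 n2 n3 n4)
    (φ : Fin 3 → Module.Dual k (GenSpace k n1 n2 n3 n4)) :
    twist (-LinearMap.id) σ * vec evenShift v φ =
      -(vec evenShift v φ * twist (-LinearMap.id) σ) := by
  rw [twist_mul_vec (-LinearMap.id) σ evenShift (Equiv.refl _) hσ (w := (-1 : k) • v)
    (ψ := (-1 : k) • φ) (by simp) (fun i => by ext <;> simp), vec_smul]
  simp

lemma twist_mul_vec_d (xi : k) {v w : GenSpace k n1 n2 n3 n4}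
    {φ ψ : Fin 3 → Module.Dual k (GenSpace k n1 n2 n3 n4)} (hv : dAct xi v = w)
    (h0 : ψ 1 ∘ₗ dAct xi = φ 0) (h1 : ψ 0 ∘ₗ dAct xi = φ 1) (h2 : ψ 2 ∘ₗ dAct xi = φ 2) :
    twist (dAct xi) sd * vec evenShift v φ = vec evenShift w ψ * twist (dAct xi) sd := by
  refine twist_mul_vec _ _ _ (Equiv.swap 0 1) (by decide) hv fun i => ?_
  fin_cases i
  · exact h0
  · exact h1
  · exact h2

lemma twist_mul_vec_d_smul {xi c c' : k} (hc : c * c' = 1) {v : GenSpace k n1 n2 n3 n4}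
    {φ : Module.Dual k (GenSpace k n1 n2 n3 n4)} (hv : dAct xi v = c • v)
    (h : φ ∘ₗ dAct xi = c' • φ) :
    twist (dAct xi) sd * vec evenShift v ![0, 0, φ] =
      c • (vec evenShift v ![0, 0, φ] * twist (dAct xi) sd) := by
  rw [← smul_mul_assoc, ← vec_smul]
  refine twist_mul_vec_d xi hv ?_ ?_ ?_
  · simp
  · simp
  · simp [LinearMap.smul_comp, h, smul_smul, hc]

lemma twist_mul_twist_even (σ σ' : GroupSet → GroupSet) :
    twist (-LinearMap.id : GenSpace k n1 n2 n3 n4 →ₗ[k] _) σ * twist (-LinearMap.id) σ' =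
      shift (σ' ∘ σ) := by
  rw [twist_mul]
  ext f x
  simp

set_option maxHeartbeats 2000000 in
lemma genOp_rel {xi : k} (hxi : xi * xi = -1) {nu : Matrix (Fin n1) (Fin n4) k}
    {gam : Matrix (Fin n2) (Fin n3) k} {lam : Fin n1 → k} {mu : Fin n2 → k}
    {alp : Fin n3 → k} {bet : Fin n4 → k} [CharZero k]
    ⦃x y : FreeAlgebra k (Gen n1 n2 n3 n4)⦄
    (h : Rel k xi n1 n2 n3 n4 nu gam lam mu alp bet x y) :
    FreeAlgebra.lift k (genOp xi nu gam lam mu alp bet) x =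
      FreeAlgebra.lift k (genOp xi nu gam lam mu alp bet) y := by
  have hda : (-LinearMap.id : GenSpace k n1 n2 n3 n4 →ₗ[k] _) ∘ₗ dAct xi =
    dAct xi ∘ₗ (-LinearMap.id) := by ext <;> simp
  cases h
  case haa | hbb | hcc =>
    simp only [map_mul, map_one, FreeAlgebra.lift_ι_apply, genOp, twist_mul_twist_even]
    refine LinearMap.ext fun f => funext fun x => ?_
    exact congrArg f (by revert x; decide)
  case hab | hac | hbc =>
    simp only [map_mul, FreeAlgebra.lift_ι_apply, genOp, twist_mul_twist_even]
    rfl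
  case hdd =>
    simp only [map_mul, FreeAlgebra.lift_ι_apply, genOp, twist_mul, dAct_comp_dAct hxi]
    exact congrArg _ (funext (by decide))
  case hda | hdb | hdc =>
    simp only [map_mul, FreeAlgebra.lift_ι_apply, genOp, twist_mul, hda]
    exact congrArg _ (funext (by decide))
  case aE | bE | cE | aF | bF | cF | aG | bG | cG | aH | bH | cH | ap1 | bp1 | cp1 | ap2 | bp2
      | cp2 =>
    simp only [map_mul, map_neg, FreeAlgebra.lift_ι_apply, genOp]
    exact twist_mul_vec_even (by decide) _ _
  case dE | dG =>
    simp only [map_mul, map_neg, map_smul, FreeAlgebra.lift_ι_apply, genOp, ← neg_smul]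
    exact twist_mul_vec_d_smul (c' := xi) (by simp [hxi]) (by simp [dAct_apply])
      (by simp [functional_comp_dAct, functional_smul])
  case dF | dH =>
    simp only [map_mul, map_smul, FreeAlgebra.lift_ι_apply, genOp]
    exact twist_mul_vec_d_smul (c' := -xi) (by simp [hxi]) (by simp [dAct_apply])
      (by simp [functional_comp_dAct, functional_smul])
  case dp1 | dp2 =>
    simp only [map_mul, map_neg, FreeAlgebra.lift_ι_apply, genOp, ← neg_one_smul k (vec _ _ _),
      ← neg_mul, ← vec_smul]
    refine twist_mul_vec_d _ (by simp [dAct_apply]) ?_ ?_ ?_ <;>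
      refine LinearMap.ext fun v => ?_ <;>
      simp [functional_apply, dAct_apply, ← mul_assoc, hxi, add_comm]
  case p1p1 | p2p2 =>
    simp only [map_mul, map_zero, FreeAlgebra.lift_ι_apply, genOp]
    refine (smul_eq_zero.1 (?_ : (2 : k) • _ = _)).resolve_left two_ne_zero
    rw [two_smul, vec_mul_vec_add _ evenShift_comm]
    simp [Fin.sum_univ_three, functional_apply]
  all_goals
    simp only [map_mul, map_zero, map_add, map_sub, map_one, map_smul, FreeAlgebra.lift_ι_apply,
      genOp, twist_mul_twist_even]
    rw [vec_mul_vec_add _ evenShift_comm]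
    simp [Fin.sum_univ_three, functional_apply, evenShift]

end Model

section Cyclic

variable {k : Type*} [Field k] {n1 n2 n3 n4 : ℕ}

lemma genSpace_eq (v : GenSpace k n1 n2 n3 n4) :
    v = v.1.1 • ((1, 0), 0) + v.1.2 • ((0, 1), 0) +
      ∑ i, v.2.1 i • (0, Pi.single i 1, 0) + ∑ i, v.2.2.1 i • (0, 0, Pi.single i 1, 0) +
      ∑ i, v.2.2.2.1 i • (0, 0, 0, Pi.single i 1, 0) +
      ∑ i, v.2.2.2.2 i • (0, 0, 0, 0, Pi.single i 1) := by
  ext <;> simp [Prod.fst_sum, Prod.snd_sum, Finset.sum_apply, Pi.single_apply]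

lemma eq_top_of_genOp_mem {xi : k} {nu : Matrix (Fin n1) (Fin n4) k}
    {gam : Matrix (Fin n2) (Fin n3) k} {lam : Fin n1 → k} {mu : Fin n2 → k}
    {alp : Fin n3 → k} {bet : Fin n4 → k}
    {N : Submodule k (GroupSet → ExteriorAlgebra k (GenSpace k n1 n2 n3 n4))}
    (hzero : Pi.single 0 1 ∈ N)
    (hN : ∀ x, ∀ f ∈ N, genOp xi nu gam lam mu alp bet x f ∈ N) : N = ⊤ := by
  refine eq_top_of_vec_mem evenShift ?_ ?_
  · have step {y : GroupSet} (T : GenSpace k n1 n2 n3 n4 →ₗ[k] GenSpace k n1 n2 n3 n4)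
        {σ : GroupSet → GroupSet} (hσ : Function.Injective σ)
        (hT : ∀ f ∈ N, twist T σ f ∈ N) (h : Pi.single (σ y) 1 ∈ N) : Pi.single y 1 ∈ N := by
      rw [← twist_single T hσ]
      exact hT _ h
    have hb (y : GroupSet) (h : Pi.single (sb y) 1 ∈ N) : Pi.single y 1 ∈ N :=
      step _ (by decide) (hN b) h
    have hc (y : GroupSet) (h : Pi.single (sc y) 1 ∈ N) : Pi.single y 1 ∈ N :=
      step _ (by decide) (hN c) h
    have hd (y : GroupSet) (h : Pi.single (sd y) 1 ∈ N) : Pi.single y 1 ∈ N :=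
      step _ (by decide) (hN d) h
    have h3 : Pi.single (0, 0, 3) 1 ∈ N := hd _ hzero
    have h2 : Pi.single (0, 0, 2) 1 ∈ N := hd _ h3
    have h1 : Pi.single (0, 0, 1) 1 ∈ N := hd _ h2
    have hz (z : ZMod 4) : Pi.single (0, 0, z) 1 ∈ N := by
      fin_cases z
      · exact hzero
      · exact h1
      · exact h2
      · exact h3
    have hy (y : ZMod 2) (z : ZMod 4) : Pi.single (0, y, z) 1 ∈ N := by
      fin_cases y
      · exact hz z
      · exact hc _ (hz z)
    rintro ⟨x, y, z⟩
    fin_cases x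
    · exact hy y z
    · exact hb _ (hy y z)
  · let W : Submodule k (GenSpace k n1 n2 n3 n4) :=
      { carrier := {v | ∃ φ, ∀ f ∈ N, vec evenShift v φ f ∈ N}
        zero_mem' := ⟨0, fun f _ => by
          convert zero_mem N using 1
          ext x
          simp [vec_apply, contract]⟩
        add_mem' := by
          rintro v w ⟨φ, hφ⟩ ⟨ψ, hψ⟩
          exact ⟨φ + ψ, fun f hf => by
            rw [vec_add]
            exact add_mem (hφ f hf) (hψ f hf)⟩
        smul_mem' := by
          rintro r v ⟨φ, hφ⟩
          exact ⟨r • φ, fun f hf => by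
            rw [vec_smul]
            exact N.smul_mem r (hφ f hf)⟩ }
    intro v
    change v ∈ W
    rw [genSpace_eq v]
    refine add_mem (add_mem (add_mem (add_mem (add_mem (W.smul_mem _ ⟨_, hN p1⟩)
      (W.smul_mem _ ⟨_, hN p2⟩)) ?_) ?_) ?_) ?_ <;>
      refine sum_mem fun i _ => W.smul_mem _ ?_
    · exact ⟨_, hN (E i)⟩
    · exact ⟨_, hN (F i)⟩
    · exact ⟨_, hN (G i)⟩
    · exact ⟨_, hN (H i)⟩

lemma finrank_exteriorAlgebra (V : Type*) [AddCommGroup V] [Module k V] [Module.Finite k V] :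
    Module.finrank k (ExteriorAlgebra k V) = 2 ^ Module.finrank k V := by
  rw [Module.finrank_eq_card_basis (Module.finBasis k V).ExteriorAlgebra]
  simp

lemma finrank_fock : Module.finrank k
    (GroupSet → ExteriorAlgebra k (GenSpace k n1 n2 n3 n4)) = 2 ^ (6 + (n1 + n2 + n3 + n4)) := by
  have : Module.Finite k (ExteriorAlgebra k (GenSpace k n1 n2 n3 n4)) :=
    .of_basis (Module.finBasis k _).ExteriorAlgebra
  rw [Module.finrank_pi_fintype]
  simp [finrank_exteriorAlgebra, ZMod.card, Finset.card_univ]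
  ring

lemma le_finrank_U [CharZero k] {xi : k} (hxi : xi * xi = -1) (nu : Matrix (Fin n1) (Fin n4) k)
    (gam : Matrix (Fin n2) (Fin n3) k) (lam : Fin n1 → k) (mu : Fin n2 → k)
    (alp : Fin n3 → k) (bet : Fin n4 → k)
    [Module.Finite k (U k xi n1 n2 n3 n4 nu gam lam mu alp bet)] :
    2 ^ (6 + (n1 + n2 + n3 + n4)) ≤
      Module.finrank k (U k xi n1 n2 n3 n4 nu gam lam mu alp bet) := by
  let rho : U k xi n1 n2 n3 n4 nu gam lam mu alp bet →ₐ[k] _ :=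
    RingQuot.liftAlgHom k ⟨_, genOp_rel (nu := nu) (gam := gam) (lam := lam) (mu := mu)
      (alp := alp) (bet := bet) hxi⟩
  have hrho (x : Gen n1 n2 n3 n4) : rho (mk k xi n1 n2 n3 n4 nu gam lam mu alp bet (g k x)) =
      genOp xi nu gam lam mu alp bet x := by
    simp [rho, mk]
  let ev := (LinearMap.applyₗ (R := k)
    (Pi.single (0 : GroupSet) (1 : ExteriorAlgebra k (GenSpace k n1 n2 n3 n4)))) ∘ₗ
      rho.toLinearMap
  have hev : LinearMap.range ev = ⊤ := by
    refine eq_top_of_genOp_mem (xi := xi) (nu := nu) (gam := gam) (lam := lam) (mu := mu)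
      (alp := alp) (bet := bet) ⟨1, by simp [ev]⟩ ?_
    rintro x _ ⟨u, rfl⟩
    exact ⟨mk k xi n1 n2 n3 n4 nu gam lam mu alp bet (g k x) * u, by
      simp only [ev, LinearMap.comp_apply, AlgHom.toLinearMap_apply, map_mul, hrho]
      rfl⟩
  rw [← finrank_fock (k := k), ← finrank_top, ← hev]
  exact LinearMap.finrank_range_le ev

end Cyclic

section Spanning

variable {k : Type*} [Field k] {n1 n2 n3 n4 : ℕ} {xi : k} {nu : Matrix (Fin n1) (Fin n4) k}
  {gam : Matrix (Fin n2) (Fin n3) k} {lam : Fin n1 → k} {mu : Fin n2 → k} {alp : Fin n3 → k}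
  {bet : Fin n4 → k} {A : Type*} [Ring A] [Algebra k A] {f : Gen n1 n2 n3 n4 → A}

/-- The generators `E, F, G, H` in increasing order. -/
def families (n1 n2 n3 n4 : ℕ) : List (Gen n1 n2 n3 n4) :=
  List.ofFn E ++ (List.ofFn F ++ (List.ofFn G ++ List.ofFn H))

lemma exists_anticommutator [CharZero k]
    (hf : ∀ ⦃x y⦄, Rel k xi n1 n2 n3 n4 nu gam lam mu alp bet x y →
      FreeAlgebra.lift k f x = FreeAlgebra.lift k f y)
    {x y : Gen n1 n2 n3 n4} (hx : x ∈ p1 :: p2 :: families n1 n2 n3 n4)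
    (hy : y ∈ p1 :: p2 :: families n1 n2 n3 n4) :
    ∃ r : k, ∃ u ∈ [a, b, c], ∃ v ∈ [a, b, c],
      f x * f y + f y * f x = r • (1 - f u * f v) := by
  set P : Gen n1 n2 n3 n4 → Gen n1 n2 n3 n4 → Prop := fun x y =>
    ∃ r : k, ∃ u ∈ [a, b, c], ∃ v ∈ [a, b, c], f x * f y + f y * f x = r • (1 - f u * f v)
  have symm {x y} (h : P x y) : P y x := by
    simpa only [P, add_comm (f x * f y)] using h
  have of_rel {x y : Gen n1 n2 n3 n4} {r : k} {u v : Gen n1 n2 n3 n4} (hu : u ∈ [a, b, c])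
      (hv : v ∈ [a, b, c]) (h : Rel k xi n1 n2 n3 n4 nu gam lam mu alp bet
        (g k x * g k y + g k y * g k x) (r • (1 - g k u * g k v))) : P x y :=
    ⟨r, u, hu, v, hv, by simpa using hf h⟩
  have of_rel_zero {x y : Gen n1 n2 n3 n4} (h : Rel k xi n1 n2 n3 n4 nu gam lam mu alp bet
        (g k x * g k y + g k y * g k x) 0) : P x y :=
    ⟨0, a, by simp, a, by simp, by simpa using hf h⟩
  have of_sq {x : Gen n1 n2 n3 n4} (h : Rel k xi n1 n2 n3 n4 nu gam lam mu alp bet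
        (g k x * g k x) 0) : P x x :=
    ⟨0, a, by simp, a, by simp, by
      have : f x * f x = 0 := by simpa using hf h
      simp [this]⟩
  have ha : (a : Gen n1 n2 n3 n4) ∈ [a, b, c] := by simp
  have hb : (b : Gen n1 n2 n3 n4) ∈ [a, b, c] := by simp
  have hc : (c : Gen n1 n2 n3 n4) ∈ [a, b, c] := by simp
  change P x y
  cases x with
  | p1 =>
    cases y with
    | p1 => exact of_sq .p1p1
    | p2 => exact of_rel_zero .p1p2
    | E j => exact of_rel ha hb (.p1E j)
    | F j => exact of_rel ha hb (.p1F j)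
    | G j => exact of_rel ha hc (.p1G j)
    | H j => exact of_rel ha hc (.p1H j)
    | _ => simp [families] at hy
  | p2 =>
    cases y with
    | p1 => exact symm (of_rel_zero .p1p2)
    | p2 => exact of_sq .p2p2
    | E j => exact of_rel ha hc (.p2E j)
    | F j => exact of_rel ha hc (.p2F j)
    | G j => exact of_rel ha hb (.p2G j)
    | H j => exact of_rel ha hb (.p2H j)
    | _ => simp [families] at hy
  | E i =>
    cases y with
    | p1 => exact symm (of_rel ha hb (.p1E i))
    | p2 => exact symm (of_rel ha hc (.p2E i))
    | E j => exact of_rel_zero (.EE i j)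
    | F j => exact of_rel_zero (.EF i j)
    | G j => exact of_rel_zero (.EG i j)
    | H j => exact of_rel hb hc (.EH i j)
    | _ => simp [families] at hy
  | F i =>
    cases y with
    | p1 => exact symm (of_rel ha hb (.p1F i))
    | p2 => exact symm (of_rel ha hc (.p2F i))
    | E j => exact symm (of_rel_zero (.EF j i))
    | F j => exact of_rel_zero (.FF i j)
    | G j => exact of_rel hb hc (.FG i j)
    | H j => exact of_rel_zero (.FH i j)
    | _ => simp [families] at hy
  | G i =>
    cases y with
    | p1 => exact symm (of_rel ha hc (.p1G i))
    | p2 => exact symm (of_rel ha hb (.p2G i))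
    | E j => exact symm (of_rel_zero (.EG j i))
    | F j => exact symm (of_rel hb hc (.FG j i))
    | G j => exact of_rel_zero (.GG i j)
    | H j => exact of_rel_zero (.GH i j)
    | _ => simp [families] at hy
  | H i =>
    cases y with
    | p1 => exact symm (of_rel ha hc (.p1H i))
    | p2 => exact symm (of_rel ha hb (.p2H i))
    | E j => exact symm (of_rel hb hc (.EH j i))
    | F j => exact symm (of_rel_zero (.FH j i))
    | G j => exact symm (of_rel_zero (.GH j i))
    | H j => exact of_rel_zero (.HH i j)
    | _ => simp [families] at hy
  | _ => simp [families] at hx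

lemma mul_self_eq_zero_of_rel [CharZero k]
    (hf : ∀ ⦃x y⦄, Rel k xi n1 n2 n3 n4 nu gam lam mu alp bet x y →
      FreeAlgebra.lift k f x = FreeAlgebra.lift k f y)
    {x : Gen n1 n2 n3 n4} (hx : x ∈ p1 :: p2 :: families n1 n2 n3 n4) : f x * f x = 0 := by
  have of_rel {x : Gen n1 n2 n3 n4} (h : Rel k xi n1 n2 n3 n4 nu gam lam mu alp bet
        (g k x * g k x + g k x * g k x) 0) : f x * f x = 0 := by
    refine (smul_eq_zero.1 (?_ : (2 : k) • _ = _)).resolve_left two_ne_zero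
    simpa [two_smul] using hf h
  cases x with
  | p1 => simpa using hf .p1p1
  | p2 => simpa using hf .p2p2
  | E m => exact of_rel (.EE m m)
  | F m => exact of_rel (.FF m m)
  | G m => exact of_rel (.GG m m)
  | H m => exact of_rel (.HH m m)
  | _ => simp [families] at hx

lemma even_anticomm
    (hf : ∀ ⦃x y⦄, Rel k xi n1 n2 n3 n4 nu gam lam mu alp bet x y →
      FreeAlgebra.lift k f x = FreeAlgebra.lift k f y)
    {u x : Gen n1 n2 n3 n4} (hu : u ∈ [a, b, c]) (hx : x ∈ p1 :: p2 :: families n1 n2 n3 n4) :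
    f u * f x = -(f x * f u) := by
  have of_rel {u x : Gen n1 n2 n3 n4} (h : Rel k xi n1 n2 n3 n4 nu gam lam mu alp bet
        (g k u * g k x) (-(g k x * g k u))) : f u * f x = -(f x * f u) := by
    simpa using hf h
  cases u <;> cases x <;> first
    | exact of_rel (by constructor)
    | simp [families] at hu hx

lemma exists_d_comm
    (hf : ∀ ⦃x y⦄, Rel k xi n1 n2 n3 n4 nu gam lam mu alp bet x y →
      FreeAlgebra.lift k f x = FreeAlgebra.lift k f y)
    {x : Gen n1 n2 n3 n4} (hx : x ∈ families n1 n2 n3 n4) :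
    ∃ r : k, f d * f x = r • (f x * f d) := by
  cases x with
  | E m => exact ⟨-xi, by simpa using hf (.dE m)⟩
  | F m => exact ⟨xi, by simpa using hf (.dF m)⟩
  | G m => exact ⟨-xi, by simpa using hf (.dG m)⟩
  | H m => exact ⟨xi, by simpa using hf (.dH m)⟩
  | _ => simp [families] at hx

/-- The span of the images of the normally ordered monomials. -/
def monoSpan (k : Type*) [Field k] [Algebra k A] (f : Gen n1 n2 n3 n4 → A) : Submodule k A :=
  tower ((p1 :: p2 :: families n1 n2 n3 n4).map f) (groupSpan k (f a) (f b) (f c) (f d))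

lemma generator_mul_mem_monoSpan [CharZero k]
    (hf : ∀ ⦃x y⦄, Rel k xi n1 n2 n3 n4 nu gam lam mu alp bet x y →
      FreeAlgebra.lift k f x = FreeAlgebra.lift k f y) (x : Gen n1 n2 n3 n4) :
    ∀ s ∈ monoSpan k f, f x * s ∈ monoSpan k f := by
  have hgrp : ∀ x ∈ [a, b, c, d], ∀ s ∈ groupSpan k (f a) (f b) (f c) (f d),
      f x * s ∈ groupSpan k (f a) (f b) (f c) (f d) := by
    intro x hx
    refine mul_mem_groupSpan (by simpa using hf .haa) (by simpa using hf .hbb)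
      (by simpa using hf .hcc) (by simpa [commute_iff_eq] using hf .hab)
      (by simpa [commute_iff_eq] using hf .hac)
      (by simpa [commute_iff_eq] using hf .hbc) (by simpa using hf .hdd)
      (by simpa [commute_iff_eq] using hf .hda)
      (by simpa using hf .hdb) (by simpa using hf .hdc) _ ?_
    rcases x <;> simp at hx ⊢
  have heven {u : Gen n1 n2 n3 n4} (hu : u ∈ [a, b, c]) (hu' : u ∈ [a, b, c, d]) :
      ∀ s ∈ monoSpan k f, f u * s ∈ monoSpan k f := by
    refine smul_comm_mul_mem_tower (hgrp u hu') ?_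
    intro y hy
    obtain ⟨x, hx, rfl⟩ := List.mem_map.1 hy
    exact ⟨-1, by simpa using even_anticomm hf hu hx⟩
  have hodd {x : Gen n1 n2 n3 n4} (hx : x ∈ p1 :: p2 :: families n1 n2 n3 n4) :
      ∀ s ∈ monoSpan k f, f x * s ∈ monoSpan k f := by
    refine mul_mem_tower ?_ ?_ _ (List.mem_map_of_mem hx)
    · intro _ h
      obtain ⟨y, hy, rfl⟩ := List.mem_map.1 h
      exact mul_self_eq_zero_of_rel hf hy
    · intro _ h _ h'
      obtain ⟨y, hy, rfl⟩ := List.mem_map.1 h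
      obtain ⟨z, hz, rfl⟩ := List.mem_map.1 h'
      obtain ⟨r, u, hu, v, hv, h⟩ := exists_anticommutator hf hy hz
      refine ⟨_, h, fun s hs => ?_, fun _ h'' => ?_⟩
      · rw [smul_mul_assoc, sub_mul, one_mul, mul_assoc]
        exact Submodule.smul_mem _ _ (sub_mem hs
          (hgrp u (by simp at hu ⊢; tauto) _ (hgrp v (by simp at hv ⊢; tauto) _ hs)))
      · obtain ⟨w, hw, rfl⟩ := List.mem_map.1 h''
        have h1 : f u * f v * f w = f w * (f u * f v) := by
          rw [mul_assoc, even_anticomm hf hv hw, mul_neg, ← mul_assoc, even_anticomm hf hu hw,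
            neg_mul, neg_neg, mul_assoc]
        rw [smul_mul_assoc, mul_smul_comm, sub_mul, mul_sub, h1, one_mul, mul_one]
  cases x with
  | a => exact heven (by simp) (by simp)
  | b => exact heven (by simp) (by simp)
  | c => exact heven (by simp) (by simp)
  | d =>
    have h1 : f d * f p1 = f p2 * f d := by simpa using hf .dp1
    have h2 : f d * f p2 = -(f p1 * f d) := by simpa using hf .dp2
    have hd : ∀ s ∈ tower ((families n1 n2 n3 n4).map f) (groupSpan k (f a) (f b) (f c) (f d)),
        f d * s ∈ tower ((families n1 n2 n3 n4).map f) (groupSpan k (f a) (f b) (f c) (f d)) := by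
      refine smul_comm_mul_mem_tower (hgrp d (by simp)) ?_
      intro y hy
      obtain ⟨x, hx, rfl⟩ := List.mem_map.1 hy
      exact exists_d_comm hf hx
    have hle : tower ((families n1 n2 n3 n4).map f) (groupSpan k (f a) (f b) (f c) (f d)) ≤
        monoSpan k f := (tower_le_tower_cons _ _ _).trans (tower_le_tower_cons _ _ _)
    have hd1 : ∀ s ∈ tower ((p2 :: families n1 n2 n3 n4).map f)
        (groupSpan k (f a) (f b) (f c) (f d)), f d * s ∈ monoSpan k f := by
      intro s hs
      obtain ⟨u, hu, v, hv, rfl⟩ := mem_tower_cons.1 hs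
      rw [mul_add, ← mul_assoc, h2, neg_mul, mul_assoc]
      exact add_mem (hle (hd u hu)) (neg_mem (hodd (by simp) _ (hle (hd v hv))))
    intro s hs
    obtain ⟨u, hu, v, hv, rfl⟩ := mem_tower_cons.1 hs
    rw [mul_add, ← mul_assoc, h1, mul_assoc]
    exact add_mem (hd1 u hu) (hodd (by simp) _ (hd1 v hv))
  | _ => exact hodd (by simp [families])

lemma lift_mem_monoSpan [CharZero k]
    (hf : ∀ ⦃x y⦄, Rel k xi n1 n2 n3 n4 nu gam lam mu alp bet x y →
      FreeAlgebra.lift k f x = FreeAlgebra.lift k f y) (w : FreeAlgebra k (Gen n1 n2 n3 n4)) :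
    FreeAlgebra.lift k f w ∈ monoSpan k f := by
  suffices h : ∀ s ∈ monoSpan k f, FreeAlgebra.lift k f w * s ∈ monoSpan k f by
    have h1 : (1 : A) ∈ monoSpan k f :=
      le_tower _ _ (Submodule.subset_span ⟨(0, 0, 0, 0), by simp⟩)
    simpa using h 1 h1
  induction w with
  | grade0 r =>
    intro s hs
    rw [AlgHom.commutes, ← Algebra.smul_def]
    exact Submodule.smul_mem _ _ hs
  | grade1 x =>
    rw [FreeAlgebra.lift_ι_apply]
    exact generator_mul_mem_monoSpan hf x
  | mul x y hx hy =>
    intro s hs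
    rw [map_mul, mul_assoc]
    exact hx _ (hy _ hs)
  | add x y hx hy =>
    intro s hs
    rw [map_add, add_mul]
    exact add_mem (hx _ hs) (hy _ hs)

lemma span_mono_eq_top [CharZero k] (xi : k) (nu : Matrix (Fin n1) (Fin n4) k)
    (gam : Matrix (Fin n2) (Fin n3) k) (lam : Fin n1 → k) (mu : Fin n2 → k)
    (alp : Fin n3 → k) (bet : Fin n4 → k) :
    Submodule.span k (Set.range (mono k xi n1 n2 n3 n4 nu gam lam mu alp bet)) = ⊤ := by
  set f := fun x : Gen n1 n2 n3 n4 => mk k xi n1 n2 n3 n4 nu gam lam mu alp bet (g k x)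
  have hlift : FreeAlgebra.lift k f = mk k xi n1 n2 n3 n4 nu gam lam mu alp bet := by
    ext x
    simp [f]
  have hlist : (p1 :: p2 :: families n1 n2 n3 n4).map f = List.ofFn ![f p1, f p2] ++
      (List.ofFn (fun m => f (E m)) ++ (List.ofFn (fun m => f (F m)) ++
        (List.ofFn (fun m => f (G m)) ++ List.ofFn (fun m => f (H m))))) := by
    simp [families, List.map_ofFn, Function.comp_def]
  rw [eq_top_iff]
  rintro u -
  obtain ⟨w, rfl⟩ := RingQuot.mkAlgHom_surjective k
    (Rel k xi n1 n2 n3 n4 nu gam lam mu alp bet) u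
  have hw := lift_mem_monoSpan (f := f) (fun x y h => by
    rw [hlift]
    exact RingQuot.mkAlgHom_rel k h) w
  rw [hlift, monoSpan, hlist, tower_append, tower_append, tower_append, tower_append] at hw
  have hle := ((tower_mono _ ((tower_mono _ ((tower_mono _ ((tower_mono _
    (tower_ofFn_le _ _)).trans (tower_ofFn_le _ _))).trans (tower_ofFn_le _ _))).trans
    (tower_ofFn_le _ _))).trans (tower_ofFn_le _ _)) hw
  refine Submodule.span_mono ?_ hle
  rintro _ ⟨⟨e, eE, eF, eG, eH, ea, eb, ec, ed⟩, rfl⟩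
  refine ⟨((e 0, e 1), eE, eF, eG, eH, ea, eb, ec, ed), ?_⟩
  simp [mono, f, map_list_prod, List.map_ofFn, Function.comp_def, mul_assoc]

end Spanning

theorem thm [IsAlgClosed k] [CharZero k] (xi : k) (hxi : IsPrimitiveRoot xi 4)
    (n1 n2 n3 n4 : ℕ) (nu : Matrix (Fin n1) (Fin n4) k)
    (gam : Matrix (Fin n2) (Fin n3) k) (lam : Fin n1 → k) (mu : Fin n2 → k)
    (alp : Fin n3 → k) (bet : Fin n4 → k) :
    Module.finrank k (U k xi n1 n2 n3 n4 nu gam lam mu alp bet) = 2 ^ (6 + (n1 + n2 + n3 + n4)) ∧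
    LinearIndependent k (mono k xi n1 n2 n3 n4 nu gam lam mu alp bet) ∧
    Submodule.span k (Set.range (mono k xi n1 n2 n3 n4 nu gam lam mu alp bet)) = ⊤ := by
  have hxi' : xi * xi = -1 := by
    have h : IsPrimitiveRoot (xi ^ 2) 2 := hxi.pow (by norm_num) (by norm_num)
    rw [← pow_two, h.eq_neg_one_of_two_right]
  have hspan := span_mono_eq_top xi nu gam lam mu alp bet
  have : Module.Finite k (U k xi n1 n2 n3 n4 nu gam lam mu alp bet) :=
    ⟨⟨(Set.finite_range _).toFinset, by rw [Set.Finite.coe_toFinset, hspan]⟩⟩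
  have hcard : Fintype.card ((Fin 2 × Fin 2) × (Fin n1 → Fin 2) × (Fin n2 → Fin 2) ×
      (Fin n3 → Fin 2) × (Fin n4 → Fin 2) × Fin 2 × Fin 2 × Fin 2 × Fin 2) =
      2 ^ (6 + (n1 + n2 + n3 + n4)) := by
    simp
    ring
  have hle := finrank_range_le_card (R := k) (mono k xi n1 n2 n3 n4 nu gam lam mu alp bet)
  rw [Set.finrank, hspan, finrank_top, hcard] at hle
  have hrank := hle.antisymm (le_finrank_U hxi' nu gam lam mu alp bet)
  exact ⟨hrank, linearIndependent_of_top_le_span_of_card_eq_finrank hspan.ge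
    (hcard.trans hrank.symm), hspan⟩

end Stmt5
end

section
/- For all λ, μ, α ∈ k, the algebra U_14(λ,μ,α) is 256-dimensional over k; the images of the monomials p1^i p2^j q1^k q2^l a^e b^f c^g d^h with i, j, k, l, e, f, g, h ∈ {0,1} form a k-basis. -/
namespace Stmt6

/-- The generators `a, b, c, d, p1, p2, q1, q2`. -/
inductive Gen | a | b | c | d | p1 | p2 | q1 | q2

open Gen

variable (k : Type*) [Field k]

/-- The generators viewed inside the free algebra. -/
abbrev g (x : Gen) : FreeAlgebra k Gen := FreeAlgebra.ι k x

variable (lam mu alp : k)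

/-- The defining relations of `U_14(λ,μ,α)`: the `H`-relations together with the listed
relations involving `p1, p2, q1, q2`. -/
inductive Rel : FreeAlgebra k Gen → FreeAlgebra k Gen → Prop
  -- H-relations
  | haa : Rel (g k a * g k a) 1
  | hbb : Rel (g k b * g k b) 1
  | hcc : Rel (g k c * g k c) 1
  | hab : Rel (g k a * g k b) (g k b * g k a)
  | hac : Rel (g k a * g k c) (g k c * g k a)
  | hbc : Rel (g k b * g k c) (g k c * g k b)
  | hdd : Rel (g k d * g k d) (g k a)
  | hda : Rel (g k d * g k a) (g k a * g k d)
  | hdb : Rel (g k d * g k b) (g k c * g k d)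
  | hdc : Rel (g k d * g k c) (g k b * g k d)
  -- relations between a,b,c,d and p1,p2
  | ap1 : Rel (g k a * g k p1) (g k p1 * g k a)
  | bp1 : Rel (g k b * g k p1) (-(g k p1 * g k b))
  | cp1 : Rel (g k c * g k p1) (-(g k p1 * g k c))
  | dp1 : Rel (g k d * g k p1) (g k p2 * g k d)
  | ap2 : Rel (g k a * g k p2) (g k p2 * g k a)
  | bp2 : Rel (g k b * g k p2) (-(g k p2 * g k b))
  | cp2 : Rel (g k c * g k p2) (-(g k p2 * g k c))
  | dp2 : Rel (g k d * g k p2) (g k p1 * g k d)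
  | p1p1 : Rel (g k p1 * g k p1) 0
  | p2p2 : Rel (g k p2 * g k p2) 0
  | p1p2 : Rel (g k p1 * g k p2 + g k p2 * g k p1) (lam • (1 - g k b * g k c))
  -- relations between a,b,c,d and q1,q2
  | aq1 : Rel (g k a * g k q1) (g k q1 * g k a)
  | bq1 : Rel (g k b * g k q1) (-(g k q1 * g k b))
  | cq1 : Rel (g k c * g k q1) (-(g k q1 * g k c))
  | dq1 : Rel (g k d * g k q1) (g k q2 * g k d)
  | aq2 : Rel (g k a * g k q2) (g k q2 * g k a)
  | bq2 : Rel (g k b * g k q2) (-(g k q2 * g k b))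
  | cq2 : Rel (g k c * g k q2) (-(g k q2 * g k c))
  | dq2 : Rel (g k d * g k q2) (g k q1 * g k d)
  | q1q1 : Rel (g k q1 * g k q1) 0
  | q2q2 : Rel (g k q2 * g k q2) 0
  | q1q2 : Rel (g k q1 * g k q2 + g k q2 * g k q1) (mu • (1 - g k b * g k c))
  -- relations between p's and q's
  | p1q1 : Rel (g k p1 * g k q1 + g k q1 * g k p1) 0
  | p2q2 : Rel (g k p2 * g k q2 + g k q2 * g k p2) 0
  | p1q2 : Rel (g k p1 * g k q2 + g k q2 * g k p1) (alp • (1 - g k b * g k c))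
  | p2q1 : Rel (g k p2 * g k q1 + g k q1 * g k p2) (alp • (1 - g k b * g k c))

/-- The algebra `U_14(λ,μ,α)`. -/
abbrev U := RingQuot (Rel k lam mu alp)

/-- The quotient map. -/
noncomputable abbrev mk : FreeAlgebra k Gen →ₐ[k] U k lam mu alp :=
  RingQuot.mkAlgHom k (Rel k lam mu alp)

/-- The image of the monomial `p1^i p2^j q1^k q2^l a^e b^f c^g d^h` in `U_14(λ,μ,α)`. -/
noncomputable def mono (e : Gen → Fin 2) : U k lam mu alp :=
  mk k lam mu alp
    (g k p1 ^ (e p1).val * g k p2 ^ (e p2).val * g k q1 ^ (e q1).val * g k q2 ^ (e q2).val *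
      g k a ^ (e a).val * g k b ^ (e b).val * g k c ^ (e c).val * g k d ^ (e d).val)

section Fock

variable {R : Type*} [CommRing R]

/-- The Fock space: functions on the `16` occupation patterns of `p1, p2, q1, q2`. -/
abbrev Fock (R : Type*) := Fin 2 → Fin 2 → Fin 2 → Fin 2 → R

/-- The sign picked up when an odd operator moves past an occupied or empty slot. -/
def sgn (R : Type*) [CommRing R] : Fin 2 → R := ![1, -1]

/-- The parity operator. -/
def parity : Module.End R (Fock R) where
  toFun f i j k l := sgn R i * sgn R j * sgn R k * sgn R l * f i j k l
  map_add' f f' := by ext; simp [mul_add]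
  map_smul' r f := by ext; simp; ring

/-- The normal-ordered action of `p1`. -/
def opP1 : Module.End R (Fock R) where
  toFun f i j k l := ![0, f 0 j k l] i
  map_add' f f' := by ext i j k l; fin_cases i <;> simp
  map_smul' r f := by ext i j k l; fin_cases i <;> simp

/-- The normal-ordered action of `p2`. -/
def opP2 (L : R) : Module.End R (Fock R) where
  toFun f i j k l := sgn R i * ![0, f i 0 k l] j + L * ![f 1 j k l, 0] i
  map_add' f f' := by ext i j k l; fin_cases i <;> fin_cases j <;> simp <;> ring
  map_smul' r f := by ext i j k l; fin_cases i <;> fin_cases j <;> simp <;> ring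

/-- The normal-ordered action of `q1`. -/
def opQ1 (N : R) : Module.End R (Fock R) where
  toFun f i j k l :=
    sgn R i * sgn R j * ![0, f i j 0 l] k + N * sgn R i * ![f i 1 k l, 0] j
  map_add' f f' := by ext i j k l; fin_cases j <;> fin_cases k <;> simp <;> ring
  map_smul' r f := by ext i j k l; fin_cases j <;> fin_cases k <;> simp <;> ring

/-- The normal-ordered action of `q2`. -/
def opQ2 (M N : R) : Module.End R (Fock R) where
  toFun f i j k l :=
    sgn R i * sgn R j * sgn R k * ![0, f i j k 0] l +
      M * sgn R i * sgn R j * ![f i j 1 l, 0] k + N * ![f 1 j k l, 0] i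
  map_add' f f' := by
    ext i j k l; fin_cases i <;> fin_cases k <;> fin_cases l <;> simp <;> ring
  map_smul' r f := by
    ext i j k l; fin_cases i <;> fin_cases k <;> fin_cases l <;> simp <;> ring

lemma parity_apply (f : Fock R) (i j k l : Fin 2) :
    parity f i j k l = sgn R i * sgn R j * sgn R k * sgn R l * f i j k l := rfl

lemma opP1_apply (f : Fock R) (i j k l : Fin 2) : opP1 f i j k l = ![0, f 0 j k l] i := rfl

lemma opP2_apply (L : R) (f : Fock R) (i j k l : Fin 2) :
    opP2 L f i j k l = sgn R i * ![0, f i 0 k l] j + L * ![f 1 j k l, 0] i := rfl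

lemma opQ1_apply (N : R) (f : Fock R) (i j k l : Fin 2) :
    opQ1 N f i j k l =
      sgn R i * sgn R j * ![0, f i j 0 l] k + N * sgn R i * ![f i 1 k l, 0] j := rfl

lemma opQ2_apply (M N : R) (f : Fock R) (i j k l : Fin 2) :
    opQ2 M N f i j k l = sgn R i * sgn R j * sgn R k * ![0, f i j k 0] l +
      M * sgn R i * sgn R j * ![f i j 1 l, 0] k + N * ![f 1 j k l, 0] i := rfl

@[simp] lemma sgn_zero : sgn R 0 = 1 := rfl

@[simp] lemma sgn_one : sgn R 1 = -1 := rfl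

lemma parity_mul_parity : (parity * parity : Module.End R (Fock R)) = 1 := by
  refine LinearMap.ext fun f => ?_; funext i j k l
  fin_cases i <;> fin_cases j <;> fin_cases k <;> fin_cases l <;> simp [parity_apply]

lemma parity_mul_opP1 : (parity * opP1 : Module.End R (Fock R)) = -(opP1 * parity) := by
  refine LinearMap.ext fun f => ?_; funext i j k l
  fin_cases i <;> simp [parity_apply, opP1_apply]

lemma parity_mul_opP2 (L : R) : parity * opP2 L = -(opP2 L * parity) := by
  refine LinearMap.ext fun f => ?_; funext i j k l
  fin_cases i <;> fin_cases j <;> simp [parity_apply, opP2_apply] <;> ring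

lemma parity_mul_opQ1 (N : R) : parity * opQ1 N = -(opQ1 N * parity) := by
  refine LinearMap.ext fun f => ?_; funext i j k l
  fin_cases i <;> fin_cases j <;> fin_cases k <;> simp [parity_apply, opQ1_apply] <;> ring

lemma parity_mul_opQ2 (M N : R) : parity * opQ2 M N = -(opQ2 M N * parity) := by
  refine LinearMap.ext fun f => ?_; funext i j k l
  fin_cases i <;> fin_cases j <;> fin_cases k <;> fin_cases l <;>
    simp [parity_apply, opQ2_apply] <;> ring

lemma opP1_mul_opP1 : (opP1 * opP1 : Module.End R (Fock R)) = 0 := by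
  refine LinearMap.ext fun f => ?_; funext i j k l
  fin_cases i <;> simp [opP1_apply]

lemma opP2_mul_opP2 (L : R) : opP2 L * opP2 L = 0 := by
  refine LinearMap.ext fun f => ?_; funext i j k l
  fin_cases i <;> fin_cases j <;> simp [opP2_apply]

lemma opQ1_mul_opQ1 (N : R) : opQ1 N * opQ1 N = 0 := by
  refine LinearMap.ext fun f => ?_; funext i j k l
  fin_cases i <;> fin_cases j <;> fin_cases k <;> simp [opQ1_apply]

lemma opQ2_mul_opQ2 (M N : R) : opQ2 M N * opQ2 M N = 0 := by
  refine LinearMap.ext fun f => ?_; funext i j k l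
  fin_cases i <;> fin_cases j <;> fin_cases k <;> fin_cases l <;> simp [opQ2_apply] <;> ring

lemma opP1_opP2_anticomm (L : R) : opP1 * opP2 L + opP2 L * opP1 = L • 1 := by
  refine LinearMap.ext fun f => ?_; funext i j k l
  fin_cases i <;> fin_cases j <;> simp [opP1_apply, opP2_apply]

lemma opQ1_opQ2_anticomm (M N : R) :
    opQ1 N * opQ2 M N + opQ2 M N * opQ1 N = M • 1 := by
  refine LinearMap.ext fun f => ?_; funext i j k l
  fin_cases i <;> fin_cases j <;> fin_cases k <;> fin_cases l <;>
    simp [opQ1_apply, opQ2_apply] <;> ring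

lemma opP1_opQ1_anticomm (N : R) : opP1 * opQ1 N + opQ1 N * opP1 = 0 := by
  refine LinearMap.ext fun f => ?_; funext i j k l
  fin_cases i <;> fin_cases j <;> fin_cases k <;> simp [opP1_apply, opQ1_apply]; ring

lemma opP2_opQ2_anticomm (L M N : R) :
    opP2 L * opQ2 M N + opQ2 M N * opP2 L = 0 := by
  refine LinearMap.ext fun f => ?_; funext i j k l
  fin_cases i <;> fin_cases j <;> fin_cases k <;> fin_cases l <;>
    simp [opP2_apply, opQ2_apply] <;> ring

lemma opP1_opQ2_anticomm (M N : R) : opP1 * opQ2 M N + opQ2 M N * opP1 = N • 1 := by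
  refine LinearMap.ext fun f => ?_; funext i j k l
  fin_cases i <;> fin_cases j <;> fin_cases k <;> fin_cases l <;>
    simp [opP1_apply, opQ2_apply] <;> ring

lemma opP2_opQ1_anticomm (L N : R) : opP2 L * opQ1 N + opQ1 N * opP2 L = N • 1 := by
  refine LinearMap.ext fun f => ?_; funext i j k l
  fin_cases i <;> fin_cases j <;> fin_cases k <;> simp [opP2_apply, opQ1_apply] <;> ring

/-- The vacuum vector. -/
def vac (R : Type*) [CommRing R] : Fock R :=
  Pi.single 0 (Pi.single 0 (Pi.single 0 (Pi.single 0 1)))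

lemma parity_vac : parity (vac R) = vac R := by
  funext i j k l
  fin_cases i <;> fin_cases j <;> fin_cases k <;> fin_cases l <;> simp [parity_apply, vac]

lemma ordered_monomial_vac (L M N : R) (i j k l : Fin 2) :
    (opP1 ^ i.val * opP2 L ^ j.val * opQ1 N ^ k.val * opQ2 M N ^ l.val :
      Module.End R (Fock R)) (vac R) =
      (Pi.single i (Pi.single j (Pi.single k (Pi.single l 1))) : Fock R) := by
  have h4 : (opQ2 M N ^ l.val) (vac R) =
      (Pi.single 0 (Pi.single 0 (Pi.single 0 (Pi.single l 1))) : Fock R) := by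
    fin_cases l
    · simp [vac]
    · funext i j k l
      fin_cases i <;> fin_cases j <;> fin_cases k <;> fin_cases l <;> simp [vac, opQ2_apply]
  have h3 : (opQ1 N ^ k.val) (Pi.single 0 (Pi.single 0 (Pi.single 0 (Pi.single l 1)))) =
      (Pi.single 0 (Pi.single 0 (Pi.single k (Pi.single l 1))) : Fock R) := by
    fin_cases k
    · simp
    · funext i j k
      fin_cases i <;> fin_cases j <;> fin_cases k <;> funext l <;> simp [opQ1_apply]
  have h2 : (opP2 L ^ j.val) (Pi.single 0 (Pi.single 0 (Pi.single k (Pi.single l 1)))) =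
      (Pi.single 0 (Pi.single j (Pi.single k (Pi.single l 1))) : Fock R) := by
    fin_cases j
    · simp
    · funext i j
      fin_cases i <;> fin_cases j <;> funext k l <;> simp [opP2_apply]
  have h1 : (opP1 ^ i.val) (Pi.single 0 (Pi.single j (Pi.single k (Pi.single l (1 : R))))) =
      (Pi.single i (Pi.single j (Pi.single k (Pi.single l 1))) : Fock R) := by
    fin_cases i
    · simp
    · funext i
      fin_cases i <;> funext j k l <;> simp [opP1_apply]
  simp only [Module.End.mul_apply, h4, h3, h2, h1]

end Fock

section Representation

variable {k} {R : Type*} [CommRing R] [Algebra k R]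

/-- The block-diagonal `2 × 2` matrix with diagonal entries `X` and `Y`. -/
def blk {E : Type*} [Ring E] (X Y : E) : Matrix (Fin 2) (Fin 2) E := Matrix.diagonal ![X, Y]

section blk

variable {E : Type*} [Ring E]

lemma blk_mul (X Y X' Y' : E) : blk X Y * blk X' Y' = blk (X * X') (Y * Y') := by
  simp only [blk, Matrix.diagonal_mul_diagonal]
  congr 1; funext i; fin_cases i <;> rfl

lemma blk_add (X Y X' Y' : E) : blk X Y + blk X' Y' = blk (X + X') (Y + Y') := by
  simp only [blk, Matrix.diagonal_add]
  congr 1; funext i; fin_cases i <;> rfl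

lemma neg_blk (X Y : E) : -blk X Y = blk (-X) (-Y) := by
  simp only [blk, Matrix.diagonal_neg]
  congr 1; funext i; fin_cases i <;> rfl

lemma blk_one : blk (1 : E) 1 = 1 := by
  rw [blk, ← Matrix.diagonal_one]
  congr 1; funext i; fin_cases i <;> rfl

lemma blk_zero : blk (0 : E) 0 = 0 := by
  rw [blk, ← Matrix.diagonal_zero]
  congr 1; funext i; fin_cases i <;> rfl

lemma smul_blk [Algebra k E] (t : k) (X Y : E) : t • blk X Y = blk (t • X) (t • Y) := by
  rw [blk, ← Matrix.diagonal_smul]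
  congr 1; funext i; fin_cases i <;> rfl

lemma blk_pow (X Y : E) (n : ℕ) : blk X Y ^ n = blk (X ^ n) (Y ^ n) := by
  induction n with
  | zero => simp only [pow_zero, blk_one]
  | succ n ih => rw [pow_succ, ih, blk_mul, ← pow_succ, ← pow_succ]

lemma blk_eq (X Y : E) : blk X Y = !![X, 0; 0, Y] := by
  ext i j; fin_cases i <;> fin_cases j <;> rfl

lemma swap_mul_blk (Z X Y : E) (hX : Z * X = X * Z) :
    !![0, 1; Z, 0] * blk X Y = blk Y X * !![0, 1; Z, 0] := by
  simp [blk_eq, hX]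

lemma swap_mul_swap (Z : E) : !![0, 1; Z, 0] * !![0, 1; Z, 0] = blk Z Z := by
  simp [blk_eq]

end blk

/-- Images of the generators in `2 × 2` matrices over `E`; the two diagonal entries are exchanged
by conjugation with `d`. -/
def genMatrix {E : Type*} [Ring E] [Algebra R E] (A B C : R) (w P₁ P₂ Q₁ Q₂ : E) :
    Gen → Matrix (Fin 2) (Fin 2) E
  | a => blk (A • 1) (A • 1)
  | b => blk (B • w) (C • w)
  | c => blk (C • w) (B • w)
  | d => !![0, 1; A • 1, 0]
  | p1 => blk P₁ P₂
  | p2 => blk P₂ P₁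
  | q1 => blk Q₁ Q₂
  | q2 => blk Q₂ Q₁

lemma genMatrix_rel {E : Type*} [Ring E] [Algebra R E] [Algebra k E] [IsScalarTower k R E]
    {lam mu alp : k} {A B C : R} (hA : A * A = 1) (hB : B * B = 1) (hC : C * C = 1)
    {w P₁ P₂ Q₁ Q₂ : E} (hw : w * w = 1) (hwP₁ : w * P₁ = -(P₁ * w)) (hwP₂ : w * P₂ = -(P₂ * w))
    (hwQ₁ : w * Q₁ = -(Q₁ * w)) (hwQ₂ : w * Q₂ = -(Q₂ * w))
    (hP₁ : P₁ * P₁ = 0) (hP₂ : P₂ * P₂ = 0) (hQ₁ : Q₁ * Q₁ = 0) (hQ₂ : Q₂ * Q₂ = 0)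
    (hPP : P₁ * P₂ + P₂ * P₁ = (lam • (1 - B * C)) • 1)
    (hQQ : Q₁ * Q₂ + Q₂ * Q₁ = (mu • (1 - B * C)) • 1)
    (h₁₁ : P₁ * Q₁ + Q₁ * P₁ = 0) (h₂₂ : P₂ * Q₂ + Q₂ * P₂ = 0)
    (h₁₂ : P₁ * Q₂ + Q₂ * P₁ = (alp • (1 - B * C)) • 1)
    (h₂₁ : P₂ * Q₁ + Q₁ * P₂ = (alp • (1 - B * C)) • 1)
    {x y : FreeAlgebra k Gen} (h : Rel k lam mu alp x y) :
    FreeAlgebra.lift k (genMatrix A B C w P₁ P₂ Q₁ Q₂) x =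
      FreeAlgebra.lift k (genMatrix A B C w P₁ P₂ Q₁ Q₂) y := by
  have hz (t : k) : t • (1 - blk (B • w) (C • w) * blk (C • w) (B • w)) =
      blk ((t • (1 - B * C)) • 1) ((t • (1 - B * C)) • 1) := by
    rw [← blk_one, sub_eq_add_neg, blk_mul, neg_blk, blk_add, smul_blk]
    simp only [smul_mul_smul_comm, hw, mul_comm C B, ← sub_eq_add_neg, smul_assoc,
      sub_smul, one_smul]
  have hBC : (B • w) * (C • w) = (C • w) * (B • w) := by
    simp only [smul_mul_smul_comm, mul_comm C B]
  have hs (t : R) (ht : t * t = 1) : (t • w) * (t • w) = 1 := by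
    rw [smul_mul_smul_comm, ht, hw, one_smul]
  have hAA : (A • 1 : E) * (A • 1) = 1 := by
    rw [smul_mul_smul_comm, hA, one_mul, one_smul]
  have hcomm (X : E) : (A • 1) * X = X * (A • 1) := by
    rw [smul_mul_assoc, mul_smul_comm, one_mul, mul_one]
  have hneg {X : E} (h : w * X = -(X * w)) (t : R) : (t • w) * X = -(X * (t • w)) := by
    rw [smul_mul_assoc, h, mul_smul_comm, smul_neg]
  have hPP' := (add_comm _ _).trans hPP
  have hQQ' := (add_comm _ _).trans hQQ
  cases h <;>
    simp only [g, map_mul, map_add, map_neg, map_smul, map_sub, map_one, map_zero,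
      FreeAlgebra.lift_ι_apply, genMatrix, hz]
  case hdd => exact swap_mul_swap _
  case hda | hdb | hdc | dp1 | dp2 | dq1 | dq2 => exact swap_mul_blk _ _ _ (hcomm _)
  all_goals
    simp only [blk_mul, blk_add, neg_blk, blk_zero, blk_one, hAA, hs, hB, hC, hcomm, hBC,
      hneg hwP₁, hneg hwP₂, hneg hwQ₁, hneg hwQ₂, hP₁, hP₂, hQ₁, hQ₂, hPP, hQQ, hPP', hQQ',
      h₁₁, h₂₂, h₁₂, h₂₁]

/-- The representation of `U_14(λ,μ,α)` determined by three commuting involutions in `R`. -/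
noncomputable def rep (lam mu alp : k) {A B C : R} (hA : A * A = 1) (hB : B * B = 1)
    (hC : C * C = 1) : U k lam mu alp →ₐ[k] Matrix (Fin 2) (Fin 2) (Module.End R (Fock R)) :=
  RingQuot.liftAlgHom k ⟨FreeAlgebra.lift k (genMatrix A B C parity opP1
    (opP2 (lam • (1 - B * C))) (opQ1 (alp • (1 - B * C)))
    (opQ2 (mu • (1 - B * C)) (alp • (1 - B * C)))), fun _ _ h =>
    genMatrix_rel (E := Module.End R (Fock R)) hA hB hC parity_mul_parity parity_mul_opP1 (parity_mul_opP2 _)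
      (parity_mul_opQ1 _) (parity_mul_opQ2 _ _) opP1_mul_opP1 (opP2_mul_opP2 _)
      (opQ1_mul_opQ1 _) (opQ2_mul_opQ2 _ _) (opP1_opP2_anticomm _) (opQ1_opQ2_anticomm _ _)
      (opP1_opQ1_anticomm _) (opP2_opQ2_anticomm _ _ _) (opP1_opQ2_anticomm _ _)
      (opP2_opQ1_anticomm _ _) h⟩

lemma rep_mono_vac (lam mu alp : k) {A B C : R} (hA : A * A = 1) (hB : B * B = 1)
    (hC : C * C = 1) (e : Gen → Fin 2) (h : Fin 2) :
    rep lam mu alp hA hB hC (mono k lam mu alp e) 0 h (vac R) =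
      if e d = h then (A ^ (e a).val * B ^ (e b).val * C ^ (e c).val) •
        (Pi.single (e p1) (Pi.single (e p2) (Pi.single (e q1) (Pi.single (e q2) 1))) : Fock R)
      else 0 := by
  have hD (X Y Z : Module.End R (Fock R)) (n : Fin 2) :
      (blk X Y * !![0, 1; Z, 0] ^ n.val) 0 h = if n = h then X else 0 := by
    fin_cases n <;> fin_cases h <;> simp [blk_eq]
  have hpar (n : ℕ) : (parity ^ n) (vac R) = vac R := by
    induction n with
    | zero => rfl
    | succ n ih => rw [pow_succ, Module.End.mul_apply, parity_vac, ih]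
  simp only [rep, mono, mk, g, RingQuot.liftAlgHom_mkAlgHom_apply, map_mul, map_pow,
    FreeAlgebra.lift_ι_apply, genMatrix, blk_pow, blk_mul, hD]
  split_ifs with hd
  · simp only [smul_pow, one_pow, mul_smul_comm, mul_one, smul_mul_assoc, LinearMap.smul_apply,
      Module.End.mul_apply, hpar]
    rw [← ordered_monomial_vac (lam • (1 - B * C)) (mu • (1 - B * C)) (alp • (1 - B * C))]
    simp only [Module.End.mul_apply, smul_smul]
    congr 1; ring
  · rfl

end Representation

/-- The monomials are linearly independent. -/
lemma linearIndependent_mono (lam mu alp : k) : LinearIndependent k (mono k lam mu alp) := by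
  let G := Fin 2 × Fin 2 × Fin 2
  let x (v : G) : AddMonoidAlgebra k G := AddMonoidAlgebra.single v 1
  have hmul (v v' : G) : x v * x v' = x (v + v') := by
    simp only [x, AddMonoidAlgebra.single_mul_single, mul_one]
  have hx (v : G) : x v * x v = 1 := by
    rw [hmul, show v + v = 0 by revert v; decide]; rfl
  have hmonomial (i j l : Fin 2) :
      x (1, 0, 0) ^ i.val * x (0, 1, 0) ^ j.val * x (0, 0, 1) ^ l.val = x (i, j, l) := by
    have h1 : 1 = x 0 := rfl
    fin_cases i <;> fin_cases j <;> fin_cases l <;> simp [h1, hmul] <;> rfl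
  refine linearIndependent_iff'.2 fun s t hst e he => ?_
  have := congrArg (fun u => (rep lam mu alp (hx (1, 0, 0)) (hx (0, 1, 0)) (hx (0, 0, 1)) u 0 (e d)
    (vac _) (e p1) (e p2) (e q1) (e q2)).coeff (e a, e b, e c)) hst
  simp only [map_sum, map_smul, Matrix.sum_apply, Matrix.smul_apply, LinearMap.sum_apply,
    LinearMap.smul_apply, rep_mono_vac, hmonomial, Finset.sum_apply, Pi.smul_apply,
    AddMonoidAlgebra.coeff_sum, Finsupp.finsetSum_apply] at this
  rw [Finset.sum_eq_single_of_mem e he] at this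
  · simpa [x] using this
  · intro e' _ hne
    split_ifs with hd
    swap
    · simp
    by_cases h1 : e' p1 = e p1
    swap
    · simp [Pi.single_eq_of_ne' h1]
    by_cases h2 : e' p2 = e p2
    swap
    · simp [h1, Pi.single_eq_of_ne' h2]
    by_cases h3 : e' q1 = e q1
    swap
    · simp [h1, h2, Pi.single_eq_of_ne' h3]
    by_cases h4 : e' q2 = e q2
    swap
    · simp [h1, h2, h3, Pi.single_eq_of_ne' h4]
    have hG : ((e' a, e' b, e' c) : G) ≠ (e a, e b, e c) := by
      intro hG
      simp only [Prod.mk.injEq] at hG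
      exact hne (funext fun i => by cases i <;> simp [*])
    simp [h1, h2, h3, h4, x, Finsupp.single_eq_of_ne' hG]

section Spanning

variable {k} {S : Type*} [Ring S] [Algebra k S]

/-- The submodule `N + x N`. -/
def adj (x : S) (N : Submodule k S) : Submodule k S := N ⊔ N.map (LinearMap.mulLeft k x)

lemma mem_adj {x : S} {N : Submodule k S} {u : S} :
    u ∈ adj x N ↔ ∃ n ∈ N, ∃ n' ∈ N, n + x * n' = u := by
  simp [adj, Submodule.mem_sup]

lemma le_adj (x : S) (N : Submodule k S) : N ≤ adj x N := le_sup_left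

lemma mul_mem_adj {x : S} {N : Submodule k S} {n : S} (hn : n ∈ N) : x * n ∈ adj x N :=
  mem_adj.2 ⟨0, N.zero_mem, n, hn, zero_add _⟩

lemma adj_stable_self {x : S} {N : Submodule k S} {s : k} (hx : x * x = s • 1) :
    ∀ n ∈ adj x N, x * n ∈ adj x N := by
  intro n hn
  obtain ⟨m, hm, m', hm', rfl⟩ := mem_adj.1 hn
  rw [mul_add, ← mul_assoc, hx, smul_mul_assoc, one_mul]
  exact add_mem (mul_mem_adj hm) (le_adj _ _ (N.smul_mem s hm'))

lemma adj_stable {x y z : S} {s t : k} {N : Submodule k S} (hy : ∀ n ∈ N, y * n ∈ N)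
    (hz : ∀ n ∈ N, z * n ∈ N) (h : y * x = s • (x * y) + t • z) :
    ∀ n ∈ adj x N, y * n ∈ adj x N := by
  intro n hn
  obtain ⟨m, hm, m', hm', rfl⟩ := mem_adj.1 hn
  rw [mul_add, ← mul_assoc, h, add_mul, smul_mul_assoc, smul_mul_assoc, mul_assoc]
  exact add_mem (le_adj _ _ (hy _ hm)) (add_mem (Submodule.smul_mem _ _ (mul_mem_adj (hy _ hm')))
    (le_adj _ _ (N.smul_mem _ (hz _ hm'))))

lemma adj_stable_of_comm {x y : S} {s : k} {N : Submodule k S} (hy : ∀ n ∈ N, y * n ∈ N)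
    (h : y * x = s • (x * y)) : ∀ n ∈ adj x N, y * n ∈ adj x N :=
  adj_stable (z := 0) (s := s) (t := 0) hy (by simp) (by simpa using h)

lemma adj_swap {x y w : S} {N K : Submodule k S} (hN : ∀ n ∈ N, w * n ∈ K)
    (hK : ∀ n ∈ K, y * n ∈ K) (h : w * x = y * w) : ∀ n ∈ adj x N, w * n ∈ K := by
  intro n hn
  obtain ⟨m, hm, m', hm', rfl⟩ := mem_adj.1 hn
  rw [mul_add, ← mul_assoc, h, mul_assoc]
  exact add_mem (hN _ hm) (hK _ (hN _ hm'))

lemma adj_mul_mem {x u : S} {N K : Submodule k S}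
    (h : ∀ i : Fin 2, ∀ n ∈ N, u * x ^ i.val * n ∈ K) : ∀ n ∈ adj x N, u * n ∈ K := by
  intro n hn
  obtain ⟨m, hm, m', hm', rfl⟩ := mem_adj.1 hn
  rw [mul_add, ← mul_assoc]
  exact add_mem (by simpa using h 0 m hm) (by simpa using h 1 m' hm')

lemma one_sub_mul_stable {x y : S} {N : Submodule k S} (hx : ∀ n ∈ N, x * n ∈ N)
    (hy : ∀ n ∈ N, y * n ∈ N) : ∀ n ∈ N, (1 - x * y) * n ∈ N := by
  intro n hn
  rw [sub_mul, one_mul, mul_assoc]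
  exact sub_mem hn (hx _ (hy _ hn))

/-- A subspace of an algebra generated by the images of the generators which contains `1` and is
stable under left multiplication by these images is everything. -/
lemma eq_top_of_stable {π : FreeAlgebra k Gen →ₐ[k] S} (hπ : Function.Surjective π)
    (K : Submodule k S) (h1 : 1 ∈ K) (hK : ∀ x : Gen, ∀ n ∈ K, π (g k x) * n ∈ K) : K = ⊤ := by
  have key (u : FreeAlgebra k Gen) : ∀ n ∈ K, π u * n ∈ K := by
    induction u using FreeAlgebra.induction with
    | grade0 r =>
      intro n hn
      rw [AlgHom.commutes, ← Algebra.smul_def]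
      exact K.smul_mem _ hn
    | grade1 x => exact hK x
    | mul u v hu hv =>
      intro n hn
      rw [map_mul, mul_assoc]
      exact hu _ (hv _ hn)
    | add u v hu hv =>
      intro n hn
      rw [map_add, add_mul]
      exact add_mem (hu _ hn) (hv _ hn)
  refine eq_top_iff.2 fun u _ => ?_
  obtain ⟨v, rfl⟩ := hπ u
  simpa using key v 1 h1

/-- In any quotient of the free algebra in which the defining relations hold, the monomials
span. -/
lemma span_monomials (lam mu alp : k) {π : FreeAlgebra k Gen →ₐ[k] S}
    (hπ : Function.Surjective π)
    (rel : ∀ {u v : FreeAlgebra k Gen}, Rel k lam mu alp u v → π u = π v) :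
    Submodule.span k (Set.range fun e : Gen → Fin 2 => π
      (g k p1 ^ (e p1).val * g k p2 ^ (e p2).val * g k q1 ^ (e q1).val * g k q2 ^ (e q2).val *
        g k a ^ (e a).val * g k b ^ (e b).val * g k c ^ (e c).val * g k d ^ (e d).val)) = ⊤ := by
  let y (x : Gen) : S := π (g k x)
  let z : S := 1 - y b * y c
  have one {x : Gen} (h : Rel k lam mu alp (g k x * g k x) 1) : y x * y x = (1 : k) • 1 := by
    simpa [y] using rel h
  have zero {x : Gen} (h : Rel k lam mu alp (g k x * g k x) 0) : y x * y x = (0 : k) • 1 := by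
    simpa [y] using rel h
  have comm {x x' : Gen} (h : Rel k lam mu alp (g k x * g k x') (g k x' * g k x)) :
      y x * y x' = (1 : k) • (y x' * y x) := by
    simpa [y] using rel h
  have comm_symm {x x' : Gen} (h : Rel k lam mu alp (g k x * g k x') (g k x' * g k x)) :
      y x' * y x = (1 : k) • (y x * y x') := by
    simpa [y] using (rel h).symm
  have neg {x x' : Gen} (h : Rel k lam mu alp (g k x * g k x') (-(g k x' * g k x))) :
      y x * y x' = (-1 : k) • (y x' * y x) := by
    simpa [y] using rel h
  have anti {x x' : Gen} {t : k} (h : Rel k lam mu alp (g k x' * g k x + g k x * g k x')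
      (t • (1 - g k b * g k c))) : y x * y x' = (-1 : k) • (y x' * y x) + t • z := by
    have := rel h
    simp only [map_add, map_mul, map_smul, map_sub, map_one] at this
    rw [neg_one_smul, eq_neg_add_iff_add_eq]
    exact this
  have anti_zero {x x' : Gen} (h : Rel k lam mu alp (g k x' * g k x + g k x * g k x') 0) :
      y x * y x' = (-1 : k) • (y x' * y x) := by
    have := rel h
    simp only [map_add, map_mul, map_zero] at this
    rw [neg_one_smul]
    exact (neg_eq_of_add_eq_zero_right this).symm
  have swap {x x' w : Gen} (h : Rel k lam mu alp (g k w * g k x) (g k x' * g k w)) :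
      y w * y x = y x' * y w := by
    simpa [y] using rel h
  let ND : Submodule k S := Submodule.span k {1, y d}
  let NC := adj (y c) ND
  let NB := adj (y b) NC
  let NA := adj (y a) NB
  let NQ2 := adj (y q2) NA
  let NQ1 := adj (y q1) NQ2
  let NP2 := adj (y p2) NQ1
  let NP1 := adj (y p1) NP2
  have cC : ∀ n ∈ NC, y c * n ∈ NC := adj_stable_self (one .hcc)
  have cB : ∀ n ∈ NB, y c * n ∈ NB := adj_stable_of_comm cC (comm_symm .hbc)
  have bB : ∀ n ∈ NB, y b * n ∈ NB := adj_stable_self (one .hbb)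
  have cA : ∀ n ∈ NA, y c * n ∈ NA := adj_stable_of_comm cB (comm_symm .hac)
  have bA : ∀ n ∈ NA, y b * n ∈ NA := adj_stable_of_comm bB (comm_symm .hab)
  have aA : ∀ n ∈ NA, y a * n ∈ NA := adj_stable_self (one .haa)
  have cQ2 : ∀ n ∈ NQ2, y c * n ∈ NQ2 := adj_stable_of_comm cA (neg .cq2)
  have bQ2 : ∀ n ∈ NQ2, y b * n ∈ NQ2 := adj_stable_of_comm bA (neg .bq2)
  have aQ2 : ∀ n ∈ NQ2, y a * n ∈ NQ2 := adj_stable_of_comm aA (comm .aq2)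
  have q2Q2 : ∀ n ∈ NQ2, y q2 * n ∈ NQ2 := adj_stable_self (zero .q2q2)
  have cQ1 : ∀ n ∈ NQ1, y c * n ∈ NQ1 := adj_stable_of_comm cQ2 (neg .cq1)
  have bQ1 : ∀ n ∈ NQ1, y b * n ∈ NQ1 := adj_stable_of_comm bQ2 (neg .bq1)
  have aQ1 : ∀ n ∈ NQ1, y a * n ∈ NQ1 := adj_stable_of_comm aQ2 (comm .aq1)
  have q2Q1 : ∀ n ∈ NQ1, y q2 * n ∈ NQ1 :=
    adj_stable q2Q2 (one_sub_mul_stable bQ2 cQ2) (anti .q1q2)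
  have q1Q1 : ∀ n ∈ NQ1, y q1 * n ∈ NQ1 := adj_stable_self (zero .q1q1)
  have cP2 : ∀ n ∈ NP2, y c * n ∈ NP2 := adj_stable_of_comm cQ1 (neg .cp2)
  have bP2 : ∀ n ∈ NP2, y b * n ∈ NP2 := adj_stable_of_comm bQ1 (neg .bp2)
  have aP2 : ∀ n ∈ NP2, y a * n ∈ NP2 := adj_stable_of_comm aQ1 (comm .ap2)
  have q2P2 : ∀ n ∈ NP2, y q2 * n ∈ NP2 := adj_stable_of_comm q2Q1 (anti_zero .p2q2)
  have q1P2 : ∀ n ∈ NP2, y q1 * n ∈ NP2 :=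
    adj_stable q1Q1 (one_sub_mul_stable bQ1 cQ1) (anti .p2q1)
  have p2P2 : ∀ n ∈ NP2, y p2 * n ∈ NP2 := adj_stable_self (zero .p2p2)
  have cP1 : ∀ n ∈ NP1, y c * n ∈ NP1 := adj_stable_of_comm cP2 (neg .cp1)
  have bP1 : ∀ n ∈ NP1, y b * n ∈ NP1 := adj_stable_of_comm bP2 (neg .bp1)
  have aP1 : ∀ n ∈ NP1, y a * n ∈ NP1 := adj_stable_of_comm aP2 (comm .ap1)
  have q2P1 : ∀ n ∈ NP1, y q2 * n ∈ NP1 :=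
    adj_stable q2P2 (one_sub_mul_stable bP2 cP2) (anti .p1q2)
  have q1P1 : ∀ n ∈ NP1, y q1 * n ∈ NP1 := adj_stable_of_comm q1P2 (anti_zero .p1q1)
  have p2P1 : ∀ n ∈ NP1, y p2 * n ∈ NP1 :=
    adj_stable p2P2 (one_sub_mul_stable bP2 cP2) (anti .p1p2)
  have p1P1 : ∀ n ∈ NP1, y p1 * n ∈ NP1 := adj_stable_self (zero .p1p1)
  have hle : ND ≤ NP1 := (le_adj _ _).trans <| (le_adj _ _).trans <| (le_adj _ _).trans <|
    (le_adj _ _).trans <| (le_adj _ _).trans <| (le_adj _ _).trans (le_adj _ _)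
  have h1 : 1 ∈ NP1 := hle (Submodule.subset_span (by simp))
  have hd : y d ∈ NP1 := hle (Submodule.subset_span (by simp))
  have hND {u : S} {K : Submodule k S} (h : ∀ i : Fin 2, u * y d ^ i.val ∈ K) :
      ∀ n ∈ ND, u * n ∈ K := by
    intro n hn
    obtain ⟨r, s, rfl⟩ := Submodule.mem_span_pair.1 hn
    rw [mul_add, mul_smul_comm, mul_smul_comm]
    exact add_mem (K.smul_mem _ (by simpa using h 0)) (K.smul_mem _ (by simpa using h 1))
  have hdd : y d * y d = y a := by simpa [y] using rel .hdd
  have dD : ∀ n ∈ ND, y d * n ∈ NP1 := hND fun i => by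
    fin_cases i
    · simpa using hd
    · simpa [hdd] using aP1 1 h1
  have dP1 : ∀ n ∈ NP1, y d * n ∈ NP1 :=
    adj_swap (adj_swap (adj_swap (adj_swap (adj_swap (adj_swap (adj_swap dD
      bP1 (swap .hdc)) cP1 (swap .hdb)) aP1 (swap .hda)) q1P1 (swap .dq2)) q2P1 (swap .dq1))
      p1P1 (swap .dp2)) p2P1 (swap .dp1)
  have htop : NP1 = ⊤ := eq_top_of_stable hπ NP1 h1 fun x => by
    cases x
    exacts [aP1, bP1, cP1, dP1, p1P1, p2P1, q1P1, q2P1]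
  have hmem (e : Gen → Fin 2) : 1 * y p1 ^ (e p1).val * y p2 ^ (e p2).val * y q1 ^ (e q1).val *
      y q2 ^ (e q2).val * y a ^ (e a).val * y b ^ (e b).val * y c ^ (e c).val * y d ^ (e d).val ∈
      Submodule.span k (Set.range fun e : Gen → Fin 2 => π
        (g k p1 ^ (e p1).val * g k p2 ^ (e p2).val * g k q1 ^ (e q1).val * g k q2 ^ (e q2).val *
          g k a ^ (e a).val * g k b ^ (e b).val * g k c ^ (e c).val * g k d ^ (e d).val)) :=
    Submodule.subset_span ⟨e, by simp [y]⟩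
  refine eq_top_iff.2 fun u _ => ?_
  rw [← one_mul u]
  exact adj_mul_mem (fun i₁ => adj_mul_mem fun i₂ => adj_mul_mem fun j₁ => adj_mul_mem fun j₂ =>
    adj_mul_mem fun r => adj_mul_mem fun s => adj_mul_mem fun t => hND fun v => hmem fun
      | p1 => i₁ | p2 => i₂ | q1 => j₁ | q2 => j₂ | a => r | b => s | c => t | d => v)
    u (htop ▸ Submodule.mem_top : u ∈ NP1)

end Spanning

/-- The eight generators. -/
def genEquiv : Gen ≃ Fin 8 where
  toFun
    | a => 0 | b => 1 | c => 2 | d => 3 | p1 => 4 | p2 => 5 | q1 => 6 | q2 => 7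
  invFun := ![a, b, c, d, p1, p2, q1, q2]
  left_inv x := by cases x <;> rfl
  right_inv i := by fin_cases i <;> rfl

theorem stmt6 [IsAlgClosed k] [CharZero k] (lam mu alp : k) :
    Module.finrank k (U k lam mu alp) = 256 ∧
    LinearIndependent k (mono k lam mu alp) ∧
    Submodule.span k (Set.range (mono k lam mu alp)) = ⊤ := by
  have hli := linearIndependent_mono k lam mu alp
  have hspan : Submodule.span k (Set.range (mono k lam mu alp)) = ⊤ :=
    span_monomials lam mu alp (RingQuot.mkAlgHom_surjective k _)
      (fun h => RingQuot.mkAlgHom_rel k h)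
  refine ⟨?_, hli, hspan⟩
  rw [Module.finrank_eq_nat_card_basis (Module.Basis.mk hli hspan.ge),
    Nat.card_congr (Equiv.arrowCongr genEquiv (Equiv.refl (Fin 2)))]
  simp

end Stmt6
end

section
/- For all λ, μ, α, ν ∈ k, the algebra U_15(λ,μ,α,ν) is 256-dimensional over k; the images of the monomials p1^i p2^j q1^k q2^l a^e b^f c^g d^h with i, j, k, l, e, f, g, h ∈ {0,1} form a k-basis. -/
namespace Stmt7

/-- The generators `a, b, c, d, p1, p2, q1, q2`. -/
inductive Gen | a | b | c | d | p1 | p2 | q1 | q2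

open Gen

variable (k : Type*) [Field k]

/-- The generators viewed inside the free algebra. -/
abbrev g (x : Gen) : FreeAlgebra k Gen := FreeAlgebra.ι k x

variable (lam mu alp nu : k)

/-- The defining relations of `U_15(λ,μ,α,ν)`: the `H`-relations together with the listed
relations involving `p1, p2, q1, q2`. -/
inductive Rel : FreeAlgebra k Gen → FreeAlgebra k Gen → Prop
  -- H-relations
  | haa : Rel (g k a * g k a) 1
  | hbb : Rel (g k b * g k b) 1
  | hcc : Rel (g k c * g k c) 1
  | hab : Rel (g k a * g k b) (g k b * g k a)
  | hac : Rel (g k a * g k c) (g k c * g k a)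
  | hbc : Rel (g k b * g k c) (g k c * g k b)
  | hdd : Rel (g k d * g k d) (g k a)
  | hda : Rel (g k d * g k a) (g k a * g k d)
  | hdb : Rel (g k d * g k b) (g k c * g k d)
  | hdc : Rel (g k d * g k c) (g k b * g k d)
  | ap1 : Rel (g k a * g k p1) (g k p1 * g k a)
  | bp1 : Rel (g k b * g k p1) (-(g k p1 * g k b))
  | cp1 : Rel (g k c * g k p1) (-(g k p1 * g k c))
  | dp1 : Rel (g k d * g k p1) (g k p2 * g k d)
  | ap2 : Rel (g k a * g k p2) (g k p2 * g k a)
  | bp2 : Rel (g k b * g k p2) (-(g k p2 * g k b))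
  | cp2 : Rel (g k c * g k p2) (-(g k p2 * g k c))
  | dp2 : Rel (g k d * g k p2) (g k p1 * g k d)
  | p1p1 : Rel (g k p1 * g k p1) (0)
  | p2p2 : Rel (g k p2 * g k p2) (0)
  | p1p2 : Rel (g k p1 * g k p2 + g k p2 * g k p1) (lam • (1 - g k b * g k c))
  | aq1 : Rel (g k a * g k q1) (g k q1 * g k a)
  | bq1 : Rel (g k b * g k q1) (-(g k q1 * g k b))
  | cq1 : Rel (g k c * g k q1) (-(g k q1 * g k c))
  | dq1 : Rel (g k d * g k q1) (g k q2 * g k d)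
  | aq2 : Rel (g k a * g k q2) (g k q2 * g k a)
  | bq2 : Rel (g k b * g k q2) (-(g k q2 * g k b))
  | cq2 : Rel (g k c * g k q2) (-(g k q2 * g k c))
  | dq2 : Rel (g k d * g k q2) (g k q1 * g k d)
  | q1q1 : Rel (g k q1 * g k q1) (0)
  | q2q2 : Rel (g k q2 * g k q2) (0)
  | q1q2 : Rel (g k q1 * g k q2 + g k q2 * g k q1) (mu • (1 - g k b * g k c))
  | p1q1 : Rel (g k p1 * g k q1 + g k q1 * g k p1) (nu • (1 - g k a))
  | p2q2 : Rel (g k p2 * g k q2 + g k q2 * g k p2) (nu • (1 - g k a))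
  | p1q2 : Rel (g k p1 * g k q2 + g k q2 * g k p1) (alp • (1 - g k a * g k b * g k c))
  | p2q1 : Rel (g k p2 * g k q1 + g k q1 * g k p2) (alp • (1 - g k a * g k b * g k c))

/-- The algebra `U_15(λ,μ,α,ν)`. -/
abbrev U := RingQuot (Rel k lam mu alp nu)

/-- The quotient map. -/
noncomputable abbrev mk : FreeAlgebra k Gen →ₐ[k] U k lam mu alp nu :=
  RingQuot.mkAlgHom k (Rel k lam mu alp nu)

/-- The image of the monomial `p1^i p2^j q1^k q2^l a^e b^f c^g d^h` in `U_15(λ,μ,α,ν)`. -/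
noncomputable def mono (e : Gen → Fin 2) : U k lam mu alp nu :=
  mk k lam mu alp nu
    (g k p1 ^ (e p1).val * g k p2 ^ (e p2).val * g k q1 ^ (e q1).val * g k q2 ^ (e q2).val *
      g k a ^ (e a).val * g k b ^ (e b).val * g k c ^ (e c).val * g k d ^ (e d).val)

section Span

variable {k} {R : Type*} [Ring R] [Algebra k R]

/-- The elements whose left multiplication preserves the submodule `N`. -/
def leftStab (N : Submodule k R) : Subalgebra k R where
  carrier := {u | ∀ n ∈ N, u * n ∈ N}
  mul_mem' {x y} hx hy n hn := by
    rw [mul_assoc]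
    exact hx _ (hy n hn)
  add_mem' {x y} hx hy n hn := by
    rw [add_mul]
    exact N.add_mem (hx n hn) (hy n hn)
  algebraMap_mem' r n hn := by
    rw [← Algebra.smul_def]
    exact N.smul_mem r hn

/-- The submodule `N + x N`. -/
def adjoinLeft (x : R) (N : Submodule k R) : Submodule k R :=
  ⨆ i : Fin 2, N.map (LinearMap.mulLeft k (x ^ i.val))

theorem adjoinLeft_le {x : R} {N P : Submodule k R} :
    adjoinLeft x N ≤ P ↔ ∀ i : Fin 2, ∀ n ∈ N, x ^ i.val * n ∈ P := by
  simp only [adjoinLeft, iSup_le_iff, Submodule.map_le_iff_le_comap]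
  rfl

theorem pow_mul_mem_adjoinLeft {x n : R} {N : Submodule k R} (i : Fin 2) (hn : n ∈ N) :
    x ^ i.val * n ∈ adjoinLeft x N :=
  adjoinLeft_le.1 le_rfl i n hn

theorem mem_adjoinLeft {x n : R} {N : Submodule k R} (hn : n ∈ N) : n ∈ adjoinLeft x N := by
  simpa using pow_mul_mem_adjoinLeft (x := x) 0 hn

theorem mul_mem_adjoinLeft {x n : R} {N : Submodule k R} (hn : n ∈ N) :
    x * n ∈ adjoinLeft x N := by
  simpa using pow_mul_mem_adjoinLeft (x := x) 1 hn

theorem mem_leftStab_adjoinLeft_self {x : R} {N : Submodule k R} (r : k) (h : x * x = r • 1) :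
    x ∈ leftStab (adjoinLeft x N) := by
  refine adjoinLeft_le (P := (adjoinLeft x N).comap (LinearMap.mulLeft k x)).2 fun i n hn => ?_
  simp only [Submodule.mem_comap, LinearMap.mulLeft_apply]
  fin_cases i
  · simpa using mul_mem_adjoinLeft hn
  · simpa [← mul_assoc, h] using Submodule.smul_mem _ r (mem_adjoinLeft hn)

theorem mem_leftStab_adjoinLeft {x y z : R} {N : Submodule k R} (s : k)
    (h : y * x = s • (x * y) + z) (hy : y ∈ leftStab N) (hz : z ∈ leftStab N) :
    y ∈ leftStab (adjoinLeft x N) := by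
  refine adjoinLeft_le (P := (adjoinLeft x N).comap (LinearMap.mulLeft k y)).2 fun i n hn => ?_
  simp only [Submodule.mem_comap, LinearMap.mulLeft_apply]
  fin_cases i
  · simpa using mem_adjoinLeft (hy n hn)
  · have : y * (x * n) = s • (x * (y * n)) + z * n := by
      rw [← mul_assoc, h, add_mul, smul_mul_assoc, mul_assoc]
    simpa [this] using Submodule.add_mem _
      (Submodule.smul_mem _ s (mul_mem_adjoinLeft (hy n hn))) (mem_adjoinLeft (hz n hn))

theorem mem_leftStab_adjoinLeft_of_commute {x y : R} {N : Submodule k R}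
    (h : y * x = x * y) (hy : y ∈ leftStab N) : y ∈ leftStab (adjoinLeft x N) :=
  mem_leftStab_adjoinLeft 1 (z := 0) (by simp [h]) hy (zero_mem _)

theorem mem_leftStab_adjoinLeft_of_anticommute {x y : R} {N : Submodule k R}
    (h : y * x = -(x * y)) (hy : y ∈ leftStab N) : y ∈ leftStab (adjoinLeft x N) :=
  mem_leftStab_adjoinLeft (-1) (z := 0) (by simp [h]) hy (zero_mem _)

theorem mem_leftStab_adjoinLeft_of_add {x y z : R} {N : Submodule k R}
    (h : x * y + y * x = z) (hy : y ∈ leftStab N) (hz : z ∈ leftStab N) :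
    y ∈ leftStab (adjoinLeft x N) :=
  mem_leftStab_adjoinLeft (-1) (z := z) (by rw [← h]; simp) hy hz

end Span

section Spanning

variable {k lam mu alp nu}

/-- The image of a generator in `U_15(λ,μ,α,ν)`. -/
noncomputable abbrev gen (x : Gen) : U k lam mu alp nu := mk k lam mu alp nu (g k x)

theorem mk_eq_of_rel {x y : FreeAlgebra k Gen} (h : Rel k lam mu alp nu x y) :
    mk k lam mu alp nu x = mk k lam mu alp nu y :=
  RingQuot.mkAlgHom_rel k h

variable (k lam mu alp nu) in
/-- The span of the monomials that do not involve `d`. -/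
noncomputable def dFreeSpan : Submodule k (U k lam mu alp nu) :=
  adjoinLeft (gen p1) <| adjoinLeft (gen p2) <| adjoinLeft (gen q1) <| adjoinLeft (gen q2) <|
    adjoinLeft (gen a) <| adjoinLeft (gen b) <| adjoinLeft (gen c) <| Submodule.span k {1}

theorem one_mem_dFreeSpan : (1 : U k lam mu alp nu) ∈ dFreeSpan k lam mu alp nu := by
  unfold dFreeSpan
  iterate 7 apply mem_adjoinLeft
  exact Submodule.mem_span_singleton_self 1

theorem gen_mem_leftStab_dFreeSpan {x : Gen} (hx : x ≠ d) :
    gen x ∈ leftStab (dFreeSpan k lam mu alp nu) := by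
  have sqOne {x : Gen} (h : Rel k lam mu alp nu (g k x * g k x) 1) (N : Submodule k _) :
      gen x ∈ leftStab (adjoinLeft (gen x : U k lam mu alp nu) N) :=
    mem_leftStab_adjoinLeft_self (1 : k) (by simpa using mk_eq_of_rel h)
  have sqZero {x : Gen} (h : Rel k lam mu alp nu (g k x * g k x) 0) (N : Submodule k _) :
      gen x ∈ leftStab (adjoinLeft (gen x : U k lam mu alp nu) N) :=
    mem_leftStab_adjoinLeft_self (0 : k) (by simpa using mk_eq_of_rel h)
  have comm {x y : Gen} (h : Rel k lam mu alp nu (g k y * g k x) (g k x * g k y))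
      {N : Submodule k _} (hy : gen y ∈ leftStab N) :
      gen y ∈ leftStab (adjoinLeft (gen x : U k lam mu alp nu) N) :=
    mem_leftStab_adjoinLeft_of_commute (by simpa using mk_eq_of_rel h) hy
  have comm' {x y : Gen} (h : Rel k lam mu alp nu (g k x * g k y) (g k y * g k x))
      {N : Submodule k _} (hy : gen y ∈ leftStab N) :
      gen y ∈ leftStab (adjoinLeft (gen x : U k lam mu alp nu) N) :=
    mem_leftStab_adjoinLeft_of_commute (by simpa using (mk_eq_of_rel h).symm) hy
  have anti {x y : Gen} (h : Rel k lam mu alp nu (g k y * g k x) (-(g k x * g k y)))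
      {N : Submodule k _} (hy : gen y ∈ leftStab N) :
      gen y ∈ leftStab (adjoinLeft (gen x : U k lam mu alp nu) N) :=
    mem_leftStab_adjoinLeft_of_anticommute (by simpa using mk_eq_of_rel h) hy
  have add {x y : Gen} {z}
      (h : Rel k lam mu alp nu (g k x * g k y + g k y * g k x) z)
      {N : Submodule k _} (hy : gen y ∈ leftStab N) (hz : mk k lam mu alp nu z ∈ leftStab N) :
      gen y ∈ leftStab (adjoinLeft (gen x : U k lam mu alp nu) N) :=
    mem_leftStab_adjoinLeft_of_add (by simpa using mk_eq_of_rel h) hy hz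
  have one_sub {N : Submodule k _} (r : k) {z} (hz : mk k lam mu alp nu z ∈ leftStab N) :
      mk k lam mu alp nu (r • (1 - z)) ∈ leftStab N := by
    rw [map_smul, map_sub, map_one]
    exact Subalgebra.smul_mem _ (sub_mem (one_mem _) hz) r
  have mul {N : Submodule k _} {y z} (hy : mk k lam mu alp nu y ∈ leftStab N)
      (hz : mk k lam mu alp nu z ∈ leftStab N) : mk k lam mu alp nu (y * z) ∈ leftStab N := by
    rw [map_mul]
    exact mul_mem hy hz
  have c₁ := sqOne .hcc (Submodule.span k {1})
  have b₂ := sqOne .hbb (adjoinLeft (gen c) (Submodule.span k {1}))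
  have c₂ := comm' .hbc c₁
  have a₃ := sqOne .haa (adjoinLeft (gen b) (adjoinLeft (gen c) (Submodule.span k {1})))
  have b₃ := comm' .hab b₂
  have c₃ := comm' .hac c₂
  have s₄ := sqZero .q2q2 (adjoinLeft (gen a) (adjoinLeft (gen b) (adjoinLeft (gen c)
    (Submodule.span k {1}))))
  have a₄ := comm .aq2 a₃
  have b₄ := anti .bq2 b₃
  have c₄ := anti .cq2 c₃
  have r₅ := sqZero .q1q1 (adjoinLeft (gen q2) (adjoinLeft (gen a) (adjoinLeft (gen b)
    (adjoinLeft (gen c) (Submodule.span k {1})))))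
  have s₅ := add .q1q2 s₄ (one_sub _ (mul b₄ c₄))
  have a₅ := comm .aq1 a₄
  have b₅ := anti .bq1 b₄
  have c₅ := anti .cq1 c₄
  have t₆ := sqZero .p2p2 (adjoinLeft (gen q1) (adjoinLeft (gen q2) (adjoinLeft (gen a)
    (adjoinLeft (gen b) (adjoinLeft (gen c) (Submodule.span k {1}))))))
  have r₆ := add .p2q1 r₅ (one_sub _ (mul (mul a₅ b₅) c₅))
  have s₆ := add .p2q2 s₅ (one_sub _ a₅)
  have a₆ := comm .ap2 a₅
  have b₆ := anti .bp2 b₅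
  have c₆ := anti .cp2 c₅
  cases x with
  | a => exact comm .ap1 a₆
  | b => exact anti .bp1 b₆
  | c => exact anti .cp1 c₆
  | d => exact absurd rfl hx
  | p1 => exact sqZero .p1p1 _
  | p2 => exact add .p1p2 t₆ (one_sub _ (mul b₆ c₆))
  | q1 => exact add .p1q1 r₆ (one_sub _ a₆)
  | q2 => exact add .p1q2 s₆ (one_sub _ (mul (mul a₆ b₆) c₆))

variable (k lam mu alp nu) in
/-- The subalgebra generated by all generators except `d`. -/
noncomputable def dFreeSubalgebra : Subalgebra k (U k lam mu alp nu) :=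
  Algebra.adjoin k (gen '' {d}ᶜ)

theorem gen_mem_dFreeSubalgebra {x : Gen} (hx : x ≠ d) :
    gen x ∈ dFreeSubalgebra k lam mu alp nu :=
  Algebra.subset_adjoin ⟨x, hx, rfl⟩

theorem dFreeSubalgebra_le_dFreeSpan {u : U k lam mu alp nu}
    (hu : u ∈ dFreeSubalgebra k lam mu alp nu) : u ∈ dFreeSpan k lam mu alp nu := by
  have h : dFreeSubalgebra k lam mu alp nu ≤ leftStab (dFreeSpan k lam mu alp nu) := by
    refine Algebra.adjoin_le ?_
    rintro _ ⟨x, hx, rfl⟩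
    exact gen_mem_leftStab_dFreeSpan hx
  simpa using h hu 1 one_mem_dFreeSpan

theorem exists_gen_d_mul_eq {u : U k lam mu alp nu} (hu : u ∈ dFreeSubalgebra k lam mu alp nu) :
    ∃ v ∈ dFreeSubalgebra k lam mu alp nu, gen d * u = v * gen d := by
  induction hu using Algebra.adjoin_induction with
  | mem u hu =>
    have key {x y : Gen} (hy : y ≠ d)
        (h : Rel k lam mu alp nu (g k d * g k x) (g k y * g k d)) :
        ∃ v ∈ dFreeSubalgebra k lam mu alp nu, gen d * gen x = v * gen d :=
      ⟨gen y, gen_mem_dFreeSubalgebra hy, by simpa using mk_eq_of_rel h⟩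
    obtain ⟨x, hx, rfl⟩ := hu
    cases x with
    | a => exact key (by simp) .hda
    | b => exact key (by simp) .hdb
    | c => exact key (by simp) .hdc
    | d => exact absurd rfl hx
    | p1 => exact key (by simp) .dp1
    | p2 => exact key (by simp) .dp2
    | q1 => exact key (by simp) .dq1
    | q2 => exact key (by simp) .dq2
  | algebraMap r => exact ⟨_, algebraMap_mem _ r, (Algebra.commutes r _).symm⟩
  | add u v _ _ hu hv =>
    obtain ⟨u', hu', hu⟩ := hu
    obtain ⟨v', hv', hv⟩ := hv
    exact ⟨u' + v', add_mem hu' hv', by rw [mul_add, hu, hv, add_mul]⟩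
  | mul u v _ _ hu hv =>
    obtain ⟨u', hu', hu⟩ := hu
    obtain ⟨v', hv', hv⟩ := hv
    exact ⟨u' * v', mul_mem hu' hv', by rw [← mul_assoc, hu, mul_assoc, hv, mul_assoc]⟩

theorem adjoin_range_gen : Algebra.adjoin k (Set.range (gen (k := k) (lam := lam) (mu := mu)
    (alp := alp) (nu := nu))) = ⊤ := by
  have h := congrArg (Subalgebra.map (mk k lam mu alp nu)) (FreeAlgebra.adjoin_range_ι k Gen)
  rw [AlgHom.map_adjoin, ← Set.range_comp, Algebra.map_top,
    (AlgHom.range_eq_top _).2 (RingQuot.mkAlgHom_surjective k _)] at h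
  exact h

theorem exists_eq_add_mul_gen_d (u : U k lam mu alp nu) :
    ∃ v ∈ dFreeSubalgebra k lam mu alp nu, ∃ w ∈ dFreeSubalgebra k lam mu alp nu,
      u = v + w * gen d := by
  let S := Subalgebra.toSubmodule (dFreeSubalgebra k lam mu alp nu)
  let F := S ⊔ S.map (LinearMap.mulRight k (gen d))
  have mem_F {u} : u ∈ F ↔ ∃ v ∈ dFreeSubalgebra k lam mu alp nu,
      ∃ w ∈ dFreeSubalgebra k lam mu alp nu, u = v + w * gen d := by
    simp [F, S, Submodule.mem_sup, eq_comm]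
  have hF : (⊤ : Subalgebra k (U k lam mu alp nu)) ≤ leftStab F := by
    rw [← adjoin_range_gen]
    refine Algebra.adjoin_le ?_
    rintro _ ⟨x, rfl⟩ n hn
    obtain ⟨v, hv, w, hw, rfl⟩ := mem_F.1 hn
    refine mem_F.2 ?_
    by_cases hx : x = d
    · subst hx
      obtain ⟨v', hv', hv⟩ := exists_gen_d_mul_eq hv
      obtain ⟨w', hw', hw⟩ := exists_gen_d_mul_eq hw
      have hdd : (gen d * gen d : U k lam mu alp nu) = gen a := by
        simpa using mk_eq_of_rel (Rel.hdd (k := k) (lam := lam) (mu := mu) (alp := alp) (nu := nu))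
      refine ⟨w' * gen a, mul_mem hw' (gen_mem_dFreeSubalgebra (by simp)), v', hv', ?_⟩
      rw [mul_add, hv, ← mul_assoc, hw, mul_assoc, hdd, add_comm]
    · have hx := gen_mem_dFreeSubalgebra (lam := lam) (mu := mu) (alp := alp) (nu := nu) hx
      exact ⟨_, mul_mem hx hv, _, mul_mem hx hw, by rw [mul_add, mul_assoc]⟩
  have h := hF (Algebra.mem_top (x := u)) 1 (mem_F.2 ⟨1, one_mem _, 0, zero_mem _, by simp⟩)
  rwa [mul_one, mem_F] at h

theorem span_range_mono : Submodule.span k (Set.range (mono k lam mu alp nu)) = ⊤ := by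
  have key (h : Fin 2) : dFreeSpan k lam mu alp nu ≤
      (Submodule.span k (Set.range (mono k lam mu alp nu))).comap
        (LinearMap.mulRight k (gen d ^ h.val)) := by
    simp only [dFreeSpan, adjoinLeft, iSup_le_iff, Submodule.map_le_iff_le_comap,
      Submodule.span_singleton_le_iff_mem, Submodule.mem_comap, LinearMap.mulLeft_apply,
      LinearMap.mulRight_apply, mul_one]
    intro i₁ i₂ i₃ i₄ i₅ i₆ i₇
    refine Submodule.subset_span
      ⟨fun x => Gen.rec (motive := fun _ => Fin 2) i₅ i₆ i₇ h i₁ i₂ i₃ i₄ x, ?_⟩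
    simp [mono, mul_assoc]
  refine eq_top_iff.2 fun u _ => ?_
  obtain ⟨v, hv, w, hw, rfl⟩ := exists_eq_add_mul_gen_d u
  refine add_mem ?_ ?_
  · simpa using key 0 (dFreeSubalgebra_le_dFreeSpan hv)
  · simpa using key 1 (dFreeSubalgebra_le_dFreeSpan hw)

end Spanning

section Representation

variable {k}

/-- A cyclic module with commuting involutions `a, b, c` and square-zero operators `y i` which
commute with `a`, anticommute with `b` and `c`, and whose anticommutators are the combinations of
`1 - bc`, `1 - a` and `1 - abc` with coefficients `r`, `s` and `t`. -/
structure CliffordModule {n : ℕ} (r s t : Fin n → Fin n → k) (M : Type*) [AddCommGroup M]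
    [Module k M] where
  (a b c : Module.End k M)
  y : Fin n → Module.End k M
  v : M
  a_a m : a (a m) = m
  b_b m : b (b m) = m
  c_c m : c (c m) = m
  a_b m : a (b m) = b (a m)
  a_c m : a (c m) = c (a m)
  b_c m : b (c m) = c (b m)
  a_y i m : a (y i m) = y i (a m)
  b_y i m : b (y i m) = -y i (b m)
  c_y i m : c (y i m) = -y i (c m)
  y_y i m : y i (y i m) = 0
  y_add i j (hij : i < j) m : y i (y j m) + y j (y i m) =
    r i j • (m - b (c m)) + s i j • (m - a m) + t i j • (m - a (b (c m)))
  cyclic (W : Submodule k M) : v ∈ W → (∀ m ∈ W, a m ∈ W) → (∀ m ∈ W, b m ∈ W) →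
    (∀ m ∈ W, c m ∈ W) → (∀ i, ∀ m ∈ W, y i m ∈ W) → W = ⊤

namespace CliffordModule

/-- The regular representation of the group generated by `a, b, c`. -/
noncomputable def regular (r s t : Fin 0 → Fin 0 → k) :
    CliffordModule r s t (Bool × Bool × Bool → k) where
  a := LinearMap.funLeft k k fun x => (!x.1, x.2.1, x.2.2)
  b := LinearMap.funLeft k k fun x => (x.1, !x.2.1, x.2.2)
  c := LinearMap.funLeft k k fun x => (x.1, x.2.1, !x.2.2)
  y := Fin.elim0
  v := Pi.single (false, false, false) 1
  a_a m := by ext; simp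
  b_b m := by ext; simp
  c_c m := by ext; simp
  a_b m := by ext; simp
  a_c m := by ext; simp
  b_c m := by ext; simp
  a_y := Fin.rec0
  b_y := Fin.rec0
  c_y := Fin.rec0
  y_y := Fin.rec0
  y_add := Fin.rec0
  cyclic W hv ha hb hc _ := by
    have key (f : Bool × Bool × Bool → Bool × Bool × Bool) (hf : ∀ x, f (f x) = x)
        (h : ∀ m ∈ W, LinearMap.funLeft k k f m ∈ W) (x) (hx : Pi.single x (1 : k) ∈ W) :
        Pi.single (f x) (1 : k) ∈ W := by
      convert h _ hx using 1
      ext z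
      simp only [LinearMap.funLeft_apply, Pi.single_apply]
      congr 1
      exact propext ⟨fun h => by rw [h, hf], fun h => by rw [← h, hf]⟩
    have key_a := key _ (by simp) ha
    have key_b := key _ (by simp) hb
    have key_c := key _ (by simp) hc
    have single_mem : ∀ x, Pi.single x (1 : k) ∈ W := by
      have h₁ : ∀ i, Pi.single (i, false, false) (1 : k) ∈ W
        | false => hv
        | true => key_a _ hv
      have h₂ : ∀ i j, Pi.single (i, j, false) (1 : k) ∈ W
        | i, false => h₁ i
        | i, true => key_b _ (h₁ i)
      rintro ⟨i, j, _ | _⟩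
      · exact h₂ i j
      · exact key_c _ (h₂ i j)
    rw [eq_top_iff, ← (Pi.basisFun k (Bool × Bool × Bool)).span_eq, Submodule.span_le]
    rintro _ ⟨x, rfl⟩
    simpa using single_mem x

variable {n : ℕ} {r s t : Fin (n + 1) → Fin (n + 1) → k} {M : Type*} [AddCommGroup M] [Module k M]

/-- Adjoin one more square-zero operator: on `M × M`, thought of as `M ⊕ x M`. -/
noncomputable def double (D : CliffordModule (fun i j => r i.succ j.succ)
    (fun i j => s i.succ j.succ) (fun i j => t i.succ j.succ) M) :
    CliffordModule r s t (M × M) where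
  a := D.a.prodMap D.a
  b := D.b.prodMap (-D.b)
  c := D.c.prodMap (-D.c)
  y := Fin.cons (LinearMap.inr k M M ∘ₗ LinearMap.fst k M M) fun i =>
    (D.y i).prodMap (-D.y i) + LinearMap.inl k M M ∘ₗ
      (r 0 i.succ • (1 - D.b * D.c) + s 0 i.succ • (1 - D.a) + t 0 i.succ • (1 - D.a * D.b * D.c))
      ∘ₗ LinearMap.snd k M M
  v := (D.v, 0)
  a_a m := by simp [D.a_a]
  b_b m := by simp [D.b_b]
  c_c m := by simp [D.c_c]
  a_b m := by simp [D.a_b]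
  a_c m := by simp [D.a_c]
  b_c m := by simp [D.b_c]
  a_y i m := by
    cases i using Fin.cases
    · simp
    · simp [D.a_y, D.a_b, D.a_c, D.a_a]
  b_y i m := by
    cases i using Fin.cases
    · simp
    · simp [D.b_y, D.a_b, D.a_c, D.b_c, D.b_b]
      module
  c_y i m := by
    cases i using Fin.cases
    · simp
    · simp [D.c_y, D.a_b, D.a_c, D.b_c, D.c_c]
      module
  y_y i m := by
    cases i using Fin.cases
    · simp
    · simp [D.y_y, D.a_y, D.b_y, D.c_y]
      module
  y_add i j hij m := by
    cases i using Fin.cases with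
    | zero =>
      cases j using Fin.cases with
      | zero => exact absurd hij (lt_irrefl _)
      | succ j =>
        refine Prod.ext ?_ ?_ <;> simp
    | succ i =>
      cases j using Fin.cases with
      | zero => exact absurd hij (by simp)
      | succ j =>
        have := D.y_add i j (Fin.succ_lt_succ_iff.1 hij)
        refine Prod.ext ?_ ?_
        · have h := this m.1
          simp [D.a_y, D.b_y, D.c_y]
          rw [← h]
          module
        · simpa using this m.2
  cyclic W hv ha hb hc hy := by
    have hx : ∀ m, (m, 0) ∈ W → (0, m) ∈ W := fun m hm => by simpa using hy 0 _ hm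
    have h : W.comap (LinearMap.inl k M M) = ⊤ := by
      refine D.cyclic _ hv (fun m hm => ?_) (fun m hm => ?_) (fun m hm => ?_) fun i m hm => ?_
      · simpa using ha _ hm
      · simpa using hb _ hm
      · simpa using hc _ hm
      · simpa using hy i.succ _ hm
    have hl (m : M) : (m, 0) ∈ W := Submodule.eq_top_iff'.1 h m
    refine Submodule.eq_top_iff'.2 fun m => ?_
    simpa using W.add_mem (hl m.1) (hx _ (hl m.2))

end CliffordModule

theorem exists_cliffordModule {k : Type u} [Field k] (n : ℕ) (r s t : Fin n → Fin n → k) :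
    ∃ (M : Type u) (_ : AddCommGroup M) (_ : Module k M),
      Module.Finite k M ∧ Module.finrank k M = 8 * 2 ^ n ∧ Nonempty (CliffordModule r s t M) := by
  induction n with
  | zero => exact ⟨_, _, _, inferInstance, by simp, ⟨.regular r s t⟩⟩
  | succ n ih =>
    obtain ⟨M, _, _, _, hM, ⟨D⟩⟩ := ih (fun i j => r i.succ j.succ)
      (fun i j => s i.succ j.succ) (fun i j => t i.succ j.succ)
    exact ⟨M × M, _, _, inferInstance, by rw [Module.finrank_prod, hM]; ring, ⟨D.double⟩⟩

/-- The operators by which the generators of `U_15(λ,μ,α,ν)` act on the module induced from a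
module over the subalgebra generated by all generators except `d`. -/
def inducedAction {r s t : Fin 4 → Fin 4 → k} {M : Type*} [AddCommGroup M] [Module k M]
    (D : CliffordModule r s t M) : Gen → Module.End k (M × M)
  | a => D.a.prodMap D.a
  | b => D.b.prodMap D.c
  | c => D.c.prodMap D.b
  | d => (D.a ∘ₗ LinearMap.snd k M M).prod (LinearMap.fst k M M)
  | p1 => (D.y 0).prodMap (D.y 1)
  | p2 => (D.y 1).prodMap (D.y 0)
  | q1 => (D.y 2).prodMap (D.y 3)
  | q2 => (D.y 3).prodMap (D.y 2)

theorem inducedAction_rel {lam mu alp nu : k} {M : Type*} [AddCommGroup M] [Module k M]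
    (D : CliffordModule !![0, lam, 0, 0; 0, 0, 0, 0; 0, 0, 0, mu; 0, 0, 0, 0]
      !![0, 0, nu, 0; 0, 0, 0, nu; 0, 0, 0, 0; 0, 0, 0, 0]
      !![0, 0, 0, alp; 0, 0, alp, 0; 0, 0, 0, 0; 0, 0, 0, 0] M) ⦃x y : FreeAlgebra k Gen⦄
    (h : Rel k lam mu alp nu x y) :
    FreeAlgebra.lift k (inducedAction D) x = FreeAlgebra.lift k (inducedAction D) y := by
  have h01 := D.y_add 0 1 (by decide)
  have h02 := D.y_add 0 2 (by decide)
  have h03 := D.y_add 0 3 (by decide)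
  have h12 := D.y_add 1 2 (by decide)
  have h13 := D.y_add 1 3 (by decide)
  have h23 := D.y_add 2 3 (by decide)
  simp only [Matrix.of_apply, Matrix.cons_val, zero_smul, add_zero, zero_add]
    at h01 h02 h03 h12 h13 h23
  have h10 m := (add_comm _ _).trans (h01 m)
  have h32 m := (add_comm _ _).trans (h23 m)
  refine LinearMap.ext fun m => ?_
  cases h <;> refine Prod.ext ?_ ?_ <;>
    simp [inducedAction, D.a_a, D.b_b, D.c_c, D.a_b, D.a_c, D.b_c, D.a_y, D.b_y, D.c_y,
      D.y_y, h01, h02, h03, h12, h13, h23, h10, h32]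

theorem le_finrank [FiniteDimensional k (U k lam mu alp nu)] :
    256 ≤ Module.finrank k (U k lam mu alp nu) := by
  obtain ⟨M, _, _, _, hM, ⟨D⟩⟩ := exists_cliffordModule 4
    !![0, lam, 0, 0; 0, 0, 0, 0; 0, 0, 0, mu; 0, 0, 0, 0]
    !![0, 0, nu, 0; 0, 0, 0, nu; 0, 0, 0, 0; 0, 0, 0, 0]
    !![0, 0, 0, alp; 0, 0, alp, 0; 0, 0, 0, 0; 0, 0, 0, 0]
  let ρ : U k lam mu alp nu →ₐ[k] Module.End k (M × M) :=
    RingQuot.liftAlgHom k ⟨_, inducedAction_rel D⟩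
  have hρ (x : Gen) : ρ (gen x) = inducedAction D x := by
    simp [ρ, RingQuot.liftAlgHom_mkAlgHom_apply]
  let φ : U k lam mu alp nu →ₗ[k] M × M := LinearMap.applyₗ (D.v, 0) ∘ₗ ρ.toLinearMap
  have stable (x : Gen) {m : M × M} (hm : m ∈ φ.range) : inducedAction D x m ∈ φ.range := by
    obtain ⟨u, rfl⟩ := hm
    exact ⟨gen x * u, by simp [φ, hρ]⟩
  have hl (m : M) : (m, 0) ∈ φ.range := by
    have h : φ.range.comap (LinearMap.inl k M M) = ⊤ := by
      refine D.cyclic _ ⟨1, by simp [φ]⟩ (fun m hm => ?_) (fun m hm => ?_) (fun m hm => ?_)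
        fun i m hm => ?_
      · simpa [inducedAction] using stable a hm
      · simpa [inducedAction] using stable b hm
      · simpa [inducedAction] using stable c hm
      · fin_cases i
        · simpa [inducedAction] using stable p1 hm
        · simpa [inducedAction] using stable p2 hm
        · simpa [inducedAction] using stable q1 hm
        · simpa [inducedAction] using stable q2 hm
    exact Submodule.eq_top_iff'.1 h m
  have hφ : Function.Surjective φ := fun m => by
    have hr : (0, m.2) ∈ φ.range := by simpa [inducedAction] using stable d (hl m.2)
    simpa using add_mem (hl m.1) hr
  have := LinearMap.finrank_le_finrank_of_surjective hφ
  rwa [Module.finrank_prod, hM] at this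

end Representation

/-- An enumeration of the generators. -/
def genEquiv : Gen ≃ Fin 8 where
  toFun
    | a => 0
    | b => 1
    | c => 2
    | d => 3
    | p1 => 4
    | p2 => 5
    | q1 => 6
    | q2 => 7
  invFun := ![a, b, c, d, p1, p2, q1, q2]
  left_inv x := by cases x <;> rfl
  right_inv x := by fin_cases x <;> rfl

instance : Fintype Gen := .ofEquiv _ genEquiv.symm

instance : DecidableEq Gen := genEquiv.decidableEq

theorem card_exponents : Fintype.card (Gen → Fin 2) = 256 := by
  rw [Fintype.card_fun, Fintype.card_congr genEquiv]
  rfl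

theorem thm [IsAlgClosed k] [CharZero k] (lam mu alp nu : k) :
    Module.finrank k (U k lam mu alp nu) = 256 ∧
    LinearIndependent k (mono k lam mu alp nu) ∧
    Submodule.span k (Set.range (mono k lam mu alp nu)) = ⊤ := by
  have hspan := span_range_mono (k := k) (lam := lam) (mu := mu) (alp := alp) (nu := nu)
  have : FiniteDimensional k (U k lam mu alp nu) :=
    Module.finite_def.2 (hspan ▸ Submodule.fg_span (Set.finite_range _))
  have hle : Module.finrank k (U k lam mu alp nu) ≤ 256 := by
    rw [← card_exponents, ← finrank_top, ← hspan]
    exact finrank_range_le_card _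
  have hrank := hle.antisymm (le_finrank lam mu alp nu)
  exact ⟨hrank, linearIndependent_of_top_le_span_of_card_eq_finrank hspan.ge
    (card_exponents.trans hrank.symm), hspan⟩

end Stmt7
end

section
/- For every λ ∈ k, the algebra U_16(λ) is 256-dimensional over k; the images of the monomials p1^i p2^j q1^k q2^l a^e b^f c^g d^h with i, j, k, l, e, f, g, h ∈ {0,1} form a k-basis. -/
namespace Stmt8

/-- The generators `a, b, c, d, p1, p2, q1, q2`. -/
inductive Gen | a | b | c | d | p1 | p2 | q1 | q2

open Gen

variable (k : Type*) [Field k]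

/-- The generators viewed inside the free algebra. -/
abbrev g (x : Gen) : FreeAlgebra k Gen := FreeAlgebra.ι k x

variable (lam : k)

/-- The defining relations of `U_16(λ)`: the `H`-relations together with the listed
relations involving `p1, p2, q1, q2`. -/
inductive Rel : FreeAlgebra k Gen → FreeAlgebra k Gen → Prop
  -- H-relations
  | haa : Rel (g k a * g k a) 1
  | hbb : Rel (g k b * g k b) 1
  | hcc : Rel (g k c * g k c) 1
  | hab : Rel (g k a * g k b) (g k b * g k a)
  | hac : Rel (g k a * g k c) (g k c * g k a)
  | hbc : Rel (g k b * g k c) (g k c * g k b)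
  | hdd : Rel (g k d * g k d) (g k a)
  | hda : Rel (g k d * g k a) (g k a * g k d)
  | hdb : Rel (g k d * g k b) (g k c * g k d)
  | hdc : Rel (g k d * g k c) (g k b * g k d)
  | ap1 : Rel (g k a * g k p1) (g k p1 * g k a)
  | bp1 : Rel (g k b * g k p1) (-(g k p1 * g k b))
  | cp1 : Rel (g k c * g k p1) (-(g k p1 * g k c))
  | dp1 : Rel (g k d * g k p1) (g k p2 * g k d)
  | ap2 : Rel (g k a * g k p2) (g k p2 * g k a)
  | bp2 : Rel (g k b * g k p2) (-(g k p2 * g k b))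
  | cp2 : Rel (g k c * g k p2) (-(g k p2 * g k c))
  | dp2 : Rel (g k d * g k p2) (g k p1 * g k d)
  | p1p1 : Rel (g k p1 * g k p1) (0)
  | p2p2 : Rel (g k p2 * g k p2) (0)
  | p1p2 : Rel (g k p1 * g k p2 + g k p2 * g k p1) (lam • (1 - g k b * g k c))
  | aq1 : Rel (g k a * g k q1) (-(g k q1 * g k a))
  | bq1 : Rel (g k b * g k q1) (g k q1 * g k b)
  | cq1 : Rel (g k c * g k q1) (g k q1 * g k c)
  | dq1 : Rel (g k d * g k q1) (g k q2 * g k d)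
  | aq2 : Rel (g k a * g k q2) (-(g k q2 * g k a))
  | bq2 : Rel (g k b * g k q2) (g k q2 * g k b)
  | cq2 : Rel (g k c * g k q2) (g k q2 * g k c)
  | dq2 : Rel (g k d * g k q2) (-(g k q1 * g k d))
  | q1q1 : Rel (g k q1 * g k q1) (0)
  | q2q2 : Rel (g k q2 * g k q2) (0)
  | q1q2 : Rel (g k q1 * g k q2 + g k q2 * g k q1) (0)
  | p1q1 : Rel (g k p1 * g k q1) (g k q1 * g k p1)
  | p2q2 : Rel (g k p2 * g k q2) (g k q2 * g k p2)
  | p1q2 : Rel (g k p1 * g k q2) (g k q2 * g k p1)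
  | p2q1 : Rel (g k p2 * g k q1) (g k q1 * g k p2)

/-- The algebra `U_16(λ)`. -/
abbrev U := RingQuot (Rel k lam)

/-- The quotient map. -/
noncomputable abbrev mk : FreeAlgebra k Gen →ₐ[k] U k lam :=
  RingQuot.mkAlgHom k (Rel k lam)

/-- The image of the monomial `p1^i p2^j q1^k q2^l a^e b^f c^g d^h` in `U_16(λ)`. -/
noncomputable def mono (e : Gen → Fin 2) : U k lam :=
  mk k lam
    (g k p1 ^ (e p1).val * g k p2 ^ (e p2).val * g k q1 ^ (e q1).val * g k q2 ^ (e q2).val *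
      g k a ^ (e a).val * g k b ^ (e b).val * g k c ^ (e c).val * g k d ^ (e d).val)

section Representation

/-- Coefficient vectors with respect to the monomials `p1^i p2^j q1^r q2^l a^e b^f c^s d^h`. -/
abbrev Coeff := Bool → Bool → Bool → Bool → Bool → Bool → Bool → Bool → k

variable {k}

/-- The sign `(-1)^i`. -/
def sgn (i : Bool) : k := if i then -1 else 1

/-- Left multiplication by a generator, written on coefficient vectors. -/
def actFun (lam : k) : Gen → Coeff k → Coeff k
  | a, F => fun i j r l e f s h => sgn r * sgn l * F i j r l (!e) f s h
  | b, F => fun i j r l e f s h => sgn i * sgn j * F i j r l e (!f) s h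
  | c, F => fun i j r l e f s h => sgn i * sgn j * F i j r l e f (!s) h
  | d, F => fun i j r l e f s h => sgn (r && !l) *
      (sgn (i && j) * F j i l r (e ^^ !h) s f (!h) +
        if i || j then 0 else
          lam * (F true true l r (e ^^ !h) s f (!h) - F true true l r (e ^^ !h) (!s) (!f) (!h)))
  | p1, F => fun i j r l e f s h => if i then F false j r l e f s h else 0
  | p2, F => fun i j r l e f s h =>
      (if j then sgn i * F i false r l e f s h else 0) +
        if i then 0 else lam * (F true j r l e f s h - F true j r l e (!f) (!s) h)
  | q1, F => fun i j r l e f s h => if r then F i j false l e f s h else 0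
  | q2, F => fun i j r l e f s h => if l then sgn r * F i j r false e f s h else 0

/-- `actFun` as a linear map. -/
def act (lam : k) (x : Gen) : Module.End k (Coeff k) where
  toFun := actFun lam x
  map_add' F F' := by
    funext i j r l e f s h
    cases x <;> simp only [actFun, Pi.add_apply] <;> (try split_ifs) <;> ring
  map_smul' t F := by
    funext i j r l e f s h
    cases x <;> simp only [actFun, Pi.smul_apply, smul_eq_mul, RingHom.id_apply] <;>
      (try split_ifs) <;> ring

set_option maxHeartbeats 4000000 in
theorem act_rel (lam : k) {x y : FreeAlgebra k Gen} (hxy : Rel k lam x y) :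
    FreeAlgebra.lift k (act lam) x = FreeAlgebra.lift k (act lam) y := by
  cases hxy <;> refine LinearMap.ext fun F => ?_ <;> funext i j r l e f s h <;>
    simp only [map_mul, map_add, map_neg, map_smul, map_sub, map_one, map_zero,
      FreeAlgebra.lift_ι_apply, Module.End.mul_apply, Module.End.one_apply, LinearMap.add_apply,
      LinearMap.sub_apply, LinearMap.neg_apply, LinearMap.smul_apply, LinearMap.zero_apply,
      Pi.add_apply, Pi.sub_apply, Pi.neg_apply, Pi.smul_apply, Pi.zero_apply, smul_eq_mul,
      act, LinearMap.coe_mk, AddHom.coe_mk, actFun] <;>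
    cases i <;> cases j <;> cases r <;> cases l <;> cases h <;> simp [sgn] <;> try ring

/-- The representation of `U_16(λ)` on coefficient vectors. -/
noncomputable def rep (lam : k) : U k lam →ₐ[k] Module.End k (Coeff k) :=
  RingQuot.liftAlgHom k ⟨FreeAlgebra.lift k (act lam), fun _ _ h => act_rel lam h⟩

end Representation

section Independence

variable {k}

/-- The coefficient vector of a single monomial. -/
def delta (i j r l e f s h : Bool) : Coeff k := fun i' j' r' l' e' f' s' h' =>
  if i' = i ∧ j' = j ∧ r' = r ∧ l' = l ∧ e' = e ∧ f' = f ∧ s' = s ∧ h' = h then 1 else 0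

variable (lam : k)

theorem act_d_delta :
    act lam d (delta false false false false false false false false) =
      delta false false false false false false false true := by
  funext i j r l e f s h
  cases i <;> cases j <;> cases h <;> cases r <;> cases l <;>
    simp [act, actFun, delta, sgn, and_comm]

theorem act_c_delta (h : Bool) :
    act lam c (delta false false false false false false false h) =
      delta false false false false false false true h := by
  funext i' j' r' l' e' f' s' h'
  cases i' <;> cases j' <;> simp [act, actFun, delta, sgn]

theorem act_b_delta (s h : Bool) :
    act lam b (delta false false false false false false s h) =
      delta false false false false false true s h := by
  funext i' j' r' l' e' f' s' h'
  cases i' <;> cases j' <;> simp [act, actFun, delta, sgn]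

theorem act_a_delta (f s h : Bool) :
    act lam a (delta false false false false false f s h) =
      delta false false false false true f s h := by
  funext i' j' r' l' e' f' s' h'
  cases r' <;> cases l' <;> simp [act, actFun, delta, sgn]

theorem act_q2_delta (e f s h : Bool) :
    act lam q2 (delta false false false false e f s h) =
      delta false false false true e f s h := by
  funext i' j' r' l' e' f' s' h'
  cases r' <;> cases l' <;> simp [act, actFun, delta, sgn]

theorem act_q1_delta (l e f s h : Bool) :
    act lam q1 (delta false false false l e f s h) = delta false false true l e f s h := by
  funext i' j' r' l' e' f' s' h'
  cases r' <;> simp [act, actFun, delta]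

theorem act_p2_delta (r l e f s h : Bool) :
    act lam p2 (delta false false r l e f s h) = delta false true r l e f s h := by
  funext i' j' r' l' e' f' s' h'
  cases i' <;> cases j' <;> simp [act, actFun, delta, sgn]

theorem act_p1_delta (j r l e f s h : Bool) :
    act lam p1 (delta false j r l e f s h) = delta true j r l e f s h := by
  funext i' j' r' l' e' f' s' h'
  cases i' <;> simp [act, actFun, delta]

theorem pow_apply_of_apply {M : Type*} [AddCommGroup M] [Module k M] (φ : Module.End k M)
    (v : Bool → M) (h : φ (v false) = v true) (n : Fin 2) :
    (φ ^ n.val) (v false) = v (n == 1) := by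
  fin_cases n <;> simp [h]

theorem rep_mk (x : FreeAlgebra k Gen) :
    rep lam (mk k lam x) = FreeAlgebra.lift k (act lam) x := by
  simp [rep, mk]

theorem rep_mono (m : Gen → Fin 2) :
    rep lam (mono k lam m) (delta false false false false false false false false) =
      delta (m p1 == 1) (m p2 == 1) (m q1 == 1) (m q2 == 1)
        (m a == 1) (m b == 1) (m c == 1) (m d == 1) := by
  rw [mono, rep_mk]
  simp only [map_mul, map_pow, FreeAlgebra.lift_ι_apply, Module.End.mul_apply]
  rw [pow_apply_of_apply _ (fun t => delta false false false false false false false t)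
      (act_d_delta lam),
    pow_apply_of_apply _ (fun t => delta false false false false false false t _)
      (act_c_delta lam _),
    pow_apply_of_apply _ (fun t => delta false false false false false t _ _)
      (act_b_delta lam _ _),
    pow_apply_of_apply _ (fun t => delta false false false false t _ _ _)
      (act_a_delta lam _ _ _),
    pow_apply_of_apply _ (fun t => delta false false false t _ _ _ _)
      (act_q2_delta lam _ _ _ _),
    pow_apply_of_apply _ (fun t => delta false false t _ _ _ _ _)
      (act_q1_delta lam _ _ _ _ _),
    pow_apply_of_apply _ (fun t => delta false t _ _ _ _ _ _)
      (act_p2_delta lam _ _ _ _ _ _),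
    pow_apply_of_apply _ (fun t => delta t _ _ _ _ _ _ _)
      (act_p1_delta lam _ _ _ _ _ _ _)]

/-- The coefficient vector of an element of `U_16(λ)`, indexed by exponent functions. -/
noncomputable def coeff : U k lam →ₗ[k] ((Gen → Fin 2) → k) where
  toFun x m := rep lam x (delta false false false false false false false false)
    (m p1 == 1) (m p2 == 1) (m q1 == 1) (m q2 == 1) (m a == 1) (m b == 1) (m c == 1) (m d == 1)
  map_add' x y := by ext; simp
  map_smul' t x := by ext; simp

theorem linearIndependent_mono : LinearIndependent k (mono k lam) := by
  classical
  refine LinearIndependent.of_comp (coeff lam) ?_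
  convert Pi.linearIndependent_single_one (Gen → Fin 2) k using 1
  funext m m'
  have key (x y : Fin 2) : (x == 1) = (y == 1) ↔ x = y := by decide +revert
  simp only [Function.comp_apply, coeff, LinearMap.coe_mk, AddHom.coe_mk, rep_mono, delta, key,
    Pi.single_apply]
  refine if_congr ⟨fun h => ?_, fun h => by simp [h]⟩ rfl rfl
  funext x
  cases x <;> tauto

end Independence

/-- The image of a generator in `U_16(λ)`. -/
noncomputable def u (x : Gen) : U k lam := mk k lam (g k x)

section Relations

variable {k lam}

theorem mk_eq_of_rel {x y : FreeAlgebra k Gen} (h : Rel k lam x y) : mk k lam x = mk k lam y :=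
  RingQuot.mkAlgHom_rel k h

theorem u_haa : u k lam a * u k lam a = 1 := by
  simpa [u] using mk_eq_of_rel (Rel.haa (k := k) (lam := lam))

theorem u_hbb : u k lam b * u k lam b = 1 := by
  simpa [u] using mk_eq_of_rel (Rel.hbb (k := k) (lam := lam))

theorem u_hcc : u k lam c * u k lam c = 1 := by
  simpa [u] using mk_eq_of_rel (Rel.hcc (k := k) (lam := lam))

theorem u_hab : u k lam a * u k lam b = u k lam b * u k lam a := by
  simpa [u] using mk_eq_of_rel (Rel.hab (k := k) (lam := lam))

theorem u_hac : u k lam a * u k lam c = u k lam c * u k lam a := by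
  simpa [u] using mk_eq_of_rel (Rel.hac (k := k) (lam := lam))

theorem u_hbc : u k lam b * u k lam c = u k lam c * u k lam b := by
  simpa [u] using mk_eq_of_rel (Rel.hbc (k := k) (lam := lam))

theorem u_hdd : u k lam d * u k lam d = u k lam a := by
  simpa [u] using mk_eq_of_rel (Rel.hdd (k := k) (lam := lam))

theorem u_hda : u k lam d * u k lam a = u k lam a * u k lam d := by
  simpa [u] using mk_eq_of_rel (Rel.hda (k := k) (lam := lam))

theorem u_hdb : u k lam d * u k lam b = u k lam c * u k lam d := by
  simpa [u] using mk_eq_of_rel (Rel.hdb (k := k) (lam := lam))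

theorem u_hdc : u k lam d * u k lam c = u k lam b * u k lam d := by
  simpa [u] using mk_eq_of_rel (Rel.hdc (k := k) (lam := lam))

theorem u_ap1 : u k lam a * u k lam p1 = u k lam p1 * u k lam a := by
  simpa [u] using mk_eq_of_rel (Rel.ap1 (k := k) (lam := lam))

theorem u_bp1 : u k lam b * u k lam p1 = -(u k lam p1 * u k lam b) := by
  simpa [u] using mk_eq_of_rel (Rel.bp1 (k := k) (lam := lam))

theorem u_cp1 : u k lam c * u k lam p1 = -(u k lam p1 * u k lam c) := by
  simpa [u] using mk_eq_of_rel (Rel.cp1 (k := k) (lam := lam))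

theorem u_dp1 : u k lam d * u k lam p1 = u k lam p2 * u k lam d := by
  simpa [u] using mk_eq_of_rel (Rel.dp1 (k := k) (lam := lam))

theorem u_ap2 : u k lam a * u k lam p2 = u k lam p2 * u k lam a := by
  simpa [u] using mk_eq_of_rel (Rel.ap2 (k := k) (lam := lam))

theorem u_bp2 : u k lam b * u k lam p2 = -(u k lam p2 * u k lam b) := by
  simpa [u] using mk_eq_of_rel (Rel.bp2 (k := k) (lam := lam))

theorem u_cp2 : u k lam c * u k lam p2 = -(u k lam p2 * u k lam c) := by
  simpa [u] using mk_eq_of_rel (Rel.cp2 (k := k) (lam := lam))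

theorem u_dp2 : u k lam d * u k lam p2 = u k lam p1 * u k lam d := by
  simpa [u] using mk_eq_of_rel (Rel.dp2 (k := k) (lam := lam))

theorem u_p1p1 : u k lam p1 * u k lam p1 = 0 := by
  simpa [u] using mk_eq_of_rel (Rel.p1p1 (k := k) (lam := lam))

theorem u_p2p2 : u k lam p2 * u k lam p2 = 0 := by
  simpa [u] using mk_eq_of_rel (Rel.p2p2 (k := k) (lam := lam))

theorem u_p1p2 : u k lam p1 * u k lam p2 + u k lam p2 * u k lam p1 = lam • (1 - u k lam b * u k lam c) := by
  simpa [u] using mk_eq_of_rel (Rel.p1p2 (k := k) (lam := lam))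

theorem u_aq1 : u k lam a * u k lam q1 = -(u k lam q1 * u k lam a) := by
  simpa [u] using mk_eq_of_rel (Rel.aq1 (k := k) (lam := lam))

theorem u_bq1 : u k lam b * u k lam q1 = u k lam q1 * u k lam b := by
  simpa [u] using mk_eq_of_rel (Rel.bq1 (k := k) (lam := lam))

theorem u_cq1 : u k lam c * u k lam q1 = u k lam q1 * u k lam c := by
  simpa [u] using mk_eq_of_rel (Rel.cq1 (k := k) (lam := lam))

theorem u_dq1 : u k lam d * u k lam q1 = u k lam q2 * u k lam d := by
  simpa [u] using mk_eq_of_rel (Rel.dq1 (k := k) (lam := lam))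

theorem u_aq2 : u k lam a * u k lam q2 = -(u k lam q2 * u k lam a) := by
  simpa [u] using mk_eq_of_rel (Rel.aq2 (k := k) (lam := lam))

theorem u_bq2 : u k lam b * u k lam q2 = u k lam q2 * u k lam b := by
  simpa [u] using mk_eq_of_rel (Rel.bq2 (k := k) (lam := lam))

theorem u_cq2 : u k lam c * u k lam q2 = u k lam q2 * u k lam c := by
  simpa [u] using mk_eq_of_rel (Rel.cq2 (k := k) (lam := lam))

theorem u_dq2 : u k lam d * u k lam q2 = -(u k lam q1 * u k lam d) := by
  simpa [u] using mk_eq_of_rel (Rel.dq2 (k := k) (lam := lam))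

theorem u_q1q1 : u k lam q1 * u k lam q1 = 0 := by
  simpa [u] using mk_eq_of_rel (Rel.q1q1 (k := k) (lam := lam))

theorem u_q2q2 : u k lam q2 * u k lam q2 = 0 := by
  simpa [u] using mk_eq_of_rel (Rel.q2q2 (k := k) (lam := lam))

theorem u_q1q2 : u k lam q1 * u k lam q2 + u k lam q2 * u k lam q1 = 0 := by
  simpa [u] using mk_eq_of_rel (Rel.q1q2 (k := k) (lam := lam))

theorem u_p1q1 : u k lam p1 * u k lam q1 = u k lam q1 * u k lam p1 := by
  simpa [u] using mk_eq_of_rel (Rel.p1q1 (k := k) (lam := lam))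

theorem u_p2q2 : u k lam p2 * u k lam q2 = u k lam q2 * u k lam p2 := by
  simpa [u] using mk_eq_of_rel (Rel.p2q2 (k := k) (lam := lam))

theorem u_p1q2 : u k lam p1 * u k lam q2 = u k lam q2 * u k lam p1 := by
  simpa [u] using mk_eq_of_rel (Rel.p1q2 (k := k) (lam := lam))

theorem u_p2q1 : u k lam p2 * u k lam q1 = u k lam q1 * u k lam p2 := by
  simpa [u] using mk_eq_of_rel (Rel.p2q1 (k := k) (lam := lam))

end Relations

section Spanning

variable {k} {R : Type*} [Ring R] [Algebra k R]

theorem mul_mul_eq_of_mul_eq {x y z : R} (h : x * y = z) (t : R) : x * (y * t) = z * t := by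
  rw [← mul_assoc, h]

/-- The elements whose left multiplication preserves a submodule. -/
def leftStab (N : Submodule k R) : Subalgebra k R where
  carrier := {x | ∀ y ∈ N, x * y ∈ N}
  mul_mem' hx hx' y hy := by rw [mul_assoc]; exact hx _ (hx' y hy)
  add_mem' hx hx' y hy := by rw [add_mul]; exact N.add_mem (hx y hy) (hx' y hy)
  algebraMap_mem' t y hy := by rw [← Algebra.smul_def]; exact N.smul_mem t hy

theorem mem_leftStab_span {ι : Type*} {f : ι → R} {x : R}
    (h : ∀ i, x * f i ∈ Submodule.span k (Set.range f)) :
    x ∈ leftStab (Submodule.span k (Set.range f)) := by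
  intro y hy
  have : Submodule.span k (Set.range f) ≤
      (Submodule.span k (Set.range f)).comap (LinearMap.mulLeft k x) := by
    rw [Submodule.span_le]
    rintro _ ⟨i, rfl⟩
    exact h i
  exact this hy

theorem mem_leftStab_span_mul {ι : Type*} {f : ι → R} {N : Submodule k R} {x : R}
    (h : ∀ i, x * f i ∈ Submodule.span k (Set.range f) * (leftStab N).toSubmodule) :
    x ∈ leftStab (Submodule.span k (Set.range f) * N) := by
  have hN : (leftStab N).toSubmodule * N ≤ N := by
    rw [Submodule.mul_le]
    exact fun m hm n hn => hm n hn
  have hx : Submodule.span k (Set.range f) ≤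
      (Submodule.span k (Set.range f) * (leftStab N).toSubmodule).comap
        (LinearMap.mulLeft k x) := by
    rw [Submodule.span_le]
    rintro _ ⟨i, rfl⟩
    exact h i
  have : Submodule.span k (Set.range f) * N ≤
      (Submodule.span k (Set.range f) * N).comap (LinearMap.mulLeft k x) := by
    rw [Submodule.mul_le]
    intro m hm n hn
    have hxmn := Submodule.mul_mem_mul (Submodule.mem_comap.1 (hx hm)) hn
    rw [LinearMap.mulLeft_apply, mul_assoc, mul_assoc] at hxmn
    exact mul_le_mul' le_rfl hN hxmn
  exact fun y hy => this hy

end Spanning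

section Monomials

/-- `neg_mul` stated for `U k lam`, where `simp` does not unify the instances by itself. -/
@[simp]
theorem U_neg_mul (x y : U k lam) : -x * y = -(x * y) := neg_mul x y

/-- `mul_neg` stated for `U k lam`, where `simp` does not unify the instances by itself. -/
@[simp]
theorem U_mul_neg (x y : U k lam) : x * -y = -(x * y) := mul_neg x y

/-- The monomials in `p1, p2`. -/
noncomputable def monoP (n : Fin 2 × Fin 2) : U k lam :=
  u k lam p1 ^ n.1.val * u k lam p2 ^ n.2.val

/-- The monomials in `q1, q2`. -/
noncomputable def monoQ (n : Fin 2 × Fin 2) : U k lam :=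
  u k lam q1 ^ n.1.val * u k lam q2 ^ n.2.val

/-- The monomials in `a, b, c, d`. -/
noncomputable def monoH (n : (Fin 2 × Fin 2) × Fin 2 × Fin 2) : U k lam :=
  u k lam a ^ n.1.1.val * u k lam b ^ n.1.2.val * u k lam c ^ n.2.1.val * u k lam d ^ n.2.2.val

variable {k lam}

theorem monoP_mul_mem {N : Submodule k (U k lam)} (n : Fin 2 × Fin 2) {y : U k lam}
    (hy : y ∈ N) : monoP k lam n * y ∈ Submodule.span k (Set.range (monoP k lam)) * N :=
  Submodule.mul_mem_mul (Submodule.subset_span ⟨n, rfl⟩) hy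

theorem monoQ_mul_mem {N : Submodule k (U k lam)} (n : Fin 2 × Fin 2) {y : U k lam}
    (hy : y ∈ N) : monoQ k lam n * y ∈ Submodule.span k (Set.range (monoQ k lam)) * N :=
  Submodule.mul_mem_mul (Submodule.subset_span ⟨n, rfl⟩) hy

theorem leftStab_monoH {x : Gen} (hx : x = a ∨ x = b ∨ x = c ∨ x = d) :
    u k lam x ∈ leftStab (Submodule.span k (Set.range (monoH k lam))) := by
  refine mem_leftStab_span fun ⟨⟨e, f⟩, s, h⟩ => Submodule.subset_span ?_
  have hab := mul_mul_eq_of_mul_eq (u_hab (k := k) (lam := lam))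
  have hac := mul_mul_eq_of_mul_eq (u_hac (k := k) (lam := lam))
  have hbc := mul_mul_eq_of_mul_eq (u_hbc (k := k) (lam := lam))
  have hda := mul_mul_eq_of_mul_eq (u_hda (k := k) (lam := lam))
  have hdb := mul_mul_eq_of_mul_eq (u_hdb (k := k) (lam := lam))
  have hdc := mul_mul_eq_of_mul_eq (u_hdc (k := k) (lam := lam))
  have haa := mul_mul_eq_of_mul_eq (u_haa (k := k) (lam := lam))
  have hbb := mul_mul_eq_of_mul_eq (u_hbb (k := k) (lam := lam))
  have hcc := mul_mul_eq_of_mul_eq (u_hcc (k := k) (lam := lam))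
  simp only [mul_assoc, one_mul] at hab hac hbc hda hdb hdc haa hbb hcc
  rcases hx with rfl | rfl | rfl | rfl
  · refine ⟨((e + 1, f), s, h), ?_⟩
    fin_cases e <;> simp [monoH, mul_assoc, haa]
  · refine ⟨((e, f + 1), s, h), ?_⟩
    fin_cases e <;> fin_cases f <;> simp [monoH, mul_assoc, hbb, ← hab]
  · refine ⟨((e, f), s + 1, h), ?_⟩
    fin_cases e <;> fin_cases f <;> fin_cases s <;>
      simp [monoH, mul_assoc, hcc, ← hac, ← hbc]
  · refine ⟨((e + h, s), f, h + 1), ?_⟩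
    fin_cases e <;> fin_cases f <;> fin_cases s <;> fin_cases h <;>
      simp [monoH, mul_assoc, hda, hdb, hdc, u_hda, u_hdb, u_hdc, u_hdd, ← hbc, ← u_hbc, ← hac,
        ← u_hab, ← u_hac, haa, u_haa]

theorem leftStab_monoQ {N : Submodule k (U k lam)}
    (hN : ∀ x, x = a ∨ x = b ∨ x = c ∨ x = d → u k lam x ∈ leftStab N)
    {x : Gen} (hx : x ≠ p1 ∧ x ≠ p2) :
    u k lam x ∈ leftStab (Submodule.span k (Set.range (monoQ k lam)) * N) := by
  refine mem_leftStab_span_mul fun n => ?_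
  have haq1 := mul_mul_eq_of_mul_eq (u_aq1 (k := k) (lam := lam))
  have hbq1 := mul_mul_eq_of_mul_eq (u_bq1 (k := k) (lam := lam))
  have hcq1 := mul_mul_eq_of_mul_eq (u_cq1 (k := k) (lam := lam))
  have hdq1 := mul_mul_eq_of_mul_eq (u_dq1 (k := k) (lam := lam))
  have hq1q1 := mul_mul_eq_of_mul_eq (u_q1q1 (k := k) (lam := lam))
  have hq2q1 : u k lam q2 * u k lam q1 = -(u k lam q1 * u k lam q2) :=
    eq_neg_of_add_eq_zero_right u_q1q2
  have hq2q1' := mul_mul_eq_of_mul_eq hq2q1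
  have key (m : Fin 2 × Fin 2) (y : U k lam) (hy : y ∈ leftStab N)
      (h : u k lam x * monoQ k lam n = monoQ k lam m * y) :
      u k lam x * monoQ k lam n ∈
        Submodule.span k (Set.range (monoQ k lam)) * (leftStab N).toSubmodule :=
    h ▸ monoQ_mul_mem m hy
  have h1 : (1 : U k lam) ∈ leftStab N := one_mem _
  have h0 : (0 : U k lam) ∈ leftStab N := zero_mem _
  obtain ⟨i, j⟩ := n
  cases x
  case a =>
    have ha := hN a (by simp)
    fin_cases i <;> fin_cases j
    · exact key (0, 0) _ ha (by simp [monoQ])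
    · exact key (0, 1) _ (neg_mem ha) (by simp [monoQ, u_aq2])
    · exact key (1, 0) _ (neg_mem ha) (by simp [monoQ, u_aq1])
    · exact key (1, 1) _ ha (by simp [monoQ, mul_assoc, haq1, u_aq2])
  case b =>
    refine key (i, j) _ (hN b (by simp)) ?_
    fin_cases i <;> fin_cases j <;> simp [monoQ, mul_assoc, hbq1, u_bq1, u_bq2]
  case c =>
    refine key (i, j) _ (hN c (by simp)) ?_
    fin_cases i <;> fin_cases j <;> simp [monoQ, mul_assoc, hcq1, u_cq1, u_cq2]
  case d =>
    have hd := hN d (by simp)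
    fin_cases i <;> fin_cases j
    · exact key (0, 0) _ hd (by simp [monoQ])
    · exact key (1, 0) _ (neg_mem hd) (by simp [monoQ, u_dq2])
    · exact key (0, 1) _ hd (by simp [monoQ, u_dq1])
    · exact key (1, 1) _ hd (by simp [monoQ, mul_assoc, hdq1, u_dq2, hq2q1'])
  case q1 =>
    fin_cases i
    · exact key (1, j) _ h1 (by simp [monoQ])
    · exact key (1, j) _ h0 (by simp [monoQ, hq1q1])
  case q2 =>
    fin_cases i <;> fin_cases j
    · exact key (0, 1) _ h1 (by simp [monoQ])
    · exact key (0, 0) _ h0 (by simp [monoQ, u_q2q2])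
    · exact key (1, 1) _ (neg_mem h1) (by simp [monoQ, hq2q1])
    · exact key (0, 0) _ h0 (by simp [monoQ, mul_assoc, hq2q1', u_q2q2])
  all_goals simp at hx

theorem leftStab_monoP {N : Submodule k (U k lam)}
    (hN : ∀ x, x ≠ p1 ∧ x ≠ p2 → u k lam x ∈ leftStab N) (x : Gen) :
    u k lam x ∈ leftStab (Submodule.span k (Set.range (monoP k lam)) * N) := by
  refine mem_leftStab_span_mul fun n => ?_
  have hap1 := mul_mul_eq_of_mul_eq (u_ap1 (k := k) (lam := lam))
  have hbp1 := mul_mul_eq_of_mul_eq (u_bp1 (k := k) (lam := lam))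
  have hcp1 := mul_mul_eq_of_mul_eq (u_cp1 (k := k) (lam := lam))
  have hdp1 := mul_mul_eq_of_mul_eq (u_dp1 (k := k) (lam := lam))
  have hp1p1 := mul_mul_eq_of_mul_eq (u_p1p1 (k := k) (lam := lam))
  have hp1q1 := mul_mul_eq_of_mul_eq (u_p1q1 (k := k) (lam := lam)).symm
  have hp1q2 := mul_mul_eq_of_mul_eq (u_p1q2 (k := k) (lam := lam)).symm
  set z : U k lam := lam • (1 - u k lam b * u k lam c) with hz
  have hp2p1 : u k lam p2 * u k lam p1 = -(u k lam p1 * u k lam p2) + z := by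
    rw [hz, ← u_p1p2 (k := k) (lam := lam)]; abel
  have hp2p1' := mul_mul_eq_of_mul_eq hp2p1
  have hzp2 : z * u k lam p2 = u k lam p2 * z := by
    simp [hz, sub_mul, mul_sub, mul_assoc, u_cp2, mul_mul_eq_of_mul_eq u_bp2]
  have hzN : z ∈ leftStab N :=
    (leftStab N).smul_mem
      (sub_mem (one_mem _) (mul_mem (hN b (by simp)) (hN c (by simp)))) lam
  have key (m : Fin 2 × Fin 2) (y : U k lam) (hy : y ∈ leftStab N)
      (h : u k lam x * monoP k lam n = monoP k lam m * y) :
      u k lam x * monoP k lam n ∈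
        Submodule.span k (Set.range (monoP k lam)) * (leftStab N).toSubmodule :=
    h ▸ monoP_mul_mem m hy
  have key_add (m m' : Fin 2 × Fin 2) (y y' : U k lam) (hy : y ∈ leftStab N)
      (hy' : y' ∈ leftStab N)
      (h : u k lam x * monoP k lam n = monoP k lam m * y + monoP k lam m' * y') :
      u k lam x * monoP k lam n ∈
        Submodule.span k (Set.range (monoP k lam)) * (leftStab N).toSubmodule :=
    h ▸ add_mem (monoP_mul_mem m hy) (monoP_mul_mem m' hy')
  have h1 : (1 : U k lam) ∈ leftStab N := one_mem _
  have h0 : (0 : U k lam) ∈ leftStab N := zero_mem _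
  obtain ⟨i, j⟩ := n
  cases x
  case a =>
    refine key (i, j) _ (hN a (by simp)) ?_
    fin_cases i <;> fin_cases j <;> simp [monoP, mul_assoc, hap1, u_ap1, u_ap2]
  case b =>
    have hb := hN b (by simp)
    fin_cases i <;> fin_cases j
    · exact key (0, 0) _ hb (by simp [monoP])
    · exact key (0, 1) _ (neg_mem hb) (by simp [monoP, u_bp2])
    · exact key (1, 0) _ (neg_mem hb) (by simp [monoP, u_bp1])
    · exact key (1, 1) _ hb (by simp [monoP, mul_assoc, hbp1, u_bp2])
  case c =>
    have hc := hN c (by simp)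
    fin_cases i <;> fin_cases j
    · exact key (0, 0) _ hc (by simp [monoP])
    · exact key (0, 1) _ (neg_mem hc) (by simp [monoP, u_cp2])
    · exact key (1, 0) _ (neg_mem hc) (by simp [monoP, u_cp1])
    · exact key (1, 1) _ hc (by simp [monoP, mul_assoc, hcp1, u_cp2])
  case d =>
    have hd := hN d (by simp)
    fin_cases i <;> fin_cases j
    · exact key (0, 0) _ hd (by simp [monoP])
    · exact key (1, 0) _ hd (by simp [monoP, u_dp2])
    · exact key (0, 1) _ hd (by simp [monoP, u_dp1])
    · exact key_add (1, 1) (0, 0) _ _ (neg_mem hd) (mul_mem hzN hd)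
        (by simp [monoP, mul_assoc, hdp1, u_dp2, hp2p1', add_mul])
  case q1 =>
    refine key (i, j) _ (hN q1 (by simp)) ?_
    fin_cases i <;> fin_cases j <;> simp [monoP, mul_assoc, hp1q1, ← u_p1q1, ← u_p2q1]
  case q2 =>
    refine key (i, j) _ (hN q2 (by simp)) ?_
    fin_cases i <;> fin_cases j <;> simp [monoP, mul_assoc, hp1q2, ← u_p1q2, ← u_p2q2]
  case p1 =>
    fin_cases i
    · exact key (1, j) _ h1 (by simp [monoP])
    · exact key (1, j) _ h0 (by simp [monoP, hp1p1])
  case p2 =>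
    fin_cases i <;> fin_cases j
    · exact key (0, 1) _ h1 (by simp [monoP])
    · exact key (0, 0) _ h0 (by simp [monoP, u_p2p2])
    · exact key_add (1, 1) (0, 0) _ _ (neg_mem h1) hzN (by simp [monoP, hp2p1])
    · exact key (0, 1) _ hzN (by simp [monoP, mul_assoc, hp2p1', add_mul, u_p2p2, hzp2])

theorem leftStab_eq_top {N : Submodule k (U k lam)} (hN : ∀ x, u k lam x ∈ leftStab N) :
    leftStab N = ⊤ := by
  refine eq_top_iff.2 fun x _ => ?_
  obtain ⟨y, rfl⟩ := RingQuot.mkAlgHom_surjective k (Rel k lam) x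
  induction y using FreeAlgebra.induction with
  | grade0 t => rw [AlgHom.commutes]; exact algebraMap_mem _ t
  | grade1 x => exact hN x
  | mul y y' hy hy' => rw [map_mul]; exact mul_mem (hy trivial) (hy' trivial)
  | add y y' hy hy' => rw [map_add]; exact add_mem (hy trivial) (hy' trivial)

theorem span_mono : Submodule.span k (Set.range (mono k lam)) = ⊤ := by
  have hle : Submodule.span k (Set.range (monoP k lam)) *
      (Submodule.span k (Set.range (monoQ k lam)) *
        Submodule.span k (Set.range (monoH k lam))) ≤
      Submodule.span k (Set.range (mono k lam)) := by
    rw [Submodule.span_mul_span, Submodule.span_mul_span]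
    refine Submodule.span_mono ?_
    rintro _ ⟨_, ⟨⟨i, j⟩, rfl⟩, _, ⟨_, ⟨⟨r, l⟩, rfl⟩, _, ⟨⟨⟨e, f⟩, s, h⟩, rfl⟩, rfl⟩, rfl⟩
    refine ⟨fun | a => e | b => f | c => s | d => h | p1 => i | p2 => j | q1 => r | q2 => l, ?_⟩
    simp [mono, monoP, monoQ, monoH, u, mul_assoc]
  refine eq_top_iff.2 (le_trans (fun x _ => ?_) hle)
  have h1 : (1 : U k lam) ∈ Submodule.span k (Set.range (monoP k lam)) *
      (Submodule.span k (Set.range (monoQ k lam)) *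
        Submodule.span k (Set.range (monoH k lam))) := by
    rw [← one_mul (1 : U k lam), ← one_mul (1 : U k lam), mul_assoc]
    exact Submodule.mul_mem_mul (Submodule.subset_span ⟨0, by simp [monoP]⟩)
      (Submodule.mul_mem_mul (Submodule.subset_span ⟨0, by simp [monoQ]⟩)
        (Submodule.subset_span ⟨0, by simp [monoH]⟩))
  have htop := leftStab_eq_top (leftStab_monoP fun x hx =>
    leftStab_monoQ (lam := lam) (fun x hx => leftStab_monoH hx) hx)
  have hx : x ∈ leftStab _ := htop ▸ Algebra.mem_top
  exact mul_one x ▸ hx 1 h1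

end Monomials

/-- The eight generators, enumerated. -/
def genEquiv : Gen ≃ Fin 8 where
  toFun | a => 0 | b => 1 | c => 2 | d => 3 | p1 => 4 | p2 => 5 | q1 => 6 | q2 => 7
  invFun := ![a, b, c, d, p1, p2, q1, q2]
  left_inv x := by cases x <;> rfl
  right_inv n := by fin_cases n <;> rfl

theorem thm [IsAlgClosed k] [CharZero k] (lam : k) :
    Module.finrank k (U k lam) = 256 ∧
    LinearIndependent k (mono k lam) ∧
    Submodule.span k (Set.range (mono k lam)) = ⊤ := by
  refine ⟨?_, linearIndependent_mono lam, span_mono⟩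
  rw [Module.finrank_eq_nat_card_basis (Module.Basis.mk (linearIndependent_mono lam) span_mono.ge),
    Nat.card_congr (genEquiv.arrowCongr (Equiv.refl (Fin 2)))]
  simp

end Stmt8
end

section
/- For every λ ∈ k, the algebra U_20(λ) is 256-dimensional over k; the images of the monomials p1^i p2^j q1^k q2^l a^e b^f c^g d^h with i, j, k, l, e, f, g, h ∈ {0,1} form a k-basis. -/
namespace Stmt9

/-- The generators `a, b, c, d, p1, p2, q1, q2`. -/
inductive Gen | a | b | c | d | p1 | p2 | q1 | q2

open Gen

variable (k : Type*) [Field k]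

/-- The generators viewed inside the free algebra. -/
abbrev g (x : Gen) : FreeAlgebra k Gen := FreeAlgebra.ι k x

variable (lam : k)

/-- The defining relations of `U_20(λ)`: the `H`-relations together with the listed
relations involving `p1, p2, q1, q2`. -/
inductive Rel : FreeAlgebra k Gen → FreeAlgebra k Gen → Prop
  -- H-relations
  | haa : Rel (g k a * g k a) 1
  | hbb : Rel (g k b * g k b) 1
  | hcc : Rel (g k c * g k c) 1
  | hab : Rel (g k a * g k b) (g k b * g k a)
  | hac : Rel (g k a * g k c) (g k c * g k a)
  | hbc : Rel (g k b * g k c) (g k c * g k b)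
  | hdd : Rel (g k d * g k d) (g k a)
  | hda : Rel (g k d * g k a) (g k a * g k d)
  | hdb : Rel (g k d * g k b) (g k c * g k d)
  | hdc : Rel (g k d * g k c) (g k b * g k d)
  | ap1 : Rel (g k a * g k p1) (g k p1 * g k a)
  | bp1 : Rel (g k b * g k p1) (g k p1 * g k b)
  | cp1 : Rel (g k c * g k p1) (-(g k p1 * g k c))
  | dp1 : Rel (g k d * g k p1) (g k p2 * g k a * g k d)
  | ap2 : Rel (g k a * g k p2) (g k p2 * g k a)
  | bp2 : Rel (g k b * g k p2) (-(g k p2 * g k b))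
  | cp2 : Rel (g k c * g k p2) (g k p2 * g k c)
  | dp2 : Rel (g k d * g k p2) (g k p1 * g k a * g k d)
  | aq1 : Rel (g k a * g k q1) (g k q1 * g k a)
  | bq1 : Rel (g k b * g k q1) (-(g k q1 * g k b))
  | cq1 : Rel (g k c * g k q1) (g k q1 * g k c)
  | dq1 : Rel (g k d * g k q1) (g k q2 * g k a * g k d)
  | aq2 : Rel (g k a * g k q2) (g k q2 * g k a)
  | bq2 : Rel (g k b * g k q2) (g k q2 * g k b)
  | cq2 : Rel (g k c * g k q2) (-(g k q2 * g k c))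
  | dq2 : Rel (g k d * g k q2) (g k q1 * g k a * g k d)
  | p1p1 : Rel (g k p1 * g k p1) (0)
  | p2p2 : Rel (g k p2 * g k p2) (0)
  | p1p2 : Rel (g k p1 * g k p2 + g k p2 * g k p1) (0)
  | q1q1 : Rel (g k q1 * g k q1) (0)
  | q2q2 : Rel (g k q2 * g k q2) (0)
  | q1q2 : Rel (g k q1 * g k q2 + g k q2 * g k q1) (0)
  | p1q1 : Rel (g k p1 * g k q1 + g k q1 * g k p1) (0)
  | p2q2 : Rel (g k p2 * g k q2 + g k q2 * g k p2) (0)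
  | p1q2 : Rel (g k p1 * g k q2 + g k q2 * g k p1) (lam • (1 - g k a))
  | p2q1 : Rel (g k p2 * g k q1 + g k q1 * g k p2) (lam • (1 - g k a))

/-- The algebra `U_20(λ)`. -/
abbrev U := RingQuot (Rel k lam)

/-- The quotient map. -/
noncomputable abbrev mk : FreeAlgebra k Gen →ₐ[k] U k lam :=
  RingQuot.mkAlgHom k (Rel k lam)

/-- The image of the monomial `p1^i p2^j q1^k q2^l a^e b^f c^g d^h` in `U_20(λ)`. -/
noncomputable def mono (e : Gen → Fin 2) : U k lam :=
  mk k lam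
    (g k p1 ^ (e p1).val * g k p2 ^ (e p2).val * g k q1 ^ (e q1).val * g k q2 ^ (e q2).val *
      g k a ^ (e a).val * g k b ^ (e b).val * g k c ^ (e c).val * g k d ^ (e d).val)

section Representation

/-- Exponent vectors, in the order `p1, p2, q1, q2, a, b, c, d`. -/
abbrev Exps := Bool × Bool × Bool × Bool × Bool × Bool × Bool × Bool

/-- The model of `U_20(λ)`: the vector space with basis the exponent vectors. -/
abbrev Model := Exps →₀ k

variable {k}

/-- The sign `(-1)^i`. -/
def sgn (i : Bool) : k := if i then -1 else 1

@[simp] theorem sgn_true : (sgn true : k) = -1 := rfl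
@[simp] theorem sgn_false : (sgn false : k) = 1 := rfl

/-- The basis vector of the model attached to an exponent vector. -/
noncomputable def vec (i j l m e f s h : Bool) : Model k :=
  Finsupp.single (i, j, l, m, e, f, s, h) 1

/-- Left multiplication by a generator on the basis of ordered monomials. -/
noncomputable def actBasis (lam : k) : Gen → Exps → Model k
  | a, (i, j, l, m, e, f, s, h) => vec i j l m (!e) f s h
  | b, (i, j, l, m, e, f, s, h) => (sgn j * sgn l : k) • vec i j l m e (!f) s h
  | c, (i, j, l, m, e, f, s, h) => (sgn i * sgn m : k) • vec i j l m e f (!s) h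
  | d, (i, j, l, m, e, f, s, h) =>
      (sgn (i && j) * sgn (l && m) : k) •
        vec j i m l (i ^^ (j ^^ (l ^^ (m ^^ (h ^^ e))))) s f (!h)
  | p1, (i, j, l, m, e, f, s, h) => if i then 0 else vec true j l m e f s h
  | p2, (i, j, l, m, e, f, s, h) => if j then 0 else (sgn i : k) • vec i true l m e f s h
  | q1, (i, j, l, m, e, f, s, h) =>
      (if l then 0 else (sgn i * sgn j : k) • vec i j true m e f s h) +
      (if j then (lam * sgn i) • vec i false l m e f s h +
        (-lam * sgn i) • vec i false l m (!e) f s h else 0)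
  | q2, (i, j, l, m, e, f, s, h) =>
      (if m then 0 else (sgn i * sgn j * sgn l : k) • vec i j l true e f s h) +
      (if i then lam • vec false j l m e f s h + (-lam) • vec false j l m (!e) f s h else 0)

/-- Left multiplication by a generator on the model. -/
noncomputable def act (lam : k) (x : Gen) : Module.End k (Model k) :=
  Finsupp.linearCombination k (actBasis lam x)

@[simp] theorem act_vec (lam : k) (x : Gen) (i j l m e f s h : Bool) :
    act lam x (vec i j l m e f s h) = actBasis lam x (i, j, l, m, e, f, s, h) := by
  simp [act, vec]

theorem model_hom_ext {M : Type*} [AddCommGroup M] [Module k M] {S T : Model k →ₗ[k] M}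
    (H : ∀ i j l m e f s h, S (vec i j l m e f s h) = T (vec i j l m e f s h)) : S = T := by
  refine Finsupp.lhom_ext' fun ⟨i, j, l, m, e, f, s, h⟩ => LinearMap.ext_ring ?_
  exact H i j l m e f s h

set_option maxHeartbeats 4000000 in
theorem lift_act_of_rel (lam : k) ⦃r s : FreeAlgebra k Gen⦄ (H : Rel k lam r s) :
    FreeAlgebra.lift k (act lam) r = FreeAlgebra.lift k (act lam) s := by
  cases H <;> refine model_hom_ext fun i j l m e f s h => ?_ <;>
    cases i <;> cases j <;> cases l <;> cases m <;>
    simp [actBasis] <;> module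

/-- The action of `U_20(λ)` on the model. -/
noncomputable def rep (lam : k) : U k lam →ₐ[k] Module.End k (Model k) :=
  RingQuot.liftAlgHom k ⟨FreeAlgebra.lift k (act lam), lift_act_of_rel lam⟩

@[simp] theorem rep_mk_g (lam : k) (x : Gen) : rep lam (mk k lam (g k x)) = act lam x := by
  simp [rep, mk, g]

end Representation

section Comparison

variable {k}

/-- The exponent vector in `Exps` as a function on the generators. -/
def expsEquiv : Exps ≃ (Gen → Fin 2) where
  toFun := fun (i, j, l, m, e, f, s, h) x =>
    finTwoEquiv.symm (match x with
      | p1 => i | p2 => j | q1 => l | q2 => m | a => e | b => f | c => s | d => h)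
  invFun t := (finTwoEquiv (t p1), finTwoEquiv (t p2), finTwoEquiv (t q1), finTwoEquiv (t q2),
    finTwoEquiv (t a), finTwoEquiv (t b), finTwoEquiv (t c), finTwoEquiv (t d))
  left_inv := fun _ => by simp
  right_inv t := by ext x; cases x <;> simp

/-- The image of a generator in `U_20(λ)`. -/
noncomputable def gen (lam : k) (x : Gen) : U k lam := mk k lam (g k x)

/-- The image of `a^e b^f c^s d^h` in `U_20(λ)`. -/
noncomputable def groupMono (lam : k) (e f s h : Bool) : U k lam :=
  gen lam a ^ e.toNat * (gen lam b ^ f.toNat * (gen lam c ^ s.toNat * gen lam d ^ h.toNat))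

theorem mono_expsEquiv (lam : k) (i j l m e f s h : Bool) :
    mono k lam (expsEquiv (i, j, l, m, e, f, s, h)) =
      gen lam p1 ^ i.toNat * (gen lam p2 ^ j.toNat * (gen lam q1 ^ l.toNat *
        (gen lam q2 ^ m.toNat * groupMono lam e f s h))) := by
  have H (x : Bool) : (finTwoEquiv.symm x : Fin 2).val = x.toNat := by cases x <;> rfl
  simp [mono, expsEquiv, groupMono, gen, H, mul_assoc]

theorem mul_mul_of_mul_eq {R : Type*} [Semigroup R] {x y z : R} (H : x * y = z) (t : R) :
    x * (y * t) = z * t := by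
  rw [← mul_assoc, H]

theorem mk_eq_of_rel (lam : k) {r s : FreeAlgebra k Gen} (H : Rel k lam r s) :
    mk k lam r = mk k lam s :=
  RingQuot.mkAlgHom_rel k H

theorem gen_a_mul_gen_a (lam : k) :
    gen lam a * gen lam a = 1 := by
  simpa [gen] using mk_eq_of_rel lam .haa

theorem gen_b_mul_gen_b (lam : k) :
    gen lam b * gen lam b = 1 := by
  simpa [gen] using mk_eq_of_rel lam .hbb

theorem gen_c_mul_gen_c (lam : k) :
    gen lam c * gen lam c = 1 := by
  simpa [gen] using mk_eq_of_rel lam .hcc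

theorem gen_b_mul_gen_a (lam : k) :
    gen lam b * gen lam a = gen lam a * gen lam b := by
  simpa [gen] using (mk_eq_of_rel lam .hab).symm

theorem gen_c_mul_gen_a (lam : k) :
    gen lam c * gen lam a = gen lam a * gen lam c := by
  simpa [gen] using (mk_eq_of_rel lam .hac).symm

theorem gen_c_mul_gen_b (lam : k) :
    gen lam c * gen lam b = gen lam b * gen lam c := by
  simpa [gen] using (mk_eq_of_rel lam .hbc).symm

theorem gen_d_mul_gen_d (lam : k) :
    gen lam d * gen lam d = gen lam a := by
  simpa [gen] using mk_eq_of_rel lam .hdd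

theorem gen_d_mul_gen_a (lam : k) :
    gen lam d * gen lam a = gen lam a * gen lam d := by
  simpa [gen] using mk_eq_of_rel lam .hda

theorem gen_d_mul_gen_b (lam : k) :
    gen lam d * gen lam b = gen lam c * gen lam d := by
  simpa [gen] using mk_eq_of_rel lam .hdb

theorem gen_d_mul_gen_c (lam : k) :
    gen lam d * gen lam c = gen lam b * gen lam d := by
  simpa [gen] using mk_eq_of_rel lam .hdc

theorem gen_a_mul_gen_p1 (lam : k) :
    gen lam a * gen lam p1 = gen lam p1 * gen lam a := by
  simpa [gen] using mk_eq_of_rel lam .ap1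

theorem gen_b_mul_gen_p1 (lam : k) :
    gen lam b * gen lam p1 = gen lam p1 * gen lam b := by
  simpa [gen] using mk_eq_of_rel lam .bp1

theorem gen_c_mul_gen_p1 (lam : k) :
    gen lam c * gen lam p1 = (-1 : k) • (gen lam p1 * gen lam c) := by
  simpa only [gen, map_mul, map_smul] using
    (mk_eq_of_rel lam .cp1).trans (congrArg _ (neg_one_smul k _).symm)

theorem gen_d_mul_gen_p1 (lam : k) :
    gen lam d * gen lam p1 = gen lam p2 * gen lam a * gen lam d := by
  simpa [gen] using mk_eq_of_rel lam .dp1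

theorem gen_a_mul_gen_p2 (lam : k) :
    gen lam a * gen lam p2 = gen lam p2 * gen lam a := by
  simpa [gen] using mk_eq_of_rel lam .ap2

theorem gen_b_mul_gen_p2 (lam : k) :
    gen lam b * gen lam p2 = (-1 : k) • (gen lam p2 * gen lam b) := by
  simpa only [gen, map_mul, map_smul] using
    (mk_eq_of_rel lam .bp2).trans (congrArg _ (neg_one_smul k _).symm)

theorem gen_c_mul_gen_p2 (lam : k) :
    gen lam c * gen lam p2 = gen lam p2 * gen lam c := by
  simpa [gen] using mk_eq_of_rel lam .cp2

theorem gen_d_mul_gen_p2 (lam : k) :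
    gen lam d * gen lam p2 = gen lam p1 * gen lam a * gen lam d := by
  simpa [gen] using mk_eq_of_rel lam .dp2

theorem gen_a_mul_gen_q1 (lam : k) :
    gen lam a * gen lam q1 = gen lam q1 * gen lam a := by
  simpa [gen] using mk_eq_of_rel lam .aq1

theorem gen_b_mul_gen_q1 (lam : k) :
    gen lam b * gen lam q1 = (-1 : k) • (gen lam q1 * gen lam b) := by
  simpa only [gen, map_mul, map_smul] using
    (mk_eq_of_rel lam .bq1).trans (congrArg _ (neg_one_smul k _).symm)

theorem gen_c_mul_gen_q1 (lam : k) :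
    gen lam c * gen lam q1 = gen lam q1 * gen lam c := by
  simpa [gen] using mk_eq_of_rel lam .cq1

theorem gen_d_mul_gen_q1 (lam : k) :
    gen lam d * gen lam q1 = gen lam q2 * gen lam a * gen lam d := by
  simpa [gen] using mk_eq_of_rel lam .dq1

theorem gen_a_mul_gen_q2 (lam : k) :
    gen lam a * gen lam q2 = gen lam q2 * gen lam a := by
  simpa [gen] using mk_eq_of_rel lam .aq2

theorem gen_b_mul_gen_q2 (lam : k) :
    gen lam b * gen lam q2 = gen lam q2 * gen lam b := by
  simpa [gen] using mk_eq_of_rel lam .bq2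

theorem gen_c_mul_gen_q2 (lam : k) :
    gen lam c * gen lam q2 = (-1 : k) • (gen lam q2 * gen lam c) := by
  simpa only [gen, map_mul, map_smul] using
    (mk_eq_of_rel lam .cq2).trans (congrArg _ (neg_one_smul k _).symm)

theorem gen_d_mul_gen_q2 (lam : k) :
    gen lam d * gen lam q2 = gen lam q1 * gen lam a * gen lam d := by
  simpa [gen] using mk_eq_of_rel lam .dq2

theorem gen_p1_mul_gen_p1 (lam : k) :
    gen lam p1 * gen lam p1 = 0 := by
  simpa [gen] using mk_eq_of_rel lam .p1p1

theorem gen_p2_mul_gen_p2 (lam : k) :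
    gen lam p2 * gen lam p2 = 0 := by
  simpa [gen] using mk_eq_of_rel lam .p2p2

theorem gen_q1_mul_gen_q1 (lam : k) :
    gen lam q1 * gen lam q1 = 0 := by
  simpa [gen] using mk_eq_of_rel lam .q1q1

theorem gen_q2_mul_gen_q2 (lam : k) :
    gen lam q2 * gen lam q2 = 0 := by
  simpa [gen] using mk_eq_of_rel lam .q2q2

theorem eq_add_smul_of_add_eq {M : Type*} [AddCommMonoid M] [Module k M] {x y z : M}
    (H : x + y = z) : y = z + (-1 : k) • x := by
  rw [← H]
  module

theorem gen_p2_mul_gen_p1 (lam : k) :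
    gen lam p2 * gen lam p1 = (-1 : k) • (gen lam p1 * gen lam p2) := by
  refine (eq_add_smul_of_add_eq ?_).trans (zero_add _)
  simpa [gen] using mk_eq_of_rel lam .p1p2

theorem gen_q2_mul_gen_q1 (lam : k) :
    gen lam q2 * gen lam q1 = (-1 : k) • (gen lam q1 * gen lam q2) := by
  refine (eq_add_smul_of_add_eq ?_).trans (zero_add _)
  simpa [gen] using mk_eq_of_rel lam .q1q2

theorem gen_q1_mul_gen_p1 (lam : k) :
    gen lam q1 * gen lam p1 = (-1 : k) • (gen lam p1 * gen lam q1) := by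
  refine (eq_add_smul_of_add_eq ?_).trans (zero_add _)
  simpa [gen] using mk_eq_of_rel lam .p1q1

theorem gen_q2_mul_gen_p2 (lam : k) :
    gen lam q2 * gen lam p2 = (-1 : k) • (gen lam p2 * gen lam q2) := by
  refine (eq_add_smul_of_add_eq ?_).trans (zero_add _)
  simpa [gen] using mk_eq_of_rel lam .p2q2

theorem gen_q2_mul_gen_p1 (lam : k) :
    gen lam q2 * gen lam p1 =
      lam • 1 + (-lam) • gen lam a + (-1 : k) • (gen lam p1 * gen lam q2) := by
  have H : lam • (1 - g k a) = lam • 1 + (-lam) • g k a := by module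
  exact eq_add_smul_of_add_eq (by
    simpa only [gen, map_mul, map_smul, map_add, map_one, H] using mk_eq_of_rel lam .p1q2)

theorem gen_q1_mul_gen_p2 (lam : k) :
    gen lam q1 * gen lam p2 =
      lam • 1 + (-lam) • gen lam a + (-1 : k) • (gen lam p2 * gen lam q1) := by
  have H : lam • (1 - g k a) = lam • 1 + (-lam) • g k a := by module
  exact eq_add_smul_of_add_eq (by
    simpa only [gen, map_mul, map_smul, map_add, map_one, H] using mk_eq_of_rel lam .p2q1)

theorem gen_a_mul_groupMono (lam : k) (e f s h : Bool) :
    gen lam a * groupMono lam e f s h = groupMono lam (!e) f s h := by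
  cases e <;> cases f <;> cases s <;> cases h <;>
    simp [groupMono,
      gen_a_mul_gen_a, mul_mul_of_mul_eq (gen_a_mul_gen_a lam)]

theorem gen_b_mul_groupMono (lam : k) (e f s h : Bool) :
    gen lam b * groupMono lam e f s h = groupMono lam e (!f) s h := by
  cases e <;> cases f <;> cases s <;> cases h <;>
    simp [groupMono,
      mul_assoc, gen_b_mul_gen_b, mul_mul_of_mul_eq (gen_b_mul_gen_b lam), gen_b_mul_gen_a,
      mul_mul_of_mul_eq (gen_b_mul_gen_a lam)]

theorem gen_c_mul_groupMono (lam : k) (e f s h : Bool) :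
    gen lam c * groupMono lam e f s h = groupMono lam e f (!s) h := by
  cases e <;> cases f <;> cases s <;> cases h <;>
    simp [groupMono,
      mul_assoc, gen_c_mul_gen_c, mul_mul_of_mul_eq (gen_c_mul_gen_c lam), gen_c_mul_gen_a,
      mul_mul_of_mul_eq (gen_c_mul_gen_a lam), gen_c_mul_gen_b,
      mul_mul_of_mul_eq (gen_c_mul_gen_b lam)]

theorem gen_d_mul_groupMono (lam : k) (e f s h : Bool) :
    gen lam d * groupMono lam e f s h = groupMono lam (h ^^ e) s f (!h) := by
  cases e <;> cases f <;> cases s <;> cases h <;>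
    simp [groupMono,
      mul_assoc, gen_a_mul_gen_a, mul_mul_of_mul_eq (gen_a_mul_gen_a lam), gen_d_mul_gen_d,
      gen_d_mul_gen_a, mul_mul_of_mul_eq (gen_d_mul_gen_a lam), gen_d_mul_gen_b,
      mul_mul_of_mul_eq (gen_d_mul_gen_b lam), gen_d_mul_gen_c,
      mul_mul_of_mul_eq (gen_d_mul_gen_c lam), gen_b_mul_gen_a, gen_c_mul_gen_a,
      mul_mul_of_mul_eq (gen_c_mul_gen_a lam), gen_c_mul_gen_b,
      mul_mul_of_mul_eq (gen_c_mul_gen_b lam)]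

/-- The linear map from the model to `U_20(λ)` sending basis vectors to ordered monomials. -/
noncomputable def ofModel (lam : k) : Model k →ₗ[k] U k lam :=
  Finsupp.linearCombination k fun t => mono k lam (expsEquiv t)

theorem ofModel_vec (lam : k) (i j l m e f s h : Bool) :
    ofModel lam (vec i j l m e f s h) = gen lam p1 ^ i.toNat * (gen lam p2 ^ j.toNat *
      (gen lam q1 ^ l.toNat * (gen lam q2 ^ m.toNat * groupMono lam e f s h))) := by
  simp [ofModel, vec, ← mono_expsEquiv]

set_option maxHeartbeats 4000000 in
theorem ofModel_act (lam : k) (x : Gen) (v : Model k) :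
    ofModel lam (act lam x v) = gen lam x * ofModel lam v := by
  suffices H : ofModel lam ∘ₗ act lam x = LinearMap.mulLeft k (gen lam x) ∘ₗ ofModel lam from
    LinearMap.congr_fun H v
  refine model_hom_ext fun i j l m e f s h => ?_
  cases x <;> cases i <;> cases j <;> cases l <;> cases m <;>
    simp [-neg_smul, actBasis, ofModel_vec, gen_a_mul_groupMono, gen_b_mul_groupMono,
      gen_c_mul_groupMono, gen_d_mul_groupMono, add_mul, mul_add, mul_assoc,
      mul_mul_of_mul_eq (gen_a_mul_gen_p1 lam), mul_mul_of_mul_eq (gen_b_mul_gen_p1 lam),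
      mul_mul_of_mul_eq (gen_c_mul_gen_p1 lam), mul_mul_of_mul_eq (gen_d_mul_gen_p1 lam),
      mul_mul_of_mul_eq (gen_a_mul_gen_p2 lam), mul_mul_of_mul_eq (gen_b_mul_gen_p2 lam),
      mul_mul_of_mul_eq (gen_c_mul_gen_p2 lam), mul_mul_of_mul_eq (gen_d_mul_gen_p2 lam),
      mul_mul_of_mul_eq (gen_a_mul_gen_q1 lam), mul_mul_of_mul_eq (gen_b_mul_gen_q1 lam),
      mul_mul_of_mul_eq (gen_c_mul_gen_q1 lam), mul_mul_of_mul_eq (gen_d_mul_gen_q1 lam),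
      mul_mul_of_mul_eq (gen_a_mul_gen_q2 lam), mul_mul_of_mul_eq (gen_b_mul_gen_q2 lam),
      mul_mul_of_mul_eq (gen_c_mul_gen_q2 lam), mul_mul_of_mul_eq (gen_d_mul_gen_q2 lam),
      mul_mul_of_mul_eq (gen_p1_mul_gen_p1 lam), mul_mul_of_mul_eq (gen_p2_mul_gen_p2 lam),
      mul_mul_of_mul_eq (gen_q1_mul_gen_q1 lam), mul_mul_of_mul_eq (gen_q2_mul_gen_q2 lam),
      mul_mul_of_mul_eq (gen_p2_mul_gen_p1 lam), mul_mul_of_mul_eq (gen_q2_mul_gen_q1 lam),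
      mul_mul_of_mul_eq (gen_q1_mul_gen_p1 lam), mul_mul_of_mul_eq (gen_q2_mul_gen_p2 lam),
      mul_mul_of_mul_eq (gen_q2_mul_gen_p1 lam), mul_mul_of_mul_eq (gen_q1_mul_gen_p2 lam)] <;>
    module

theorem ofModel_rep (lam : k) (u : U k lam) (v : Model k) :
    ofModel lam (rep lam u v) = u * ofModel lam v := by
  obtain ⟨r, rfl⟩ := RingQuot.mkAlgHom_surjective k (Rel k lam) u
  induction r using FreeAlgebra.induction generalizing v with
  | grade0 t => simp [Algebra.smul_def]
  | grade1 x =>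
    have H := ofModel_act lam x v
    rwa [← rep_mk_g] at H
  | mul r s hr hs => simp [hr, hs, mul_assoc]
  | add r s hr hs => simp [hr, hs, add_mul]

/-- The basis vector of the model attached to the empty monomial. -/
noncomputable def vacuum : Model k := vec false false false false false false false false

theorem ofModel_vacuum (lam : k) : ofModel lam vacuum = 1 := by
  simp [vacuum, ofModel_vec, groupMono]

theorem rep_mono_vacuum (lam : k) (t : Exps) :
    rep lam (mono k lam (expsEquiv t)) vacuum = Finsupp.single t 1 := by
  obtain ⟨i, j, l, m, e, f, s, h⟩ := t
  rw [mono_expsEquiv]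
  change _ = vec i j l m e f s h
  have H (x : Gen) : rep lam (gen lam x) = act lam x := rep_mk_g lam x
  have hg : rep lam (groupMono lam e f s h) vacuum = vec false false false false e f s h := by
    cases e <;> cases f <;> cases s <;> cases h <;> simp [groupMono, vacuum, H, actBasis]
  cases i <;> cases j <;> cases l <;> cases m <;> simp [hg, H, actBasis]

/-- Applying elements of `U_20(λ)` to the vacuum identifies `U_20(λ)` with the model. -/
noncomputable def modelEquiv (lam : k) : U k lam ≃ₗ[k] Model k :=
  LinearEquiv.ofLinearMap ((rep lam).toLinearMap.flip vacuum) (ofModel lam)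
    (Finsupp.lhom_ext' fun t => LinearMap.ext_ring <| by
      simpa [ofModel] using rep_mono_vacuum lam t)
    (LinearMap.ext fun u => by simp [ofModel_rep, ofModel_vacuum])

/-- The basis of `U_20(λ)` formed by the ordered monomials. -/
noncomputable def monoBasis (lam : k) : Module.Basis (Gen → Fin 2) k (U k lam) :=
  (Module.Basis.ofRepr (modelEquiv lam)).reindex expsEquiv

theorem coe_monoBasis (lam : k) : ⇑(monoBasis lam) = mono k lam := by
  ext t
  simp [monoBasis, modelEquiv, ofModel]

end Comparison

theorem thm [IsAlgClosed k] [CharZero k] (lam : k) :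
    Module.finrank k (U k lam) = 256 ∧
    LinearIndependent k (mono k lam) ∧
    Submodule.span k (Set.range (mono k lam)) = ⊤ := by
  refine ⟨?_, coe_monoBasis lam ▸ (monoBasis lam).linearIndependent,
    coe_monoBasis lam ▸ (monoBasis lam).span_eq⟩
  rw [(modelEquiv lam).finrank_eq, Module.finrank_finsupp_self]
  simp

end Stmt9
end
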